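/- arXiv:1408.6979 — 2 statements merged into one kernel-verified Lean document; each statement's English description precedes it below -/
import Mathlib

section
/- For every dimension d ≥ 1 and every ε > 0 there exists δ > 0, depending only on d and ε, such that the following holds. Let μ be a Radon measure on ℝ^d and B₀ ⊂ ℝ^d a ball with 0 < μ(B̄₀) and μ(2B₀) ≤ 9·μ(B̄₀). If ∫_{δ r(B₀)}^{δ^{-1} r(B₀)} ∫_{x ∈ δ^{-1}B₀} Δ_μ(x,r) dμ(x) (dr/r) ≤ δ^{1/2}·μ(B̄₀)²/r(B₀), then dist_{2B₀}(μ, F) < ε·r(B₀)·μ(B̄₀), where F denotes the family of 1-flat measures. -/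
open MeasureTheory Metric
open scoped ENNReal NNReal

/-- `Δ_μ(x,r) = |μ(B(x,r))/r − μ(B(x,2r))/(2r)|`. -/
noncomputable def ballDelta {d : ℕ} (μ : Measure (EuclideanSpace ℝ (Fin d)))
    (x : EuclideanSpace ℝ (Fin d)) (r : ℝ) : ℝ :=
  |(μ (ball x r)).toReal / r - (μ (ball x (2 * r))).toReal / (2 * r)|

/-- `L` is an affine line in `ℝ^d`. -/
def IsLine {d : ℕ} (L : Set (EuclideanSpace ℝ (Fin d))) : Prop :=
  ∃ x v : EuclideanSpace ℝ (Fin d), v ≠ 0 ∧ L = {y | ∃ t : ℝ, y = x + t • v}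

/-- A measure is 1-flat if it is a positive multiple of `H^1` restricted to a line. -/
def IsFlat {d : ℕ} (σ : Measure (EuclideanSpace ℝ (Fin d))) : Prop :=
  ∃ c : ℝ, 0 < c ∧ ∃ L : Set (EuclideanSpace ℝ (Fin d)), IsLine L ∧
    σ = (ENNReal.ofReal c) • (μH[1].restrict L)

/-- `dist_B(σ,ν)`: supremum of `|∫ f dσ − ∫ f dν|` over 1-Lipschitz `f` supported in `B`. -/
noncomputable def distB {d : ℕ} (B : Set (EuclideanSpace ℝ (Fin d)))
    (σ ν : Measure (EuclideanSpace ℝ (Fin d))) : ℝ :=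
  ⨆ f : {f : EuclideanSpace ℝ (Fin d) → ℝ // LipschitzWith 1 f ∧ Function.support f ⊆ B},
    |(∫ x, f.1 x ∂σ) - ∫ x, f.1 x ∂ν|

/-- `dist_B(μ, F)`: distance from `μ` to the family of 1-flat measures. -/
noncomputable def distToFlat {d : ℕ} (B : Set (EuclideanSpace ℝ (Fin d)))
    (μ : Measure (EuclideanSpace ℝ (Fin d))) : ℝ :=
  ⨅ σ : {σ : Measure (EuclideanSpace ℝ (Fin d)) // IsFlat σ}, distB B μ σ.1



section
open MeasureTheory Metric
open scoped ENNReal NNReal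

set_option linter.unusedSectionVars false
set_option linter.unusedVariables false
namespace FlatPf

section

variable {V : Type*} [NormedAddCommGroup V] [InnerProductSpace ℝ V] [FiniteDimensional ℝ V]
  [MeasurableSpace V] [BorelSpace V]

/-- Uniformly distributed measures with dyadically homogeneous ball function. -/
structure Unif (μ : Measure V) (S : Set V) (g : ℝ → ℝ) : Prop where
  closed : IsClosed S
  null : μ Sᶜ = 0
  ball : ∀ x ∈ S, ∀ r, 0 < r → μ.real (ball x r) = g r
  pos : ∀ r, 0 < r → 0 < g r
  dbl : ∀ r, 0 < r → g (2 * r) = 2 * g r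

/-- The truncated paraboloid. -/
noncomputable def vv (R : ℝ) (y : V) : ℝ := max (R ^ 2 - ‖y‖ ^ 2) 0

noncomputable def aa (μ : Measure V) (R : ℝ) : ℝ := ∫ y, vv R y ∂μ
noncomputable def ZZ (μ : Measure V) (R : ℝ) : ℝ := ∫ y, (vv R y) ^ 2 ∂μ

lemma vv_nonneg (R : ℝ) (y : V) : 0 ≤ vv R y := le_max_right _ _
lemma vv_le (R : ℝ) (y : V) : vv R y ≤ R ^ 2 := by
  unfold vv; exact max_le (by nlinarith [sq_nonneg ‖y‖]) (sq_nonneg R)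
@[fun_prop]
lemma vv_cont (R : ℝ) : Continuous (vv R : V → ℝ) := by unfold vv; fun_prop
lemma vv_zero {R : ℝ} (hR : 0 ≤ R) {y : V} (h : R ≤ ‖y‖) : vv R y = 0 := by
  unfold vv; apply max_eq_right; nlinarith [norm_nonneg y]

lemma integ (μ : Measure V) [IsLocallyFiniteMeasure μ] {f : V → ℝ} (hf : Continuous f) (R : ℝ)
    (h : ∀ y, R < ‖y‖ → f y = 0) : Integrable f μ := by
  apply hf.integrable_of_hasCompactSupport
  apply HasCompactSupport.intro (isCompact_closedBall (0 : V) R)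
  intro y hy
  apply h
  simpa using hy

lemma integ_vv (μ : Measure V) [IsLocallyFiniteMeasure μ] {R : ℝ} (hR : 0 ≤ R) {f : V → ℝ}
    (hf : Continuous f) : Integrable (fun y => vv R y * f y) μ :=
  integ μ (by fun_prop) R (fun y hy => by simp [vv_zero hR hy.le])

lemma integ_vv2 (μ : Measure V) [IsLocallyFiniteMeasure μ] {R : ℝ} (hR : 0 ≤ R) {f : V → ℝ}
    (hf : Continuous f) : Integrable (fun y => (vv R y) ^ 2 * f y) μ :=
  integ μ (by fun_prop) R (fun y hy => by simp [vv_zero hR hy.le])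

lemma ball_ne_top (μ : Measure V) [IsLocallyFiniteMeasure μ] (x : V) (r : ℝ) :
    μ (Metric.ball x r) ≠ ⊤ := measure_ball_lt_top.ne

lemma map_eq_of_ball {μ : Measure V} [IsLocallyFiniteMeasure μ] {p q : V → ℝ} {c : ℝ≥0∞}
    (hp : Measurable p) (hq : Measurable q) (x : V) (l : ℝ) (hl : 0 < l)
    (hqx : ∀ y r, q y < r ↔ y ∈ Metric.ball x (l * r))
    (h : ∀ r, μ {y | q y < r} = c * μ {y | p y < r}) :
    Measure.map q μ = c • Measure.map p μ := by
  apply Measure.ext_of_generateFrom_of_iUnion (Set.range Set.Iio) (fun n : ℕ => Set.Iio (n : ℝ))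
  · rw [← borel_eq_generateFrom_Iio]; exact BorelSpace.measurable_eq
  · exact isPiSystem_Iio
  · ext t
    simp only [Set.mem_iUnion, Set.mem_Iio, Set.mem_univ, iff_true]
    exact exists_nat_gt t
  · intro i; exact ⟨_, rfl⟩
  · intro i
    rw [Measure.map_apply hq measurableSet_Iio]
    have : q ⁻¹' Set.Iio (i : ℝ) = Metric.ball x (l * i) := by
      ext y; exact hqx y i
    rw [this]; exact ball_ne_top _ _ _
  · rintro s ⟨r, rfl⟩
    rw [Measure.smul_apply, Measure.map_apply hq measurableSet_Iio,
      Measure.map_apply hp measurableSet_Iio]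
    exact h r

variable {μ : Measure V} [IsLocallyFiniteMeasure μ] {S : Set V} {g : ℝ → ℝ}

lemma Unif.mball (h : Unif μ S g) {x : V} (hx : x ∈ S) {r : ℝ} (hr : 0 < r) :
    μ (Metric.ball x r) = ENNReal.ofReal (g r) := by
  rw [← h.ball x hx r hr, Measure.real, ENNReal.ofReal_toReal (ball_ne_top _ _ _)]

lemma Unif.radial (h : Unif μ S g) (h0 : (0 : V) ∈ S) {x : V} (hx : x ∈ S) (Φ : ℝ → ℝ)
    (hΦ : Continuous Φ) : ∫ y, Φ ‖y - x‖ ∂μ = ∫ y, Φ ‖y‖ ∂μ := by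
  have key : Measure.map (fun y => ‖y - x‖) μ = (1 : ℝ≥0∞) • Measure.map (fun y => ‖y‖) μ := by
    apply map_eq_of_ball (by fun_prop) (by fun_prop) x 1 one_pos
    · intro y r; simp [dist_eq_norm]
    · intro r
      have e1 : {y : V | ‖y - x‖ < r} = Metric.ball x r := by ext y; simp [dist_eq_norm]
      have e2 : {y : V | ‖y‖ < r} = Metric.ball 0 r := by ext y; simp
      rw [e1, e2, one_mul]
      rcases le_or_gt r 0 with hr | hr
      · rw [Metric.ball_eq_empty.2 hr, Metric.ball_eq_empty.2 hr]
      · rw [h.mball hx hr, h.mball h0 hr]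
  rw [one_smul] at key
  have e1 := integral_map (μ := μ) (φ := fun y => ‖y - x‖) (by fun_prop) (f := Φ)
    hΦ.aestronglyMeasurable
  have e2 := integral_map (μ := μ) (φ := fun y : V => ‖y‖) (by fun_prop) (f := Φ)
    hΦ.aestronglyMeasurable
  rw [← e1, key, e2]

lemma Unif.scale (h : Unif μ S g) (h0 : (0 : V) ∈ S) (Φ : ℝ → ℝ)
    (hΦ : Continuous Φ) : ∫ y, Φ (‖y‖ / 2) ∂μ = 2 * ∫ y, Φ ‖y‖ ∂μ := by
  have key : Measure.map (fun y : V => ‖y‖ / 2) μ = (2 : ℝ≥0∞) • Measure.map (fun y => ‖y‖) μ := by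
    apply map_eq_of_ball (by fun_prop) (by fun_prop) 0 2 two_pos
    · intro y r; simp [div_lt_iff₀, mul_comm]
    · intro r
      have e1 : {y : V | ‖y‖ / 2 < r} = Metric.ball 0 (2 * r) := by
        ext y; simp [div_lt_iff₀, mul_comm]
      have e2 : {y : V | ‖y‖ < r} = Metric.ball 0 r := by ext y; simp
      rw [e1, e2]
      rcases le_or_gt r 0 with hr | hr
      · rw [Metric.ball_eq_empty.2 hr, Metric.ball_eq_empty.2 (by linarith)]; simp
      · rw [h.mball h0 hr, h.mball h0 (by linarith), h.dbl r hr,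
          ENNReal.ofReal_mul (by norm_num)]; simp
  have e1 := integral_map (μ := μ) (φ := fun y : V => ‖y‖ / 2) (by fun_prop) (f := Φ)
    hΦ.aestronglyMeasurable
  have e2 := integral_map (μ := μ) (φ := fun y : V => ‖y‖) (by fun_prop) (f := Φ)
    hΦ.aestronglyMeasurable
  rw [← e1, key, integral_smul_measure, e2]; simp

lemma Unif.gmono (h : Unif μ S g) (h0 : (0 : V) ∈ S) {r s : ℝ} (hr : 0 < r) (hrs : r ≤ s) :
    g r ≤ g s := by
  rw [← h.ball 0 h0 r hr, ← h.ball 0 h0 s (hr.trans_le hrs)]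
  exact measureReal_mono (Metric.ball_subset_ball hrs) (ball_ne_top _ _ _)

lemma Unif.gpow (h : Unif μ S g) (k : ℕ) {r : ℝ} (hr : 0 < r) :
    g (2 ^ k * r) = 2 ^ k * g r := by
  induction k with
  | zero => simp
  | succ k ih =>
    rw [pow_succ, show (2 : ℝ) ^ k * 2 * r = 2 * (2 ^ k * r) by ring, h.dbl _ (by positivity), ih]
    ring

lemma Unif.mem_of_open (h : Unif μ S g) {U : Set V} (hU : IsOpen U) (hU0 : μ U = 0) {x : V}
    (hx : x ∈ S) : x ∉ U := by
  intro hxU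
  obtain ⟨r, hr, hb⟩ := Metric.isOpen_iff.1 hU x hxU
  have := h.mball hx hr
  rw [measure_mono_null hb hU0] at this
  have h2 := h.pos r hr
  have := (ENNReal.ofReal_eq_zero.1 this.symm)
  linarith

lemma Unif.ae_mem (h : Unif μ S g) : ∀ᵐ y ∂μ, y ∈ S := h.null

lemma Unif.ZZ_two (h : Unif μ S g) (h0 : (0 : V) ∈ S) (R : ℝ) :
    ZZ μ (2 * R) = 32 * ZZ μ R := by
  have := h.scale h0 (fun t => (max (R ^ 2 - t ^ 2) 0) ^ 2) (by fun_prop)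
  unfold ZZ vv
  have e : ∀ y : V, (max ((2 * R) ^ 2 - ‖y‖ ^ 2) 0) ^ 2
      = 16 * (max (R ^ 2 - (‖y‖ / 2) ^ 2) 0) ^ 2 := by
    intro y
    have : max ((2 * R) ^ 2 - ‖y‖ ^ 2) 0 = 4 * max (R ^ 2 - (‖y‖ / 2) ^ 2) 0 := by
      rw [mul_max_of_nonneg _ _ (by norm_num : (0 : ℝ) ≤ 4)]; congr 1 <;> ring
    rw [this]; ring
  simp_rw [e]
  rw [integral_const_mul, this]; ring

lemma Unif.ZZ_pow (h : Unif μ S g) (h0 : (0 : V) ∈ S) (k : ℕ) (R : ℝ) :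
    ZZ μ (2 ^ k * R) = 32 ^ k * ZZ μ R := by
  induction k with
  | zero => simp
  | succ k ih =>
    rw [pow_succ, show (2 : ℝ) ^ k * 2 * R = 2 * (2 ^ k * R) by ring, h.ZZ_two h0, ih]
    ring

lemma Unif.aa_two (h : Unif μ S g) (h0 : (0 : V) ∈ S) (R : ℝ) :
    aa μ (2 * R) = 8 * aa μ R := by
  have := h.scale h0 (fun t => (max (R ^ 2 - t ^ 2) 0)) (by fun_prop)
  unfold aa vv
  have e : ∀ y : V, (max ((2 * R) ^ 2 - ‖y‖ ^ 2) 0)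
      = 4 * (max (R ^ 2 - (‖y‖ / 2) ^ 2) 0) := by
    intro y
    rw [mul_max_of_nonneg _ _ (by norm_num : (0 : ℝ) ≤ 4)]; congr 1 <;> ring
  simp_rw [e]
  rw [integral_const_mul, this]; ring

lemma Unif.aa_pow (h : Unif μ S g) (h0 : (0 : V) ∈ S) (k : ℕ) (R : ℝ) :
    aa μ (2 ^ k * R) = 8 ^ k * aa μ R := by
  induction k with
  | zero => simp
  | succ k ih =>
    rw [pow_succ, show (2 : ℝ) ^ k * 2 * R = 2 * (2 ^ k * R) by ring, h.aa_two h0, ih]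
    ring

lemma Unif.ZZ_pos (h : Unif μ S g) (h0 : (0 : V) ∈ S) {R : ℝ} (hR : 0 < R) : 0 < ZZ μ R := by
  have h1 : (R ^ 2 - (R / 2) ^ 2) ^ 2 * g (R / 2) ≤ ZZ μ R := by
    rw [← h.ball 0 h0 (R / 2) (by positivity)]
    have : (R ^ 2 - (R / 2) ^ 2) ^ 2 * μ.real (Metric.ball (0 : V) (R / 2))
        = ∫ y, (Metric.ball (0 : V) (R / 2)).indicator (fun _ => (R ^ 2 - (R / 2) ^ 2) ^ 2) y ∂μ := by
      rw [integral_indicator_const _ measurableSet_ball]; simp [mul_comm]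
    rw [this]
    apply integral_mono
    · exact (integrable_indicator_iff measurableSet_ball).2
        (integrableOn_const (ball_ne_top _ _ _))
    · simpa using integ_vv2 μ hR.le (f := fun _ => 1) (by fun_prop)
    · intro y
      by_cases hy : y ∈ Metric.ball (0 : V) (R / 2)
      · simp only [Set.indicator_of_mem hy]
        have hy' : ‖y‖ < R / 2 := by simpa using hy
        have h2 : R ^ 2 - (R / 2) ^ 2 ≤ vv R y := by
          unfold vv; apply le_max_of_le_left; nlinarith [norm_nonneg y]
        have : 0 ≤ R ^ 2 - (R / 2) ^ 2 := by nlinarith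
        exact pow_le_pow_left₀ this h2 2
      · simp only [Set.indicator_of_notMem hy]; positivity
  have h2 : 0 < R ^ 2 - (R / 2) ^ 2 := by nlinarith
  have h3 := h.pos (R / 2) (by positivity)
  have : 0 < (R ^ 2 - (R / 2) ^ 2) ^ 2 * g (R / 2) := by positivity
  linarith

end
end FlatPf
end

section
open MeasureTheory Metric
open scoped ENNReal NNReal
set_option linter.unusedSectionVars false
set_option linter.unusedVariables false

namespace FlatPf
section
variable {V : Type*} [NormedAddCommGroup V] [InnerProductSpace ℝ V] [FiniteDimensional ℝ V]
  [MeasurableSpace V] [BorelSpace V]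
variable {μ : Measure V} [IsLocallyFiniteMeasure μ] {S : Set V} {g : ℝ → ℝ}

lemma int_sub {f g : V → ℝ} (hf : Integrable f μ) (hg : Integrable g μ) :
    Integrable (fun y => f y - g y) μ := hf.sub hg
lemma int_add {f g : V → ℝ} (hf : Integrable f μ) (hg : Integrable g μ) :
    Integrable (fun y => f y + g y) μ := hf.add hg

lemma hasDerivAt_maxsq (t : ℝ) : HasDerivAt (fun t : ℝ => (max t 0) ^ 2) (2 * max t 0) t := by
  rcases lt_trichotomy t 0 with h | h | h
  · rw [max_eq_right h.le]
    have : (fun t : ℝ => (max t 0) ^ 2) =ᶠ[nhds t] fun _ => 0 := by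
      filter_upwards [Iio_mem_nhds h] with s hs
      rw [max_eq_right (le_of_lt hs)]; ring
    simpa using (hasDerivAt_const t (0 : ℝ)).congr_of_eventuallyEq this
  · subst h
    rw [hasDerivAt_iff_isLittleO]
    simp only [max_self, sub_zero]
    have : (fun x : ℝ => max x 0 ^ 2 - 0 ^ 2 - x • (2 * (0 : ℝ))) =O[nhds 0] fun x : ℝ => x ^ 2 := by
      apply Asymptotics.IsBigO.of_bound 1
      filter_upwards with x
      rw [show max x 0 ^ 2 - 0 ^ 2 - x • (2 * (0 : ℝ)) = max x 0 ^ 2 by simp, Real.norm_eq_abs,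
        Real.norm_eq_abs, one_mul]
      rw [abs_of_nonneg (by positivity), abs_of_nonneg (by positivity)]
      rcases le_total x 0 with h | h
      · rw [max_eq_right h]; nlinarith
      · rw [max_eq_left h]
    refine this.trans_isLittleO ?_
    exact Asymptotics.isLittleO_pow_id one_lt_two
  · rw [max_eq_left h.le]
    have : (fun t : ℝ => (max t 0) ^ 2) =ᶠ[nhds t] fun t => t ^ 2 := by
      filter_upwards [Ioi_mem_nhds h] with s hs
      rw [max_eq_left (le_of_lt hs)]
    simpa using (hasDerivAt_pow 2 t).congr_of_eventuallyEq this

lemma vv_mono {R R' : ℝ} (h : |R| ≤ R') (y : V) : vv R y ≤ vv R' y := by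
  unfold vv
  apply max_le_max _ le_rfl
  have := sq_le_sq' (a := R) (b := R') (by linarith [neg_abs_le R]) (by linarith [le_abs_self R])
  linarith

lemma ZZ_deriv (μ : Measure V) [IsLocallyFiniteMeasure μ] (R : ℝ) :
    HasDerivAt (ZZ μ) (4 * R * aa μ R) R := by
  have h := hasDerivAt_integral_of_dominated_loc_of_deriv_le (μ := μ) (𝕜 := ℝ)
    (F := fun R (y : V) => (vv R y) ^ 2) (F' := fun R y => 4 * R * vv R y) (x₀ := R)
    (s := Metric.ball R 1) (bound := fun y => vv (|R| + 1) y * (4 * (|R| + 1)))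
    (Metric.ball_mem_nhds R one_pos)
    (Filter.Eventually.of_forall fun R => (by fun_prop : Continuous fun y : V => (vv R y) ^ 2).aestronglyMeasurable)
    ?_ (by fun_prop : Continuous fun y : V => 4 * R * vv R y).aestronglyMeasurable ?_ ?_ ?_
  · have := h.2
    rw [integral_const_mul] at this
    exact this
  · exact integ μ (by fun_prop) |R| (fun y hy => by
      have h1 := vv_mono (le_refl |R|) y
      have h2 := vv_nonneg R y
      rw [vv_zero (abs_nonneg R) hy.le] at h1
      rw [le_antisymm h1 h2]; simp)
  · filter_upwards with y x hx
    have hx' : |x| ≤ |R| + 1 := by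
      have : |x - R| < 1 := by simpa [Real.dist_eq] using hx
      calc |x| = |R + (x - R)| := by ring_nf
        _ ≤ |R| + |x - R| := abs_add_le _ _
        _ ≤ _ := by linarith
    rw [Real.norm_eq_abs, abs_mul, abs_mul, abs_of_nonneg (vv_nonneg x y), mul_comm]
    have := vv_mono hx' y
    have h4 : |(4 : ℝ)| = 4 := by norm_num
    rw [h4]
    have := vv_nonneg x y
    have := abs_nonneg x
    have := vv_nonneg (|R| + 1) y
    gcongr
  · exact integ_vv μ (by positivity) (f := fun _ => (4 * (|R| + 1))) (by fun_prop)
  · filter_upwards with y x hx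
    unfold vv
    have h1 := (hasDerivAt_maxsq (x ^ 2 - ‖y‖ ^ 2)).comp x
      ((hasDerivAt_pow 2 x).sub_const (‖y‖ ^ 2))
    exact h1.congr_deriv (by push_cast; ring)

/-- The ratio `Z / R^5` derivative. -/
lemma ZZ5_deriv (μ : Measure V) [IsLocallyFiniteMeasure μ] {R : ℝ} (hR : 0 < R) :
    HasDerivAt (fun R => ZZ μ R / R ^ 5) ((4 * R ^ 2 * aa μ R - 5 * ZZ μ R) / R ^ 6) R := by
  have := (ZZ_deriv μ R).div (hasDerivAt_pow 5 R) (by positivity)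
  refine this.congr_deriv ?_
  push_cast
  rw [div_eq_div_iff (by positivity) (by positivity)]
  ring

lemma Unif.exists_R0 (h : Unif μ S g) (h0 : (0 : V) ∈ S) :
    ∃ R0 : ℝ, 0 < R0 ∧ 4 * R0 ^ 2 * aa μ R0 = 5 * ZZ μ R0 := by
  obtain ⟨c, hc, hc'⟩ := exists_hasDerivAt_eq_zero (a := 1) (b := 2) (by norm_num)
    (f := fun R => ZZ μ R / R ^ 5) (f' := fun R => ((4 * R ^ 2 * aa μ R - 5 * ZZ μ R) / R ^ 6))
    (by
      intro x hx
      exact (ZZ5_deriv μ (by linarith [hx.1])).continuousAt.continuousWithinAt)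
    (by
      have := h.ZZ_two h0 1
      simp at this ⊢
      rw [this]; ring)
    (fun x hx => ZZ5_deriv μ (by linarith [hx.1]))
  have hc0 : 0 < c := by linarith [hc.1]
  refine ⟨c, hc0, ?_⟩
  rw [div_eq_zero_iff] at hc'
  rcases hc' with h | h
  · linarith
  · exact absurd h (by positivity)

/-- Moments. -/
noncomputable def mA (μ : Measure V) (R : ℝ) (x : V) : ℝ := ∫ y, (vv R y) ^ 2 * inner ℝ x y ∂μ
noncomputable def mQ (μ : Measure V) (R : ℝ) (x : V) : ℝ := ∫ y, vv R y * (inner ℝ x y) ^ 2 ∂μ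

lemma cube_ineq (w h : ℝ) :
    |(max (w - h) 0) ^ 3 - (max w 0) ^ 3 + 3 * (max w 0) ^ 2 * h - 3 * max w 0 * h ^ 2| ≤ |h| ^ 3 := by
  rcases le_total 0 w with hw | hw <;> rcases le_total 0 (w - h) with hh | hh
  · rw [max_eq_left hw, max_eq_left hh, ← abs_pow]
    apply le_of_eq
    rw [← abs_neg]; congr 1; ring
  · rw [max_eq_left hw, max_eq_right hh]
    have : 0 ≤ h := by linarith
    rw [abs_of_nonneg this, abs_le]
    have h1 : 0 ≤ (h - w) ^ 3 := by have : 0 ≤ h - w := by linarith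
                                    positivity
    have h2 : (h - w) ^ 3 ≤ h ^ 3 := by
      apply pow_le_pow_left₀ (by linarith) (by linarith)
    constructor <;> nlinarith
  · rw [max_eq_right hw, max_eq_left hh]
    have : h ≤ 0 := by linarith
    rw [abs_of_nonpos this]
    have h1 : 0 ≤ (w - h) ^ 3 := by positivity
    have h2 : (w - h) ^ 3 ≤ (-h) ^ 3 := by
      apply pow_le_pow_left₀ (by linarith) (by linarith)
    simp only [ne_eq, OfNat.ofNat_ne_zero, not_false_eq_true, zero_pow, mul_zero, zero_mul, sub_zero, add_zero]
    rw [abs_of_nonneg h1]; exact h2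
  · rw [max_eq_right hw, max_eq_right hh]; simp

lemma Unif.expand0 (h : Unif μ S g) (h0 : (0 : V) ∈ S) {x : V} (hx : x ∈ S) {R : ℝ} (hR : 0 < R)
    (hxR : ‖x‖ ≤ R) :
    |(∫ y, (vv R y) ^ 2 * (‖x‖ ^ 2 - 2 * inner ℝ x y) ∂μ) -
      ∫ y, vv R y * (‖x‖ ^ 2 - 2 * inner ℝ x y) ^ 2 ∂μ| ≤ 42 * ‖x‖ ^ 3 * R ^ 3 * g (4 * R) := by
  have hrad := h.radial h0 hx (fun t => (max (R ^ 2 - t ^ 2) 0) ^ 3) (by fun_prop)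
  set H : V → ℝ := fun y => ‖x‖ ^ 2 - 2 * inner ℝ x y with hH
  have hHc : Continuous H := by rw [hH]; fun_prop
  have hid : ∀ y, R ^ 2 - ‖y - x‖ ^ 2 = (R ^ 2 - ‖y‖ ^ 2) - H y := by
    intro y
    rw [norm_sub_sq_real, hH, real_inner_comm]; ring
  have i1 : Integrable (fun y => (max (R ^ 2 - ‖y - x‖ ^ 2) 0) ^ 3) μ := by
    apply integ μ (by fun_prop) (2 * R)
    intro y hy
    have : R ≤ ‖y - x‖ := by
      have := norm_sub_norm_le y x
      linarith
    rw [max_eq_right (by nlinarith)]; simp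
  have i2 : Integrable (fun y => (vv R y) ^ 3) μ := by
    have := integ_vv2 μ hR.le (f := fun y => vv R y) (by fun_prop)
    convert this using 2
    ring
  have i3 : Integrable (fun y => (vv R y) ^ 2 * H y) μ := integ_vv2 μ hR.le hHc
  have i4 : Integrable (fun y => vv R y * (H y) ^ 2) μ := integ_vv μ hR.le (by fun_prop)
  have e : ∫ y, ((max (R ^ 2 - ‖y - x‖ ^ 2) 0) ^ 3 - (vv R y) ^ 3 + 3 * ((vv R y) ^ 2 * H y)
      - 3 * (vv R y * (H y) ^ 2)) ∂μ = 3 * ((∫ y, (vv R y) ^ 2 * H y ∂μ) - ∫ y, vv R y * (H y) ^ 2 ∂μ) := by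
    rw [integral_sub (int_add (int_sub i1 i2) (i3.const_mul 3)) (i4.const_mul 3),
      integral_add (int_sub i1 i2) (i3.const_mul 3), integral_sub i1 i2, integral_const_mul,
      integral_const_mul, hrad]
    unfold vv
    ring
  have hb : |∫ y, ((max (R ^ 2 - ‖y - x‖ ^ 2) 0) ^ 3 - (vv R y) ^ 3 + 3 * ((vv R y) ^ 2 * H y)
      - 3 * (vv R y * (H y) ^ 2)) ∂μ| ≤ 125 * ‖x‖ ^ 3 * R ^ 3 * g (4 * R) := by
    rw [← h.ball 0 h0 (4 * R) (by positivity)]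
    have : 125 * ‖x‖ ^ 3 * R ^ 3 * μ.real (Metric.ball (0 : V) (4 * R))
        = ∫ y, (Metric.ball (0 : V) (4 * R)).indicator (fun _ => 125 * ‖x‖ ^ 3 * R ^ 3) y ∂μ := by
      rw [integral_indicator_const _ measurableSet_ball]; simp [mul_comm]
    rw [this, ← Real.norm_eq_abs]
    apply norm_integral_le_of_norm_le
    · exact (integrable_indicator_iff measurableSet_ball).2
        (integrableOn_const (ball_ne_top _ _ _))
    · filter_upwards with y
      rw [Real.norm_eq_abs, hid]
      have hc := cube_ineq (R ^ 2 - ‖y‖ ^ 2) (H y)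
      by_cases hy : ‖y‖ ≤ 2 * R
      · have hy' : y ∈ Metric.ball (0 : V) (4 * R) := by simp; linarith
        rw [Set.indicator_of_mem hy']
        have hHb : |H y| ≤ 5 * ‖x‖ * R := by
          have h1 := abs_real_inner_le_norm x y
          have h2 : |H y| ≤ ‖x‖ ^ 2 + 2 * |inner ℝ x y| := by
            rw [hH]
            calc |‖x‖ ^ 2 - 2 * inner ℝ x y| ≤ |‖x‖ ^ 2| + |2 * inner ℝ x y| := abs_sub _ _
              _ = _ := by rw [abs_of_nonneg (by positivity), abs_mul]; norm_num
          have h3 : ‖x‖ * ‖y‖ ≤ ‖x‖ * (2 * R) := by gcongr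
          nlinarith [norm_nonneg x]
        calc _ = |(max (R ^ 2 - ‖y‖ ^ 2 - H y) 0) ^ 3 - (max (R ^ 2 - ‖y‖ ^ 2) 0) ^ 3
            + 3 * (max (R ^ 2 - ‖y‖ ^ 2) 0) ^ 2 * H y - 3 * max (R ^ 2 - ‖y‖ ^ 2) 0 * H y ^ 2| := by
              unfold vv; congr 1; ring
          _ ≤ |H y| ^ 3 := hc
          _ ≤ (5 * ‖x‖ * R) ^ 3 := by gcongr
          _ = _ := by ring
      · push Not at hy
        have h1 : R ≤ ‖y - x‖ := by
          have := norm_sub_norm_le y x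
          linarith
        have h2 : R ^ 2 - ‖y‖ ^ 2 - H y ≤ 0 := by rw [← hid]; nlinarith
        rw [max_eq_right h2, vv_zero hR.le (by linarith)]
        simp only [ne_eq, OfNat.ofNat_ne_zero, not_false_eq_true, zero_pow, mul_zero, zero_mul, sub_zero, add_zero, abs_zero]
        exact Set.indicator_nonneg (fun _ _ => by positivity) _
  rw [e, abs_mul] at hb
  have h3 : |(3 : ℝ)| = 3 := by norm_num
  rw [h3] at hb
  have hg := h.pos (4 * R) (by positivity)
  have : 0 ≤ ‖x‖ ^ 3 * R ^ 3 * g (4 * R) := by positivity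
  nlinarith

lemma Unif.aa_le (h : Unif μ S g) (h0 : (0 : V) ∈ S) {R : ℝ} (hR : 0 < R) :
    aa μ R ≤ R ^ 2 * g R := by
  rw [← h.ball 0 h0 R hR]
  have : R ^ 2 * μ.real (Metric.ball (0 : V) R)
        = ∫ y, (Metric.ball (0 : V) R).indicator (fun _ => R ^ 2) y ∂μ := by
      rw [integral_indicator_const _ measurableSet_ball]; simp [mul_comm]
  rw [this]
  apply integral_mono
  · simpa using integ_vv μ hR.le (f := fun _ => 1) (by fun_prop)
  · exact (integrable_indicator_iff measurableSet_ball).2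
        (integrableOn_const (ball_ne_top _ _ _))
  · intro y
    by_cases hy : y ∈ Metric.ball (0 : V) R
    · simp only [Set.indicator_of_mem hy]; exact vv_le R y
    · simp only [Set.indicator_of_notMem hy]
      rw [vv_zero hR.le (by simpa using hy)]

lemma Unif.expand (h : Unif μ S g) (h0 : (0 : V) ∈ S) {x : V} (hx : x ∈ S) {R : ℝ} (hR : 0 < R)
    (hxR : ‖x‖ ≤ R) :
    |‖x‖ ^ 2 * ZZ μ R - 2 * mA μ R x - 4 * mQ μ R x| ≤ 50 * ‖x‖ ^ 3 * R ^ 3 * g (4 * R) := by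
  have h1 := h.expand0 h0 hx hR hxR
  have i1 : Integrable (fun y => (vv R y) ^ 2) μ := by
    simpa using integ_vv2 μ hR.le (f := fun _ => 1) (by fun_prop)
  have i2 : Integrable (fun y => vv R y) μ := by
    simpa using integ_vv μ hR.le (f := fun _ => 1) (by fun_prop)
  have i3 : Integrable (fun y => (vv R y) ^ 2 * inner ℝ x y) μ := integ_vv2 μ hR.le (by fun_prop)
  have i4 : Integrable (fun y => vv R y * inner ℝ x y) μ := integ_vv μ hR.le (by fun_prop)
  have i5 : Integrable (fun y => vv R y * (inner ℝ x y) ^ 2) μ := integ_vv μ hR.le (by fun_prop)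
  have e1 : (∫ y, (vv R y) ^ 2 * (‖x‖ ^ 2 - 2 * inner ℝ x y) ∂μ)
      = ‖x‖ ^ 2 * ZZ μ R - 2 * mA μ R x := by
    have : ∀ y, (vv R y) ^ 2 * (‖x‖ ^ 2 - 2 * inner ℝ x y)
      = ‖x‖ ^ 2 * (vv R y) ^ 2 - 2 * ((vv R y) ^ 2 * inner ℝ x y) := fun y => by ring
    simp_rw [this]
    rw [integral_sub (i1.const_mul _) (i3.const_mul _), integral_const_mul, integral_const_mul]; rfl
  have e2 : (∫ y, vv R y * (‖x‖ ^ 2 - 2 * inner ℝ x y) ^ 2 ∂μ)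
      = ‖x‖ ^ 4 * aa μ R - 4 * ‖x‖ ^ 2 * (∫ y, vv R y * inner ℝ x y ∂μ) + 4 * mQ μ R x := by
    have : ∀ y, vv R y * (‖x‖ ^ 2 - 2 * inner ℝ x y) ^ 2
      = ‖x‖ ^ 4 * vv R y - 4 * ‖x‖ ^ 2 * (vv R y * inner ℝ x y) + 4 * (vv R y * (inner ℝ x y) ^ 2) :=
        fun y => by ring
    simp_rw [this]
    rw [integral_add (int_sub (i2.const_mul _) (i4.const_mul _)) (i5.const_mul _),
      integral_sub (i2.const_mul _) (i4.const_mul _), integral_const_mul, integral_const_mul,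
      integral_const_mul]; rfl
  have haa := h.aa_le h0 hR
  have haa0 : 0 ≤ aa μ R := integral_nonneg (fun y => vv_nonneg R y)
  have e3 : |∫ y, vv R y * inner ℝ x y ∂μ| ≤ ‖x‖ * R * aa μ R := by
    have : ‖x‖ * R * aa μ R = ∫ y, ‖x‖ * R * vv R y ∂μ := by rw [integral_const_mul]; rfl
    rw [this, ← Real.norm_eq_abs]
    apply norm_integral_le_of_norm_le (i2.const_mul _)
    filter_upwards with y
    rw [Real.norm_eq_abs, abs_mul, abs_of_nonneg (vv_nonneg R y)]
    rcases le_or_gt R ‖y‖ with hy | hy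
    · rw [vv_zero hR.le hy]; simp
    · have h1 := abs_real_inner_le_norm x y
      have h3 : ‖x‖ * ‖y‖ ≤ ‖x‖ * R := by gcongr
      rw [mul_comm]
      exact mul_le_mul_of_nonneg_right (h1.trans h3) (vv_nonneg _ _)
  have hg4 := h.gmono h0 hR (by linarith : R ≤ 4 * R)
  have hgp := h.pos R hR
  have hgp4 := h.pos (4 * R) (by positivity)
  rw [e1, e2] at h1
  have hxn := norm_nonneg x
  have b1 : ‖x‖ ^ 4 * aa μ R ≤ ‖x‖ ^ 3 * R ^ 3 * g (4 * R) := by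
    calc ‖x‖ ^ 4 * aa μ R ≤ ‖x‖ ^ 4 * (R ^ 2 * g (4 * R)) := by
          gcongr; exact haa.trans (by gcongr)
      _ = ‖x‖ ^ 3 * R ^ 2 * g (4 * R) * ‖x‖ := by ring
      _ ≤ ‖x‖ ^ 3 * R ^ 2 * g (4 * R) * R := by gcongr; 
      _ = _ := by ring
  have b2 : ‖x‖ ^ 2 * |∫ y, vv R y * inner ℝ x y ∂μ| ≤ ‖x‖ ^ 3 * R ^ 3 * g (4 * R) := by
    calc _ ≤ ‖x‖ ^ 2 * (‖x‖ * R * (R ^ 2 * g (4 * R))) := by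
          gcongr; exact e3.trans (by gcongr; exact haa.trans (by gcongr))
      _ = _ := by ring
  have b3 : 0 ≤ ‖x‖ ^ 4 * aa μ R := by positivity
  have b4 := abs_le.1 (show |‖x‖ ^ 2 * (∫ y, vv R y * inner ℝ x y ∂μ)| ≤ ‖x‖ ^ 3 * R ^ 3 * g (4 * R) by
    rw [abs_mul, abs_of_nonneg (by positivity)]; exact b2)
  have h1' := abs_le.1 h1
  rw [abs_le]
  constructor <;> nlinarith [h1'.1, h1'.2, b4.1, b4.2]

end
end FlatPf
end

section
open MeasureTheory Metric
open scoped ENNReal NNReal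
set_option linter.unusedSectionVars false
set_option linter.unusedVariables false

namespace FlatPf
section
variable {V : Type*} [NormedAddCommGroup V] [InnerProductSpace ℝ V] [FiniteDimensional ℝ V]
  [MeasurableSpace V] [BorelSpace V]
variable {μ : Measure V} [IsLocallyFiniteMeasure μ] {S : Set V} {g : ℝ → ℝ}

/-- normalized first moment vector -/
noncomputable def bv (μ : Measure V) (R : ℝ) : V := (2 / ZZ μ R) • ∫ y, (vv R y) ^ 2 • y ∂μ
noncomputable def qv (μ : Measure V) (R : ℝ) (x : V) : ℝ := 4 / ZZ μ R * mQ μ R x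
noncomputable def TT (μ : Measure V) (R : ℝ) : ℝ := 4 * R ^ 2 * aa μ R / ZZ μ R - 4

lemma inner_bv {R : ℝ} (hR : 0 < R) (x : V) : inner ℝ x (bv μ R) = 2 / ZZ μ R * mA μ R x := by
  unfold bv mA
  rw [inner_smul_right, ← integral_inner]
  · simp_rw [inner_smul_right]
  · apply Continuous.integrable_of_hasCompactSupport (by fun_prop)
    apply HasCompactSupport.intro (isCompact_closedBall (0 : V) R)
    intro y hy
    have : R ≤ ‖y‖ := by
      simp at hy; exact hy.le
    simp [vv_zero hR.le this]

lemma Unif.expandk (h : Unif μ S g) (h0 : (0 : V) ∈ S) {R0 : ℝ} (hR : 0 < R0) {x : V} (hx : x ∈ S)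
    (k : ℕ) (hk : ‖x‖ ≤ 2 ^ k * R0) :
    |‖x‖ ^ 2 - inner ℝ x (bv μ (2 ^ k * R0)) - qv μ (2 ^ k * R0) x|
      ≤ (50 * R0 ^ 3 * g (4 * R0) / ZZ μ R0) * ‖x‖ ^ 3 * (1 / 2) ^ k := by
  have hRk : 0 < 2 ^ k * R0 := by positivity
  have h1 := h.expand h0 hx hRk hk
  have hZ := h.ZZ_pos h0 hRk
  have hZ0 := h.ZZ_pos h0 hR
  rw [inner_bv hRk]
  unfold qv
  have e : ‖x‖ ^ 2 - 2 / ZZ μ (2 ^ k * R0) * mA μ (2 ^ k * R0) x - 4 / ZZ μ (2 ^ k * R0) * mQ μ (2 ^ k * R0) x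
     = (‖x‖ ^ 2 * ZZ μ (2 ^ k * R0) - 2 * mA μ (2 ^ k * R0) x - 4 * mQ μ (2 ^ k * R0) x) / ZZ μ (2 ^ k * R0) := by
    field_simp
  rw [e, abs_div, abs_of_pos hZ, div_le_iff₀ hZ]
  refine h1.trans (le_of_eq ?_)
  rw [h.ZZ_pow h0, show 4 * (2 ^ k * R0) = 2 ^ k * (4 * R0) by ring, h.gpow k (by positivity)]
  have e2 : (32 : ℝ) ^ k = 2 ^ k * 2 ^ k * 2 ^ k * 2 ^ k * 2 ^ k := by
    rw [← mul_pow, ← mul_pow, ← mul_pow, ← mul_pow]; norm_num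
  rw [e2, one_div, inv_pow]
  field_simp

lemma Unif.TT_pow (h : Unif μ S g) (h0 : (0 : V) ∈ S) {R0 : ℝ} (hR : 0 < R0) (k : ℕ) :
    TT μ (2 ^ k * R0) = TT μ R0 := by
  unfold TT
  have hZ0 := h.ZZ_pos h0 hR
  rw [h.ZZ_pow h0, h.aa_pow h0]
  have e2 : (32 : ℝ) ^ k = 2 ^ k * 2 ^ k * 8 ^ k := by
    rw [← mul_pow, ← mul_pow]; norm_num
  rw [e2]
  field_simp

lemma Unif.TT_eq (h : Unif μ S g) (h0 : (0 : V) ∈ S) {R : ℝ} (hR : 0 < R) :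
    TT μ R = 4 / ZZ μ R * ∫ y, vv R y * ‖y‖ ^ 2 ∂μ := by
  have hZ0 := h.ZZ_pos h0 hR
  have i1 : Integrable (fun y => (vv R y) ^ 2) μ := by
    simpa using integ_vv2 μ hR.le (f := fun _ => 1) (by fun_prop)
  have i2 : Integrable (fun y => vv R y) μ := by
    simpa using integ_vv μ hR.le (f := fun _ => 1) (by fun_prop)
  have : ∀ y : V, vv R y * ‖y‖ ^ 2 = R ^ 2 * vv R y - (vv R y) ^ 2 := by
    intro y; unfold vv
    rcases le_total (R ^ 2 - ‖y‖ ^ 2) 0 with h | h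
    · rw [max_eq_right h]; ring
    · rw [max_eq_left h]; ring
  simp_rw [this]
  rw [integral_sub (i2.const_mul _) i1, integral_const_mul]
  unfold TT
  change _ = 4 / ZZ μ R * (R ^ 2 * aa μ R - ZZ μ R)
  field_simp

lemma Unif.qv_nonneg (h : Unif μ S g) (h0 : (0 : V) ∈ S) {R : ℝ} (hR : 0 < R) (x : V) :
    0 ≤ qv μ R x := by
  have hZ0 := h.ZZ_pos h0 hR
  unfold qv mQ
  have : 0 ≤ ∫ y, vv R y * (inner ℝ x y) ^ 2 ∂μ :=
    integral_nonneg (fun y => mul_nonneg (vv_nonneg _ _) (sq_nonneg _))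
  positivity

lemma qv_smul {R : ℝ} (c : ℝ) (x : V) : qv μ R (c • x) = c ^ 2 * qv μ R x := by
  unfold qv mQ
  have : ∀ y, vv R y * (inner ℝ (c • x) y) ^ 2 = c ^ 2 * (vv R y * (inner ℝ x y) ^ 2) := by
    intro y; rw [real_inner_smul_left]; ring
  simp_rw [this]
  rw [integral_const_mul]; ring

lemma Unif.qv_add_le (h : Unif μ S g) (h0 : (0 : V) ∈ S) {R : ℝ} (hR : 0 < R) {e f : V}
    (he : ‖e‖ = 1) (hf : ‖f‖ = 1) (hef : inner ℝ e f = 0) : qv μ R e + qv μ R f ≤ TT μ R := by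
  have hZ0 := h.ZZ_pos h0 hR
  rw [h.TT_eq h0 hR]
  unfold qv mQ
  rw [← mul_add, ← integral_add (integ_vv μ hR.le (by fun_prop)) (integ_vv μ hR.le (by fun_prop))]
  apply mul_le_mul_of_nonneg_left _ (by positivity)
  apply integral_mono
  · exact int_add (integ_vv μ hR.le (by fun_prop)) (integ_vv μ hR.le (by fun_prop))
  · exact integ_vv μ hR.le (by fun_prop)
  intro y
  simp only
  rw [← mul_add]
  apply mul_le_mul_of_nonneg_left _ (vv_nonneg _ _)
  have h1 : ‖y - (inner ℝ e y) • e - (inner ℝ f y) • f‖ ^ 2 = ‖y‖ ^ 2 - (inner ℝ e y) ^ 2 - (inner ℝ f y) ^ 2 := by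
    rw [norm_sub_sq_real, norm_sub_sq_real, norm_smul, norm_smul, he, hf, inner_sub_left,
      real_inner_smul_right, real_inner_smul_right, real_inner_smul_left, real_inner_smul_right, hef,
      real_inner_comm y e, real_inner_comm y f]
    simp only [Real.norm_eq_abs, mul_one, sq_abs]
    ring
  nlinarith [sq_nonneg ‖y - (inner ℝ e y) • e - (inner ℝ f y) • f‖]

lemma Unif.qv_le (h : Unif μ S g) (h0 : (0 : V) ∈ S) {R : ℝ} (hR : 0 < R) (x : V) :
    qv μ R x ≤ TT μ R * ‖x‖ ^ 2 := by
  have hZ0 := h.ZZ_pos h0 hR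
  rw [h.TT_eq h0 hR, mul_assoc]
  unfold qv mQ
  apply mul_le_mul_of_nonneg_left _ (by positivity)
  rw [← integral_mul_const]
  apply integral_mono (integ_vv μ hR.le (by fun_prop))
  · have := integ_vv μ hR.le (f := fun y => ‖y‖ ^ 2 * ‖x‖ ^ 2) (by fun_prop)
    simpa only [mul_assoc] using this
  intro y
  simp only
  rw [mul_assoc]
  apply mul_le_mul_of_nonneg_left _ (vv_nonneg _ _)
  have := abs_real_inner_le_norm x y
  rw [← mul_pow, ← sq_abs]
  rw [mul_comm ‖y‖]
  gcongr

lemma Unif.qv_split (h : Unif μ S g) (h0 : (0 : V) ∈ S) {R : ℝ} (hR : 0 < R) (u w : V) {η : ℝ}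
    (hη : 0 < η) : qv μ R (u + w) ≤ (1 + η) * qv μ R u + (1 + 1 / η) * qv μ R w := by
  have hZ0 := h.ZZ_pos h0 hR
  unfold qv mQ
  rw [mul_left_comm, mul_left_comm (1 + 1 / η), ← mul_add]
  apply mul_le_mul_of_nonneg_left _ (by positivity)
  rw [← integral_const_mul, ← integral_const_mul, ← integral_add]
  · apply integral_mono (integ_vv μ hR.le (by fun_prop))
    · exact int_add ((integ_vv μ hR.le (by fun_prop)).const_mul _)
        ((integ_vv μ hR.le (by fun_prop)).const_mul _)
    intro y
    simp only
    rw [mul_left_comm, mul_left_comm (1 + 1 / η), ← mul_add]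
    apply mul_le_mul_of_nonneg_left _ (vv_nonneg _ _)
    rw [inner_add_left]
    set s := inner ℝ u y
    set t := inner ℝ w y
    have : (1 + η) * s ^ 2 + (1 + 1 / η) * t ^ 2 - (s + t) ^ 2 = (η * s - t) ^ 2 / η := by
      field_simp; ring
    have h2 : 0 ≤ (η * s - t) ^ 2 / η := by positivity
    linarith
  · exact (integ_vv μ hR.le (by fun_prop)).const_mul _
  · exact (integ_vv μ hR.le (by fun_prop)).const_mul _

lemma Unif.meas_inter (h : Unif μ S g) (A : Set V) : μ (A ∩ S) = μ A := by
  apply le_antisymm (measure_mono Set.inter_subset_left)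
  calc μ A ≤ μ ((A ∩ S) ∪ Sᶜ) := measure_mono (fun y hy => by
        by_cases h : y ∈ S
        · exact Or.inl ⟨hy, h⟩
        · exact Or.inr h)
    _ ≤ μ (A ∩ S) + μ Sᶜ := measure_union_le _ _
    _ = _ := by rw [h.null, add_zero]

lemma Unif.unbounded (h : Unif μ S g) (h0 : (0 : V) ∈ S) (M : ℝ) : ∃ x ∈ S, M < ‖x‖ := by
  by_contra! hc
  set M' := max M 0 + 1
  have hM' : 0 < M' := by positivity
  have h1 : ∀ k : ℕ, g (2 ^ k * M') ≤ g M' := by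
    intro k
    rw [← h.ball 0 h0 _ (by positivity), ← h.ball 0 h0 _ hM']
    apply ENNReal.toReal_mono (ball_ne_top _ _ _)
    rw [← h.meas_inter]
    apply measure_mono
    rintro y ⟨_, hy⟩
    have := hc y hy
    simp
    have := le_max_left M 0
    show ‖y‖ < max M 0 + 1
    linarith
  have h2 := h1 1
  rw [h.gpow 1 hM'] at h2
  have := h.pos M' hM'
  linarith

lemma Unif.bv_bound (h : Unif μ S g) (h0 : (0 : V) ∈ S) {R0 : ℝ} (hR : 0 < R0) :
    ∃ C : ℝ, 0 ≤ C ∧ ∀ k : ℕ, ∀ x ∈ Submodule.span ℝ S, |inner ℝ x (bv μ (2 ^ k * R0))| ≤ C * ‖x‖ := by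
  set W := Submodule.span ℝ S
  have hpt : ∀ x : V, x ∈ W → ∃ C, ∀ k : ℕ, |inner ℝ x (bv μ (2 ^ k * R0))| ≤ C := by
    intro x hx
    induction hx using Submodule.span_induction with
    | mem x hx =>
      obtain ⟨k0, hk0⟩ : ∃ k0 : ℕ, ∀ k ≥ k0, ‖x‖ ≤ 2 ^ k * R0 := by
        obtain ⟨k0, hk0⟩ := pow_unbounded_of_one_lt (‖x‖ / R0) (one_lt_two : (1 : ℝ) < 2)
        refine ⟨k0, fun k hk => ?_⟩
        rw [div_lt_iff₀ hR] at hk0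
        have : (2 : ℝ) ^ k0 ≤ 2 ^ k := pow_le_pow_right₀ (by norm_num) hk
        nlinarith
      set K := 50 * R0 ^ 3 * g (4 * R0) / ZZ μ R0
      have hK : 0 ≤ K := by
        have := h.ZZ_pos h0 hR
        have := h.pos (4 * R0) (by positivity)
        positivity
      refine ⟨(‖x‖ ^ 2 + TT μ R0 * ‖x‖ ^ 2 + K * ‖x‖ ^ 3) +
        ∑ k ∈ Finset.range k0, |inner ℝ x (bv μ (2 ^ k * R0))|, fun k => ?_⟩
      have hq0 : ∀ k : ℕ, 0 ≤ qv μ (2 ^ k * R0) x := fun k => h.qv_nonneg h0 (by positivity) x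
      have hq1 : ∀ k : ℕ, qv μ (2 ^ k * R0) x ≤ TT μ R0 * ‖x‖ ^ 2 := fun k => by
        rw [← h.TT_pow h0 hR k]; exact h.qv_le h0 (by positivity) x
      by_cases hk : k < k0
      · have h1 : |inner ℝ x (bv μ (2 ^ k * R0))| ≤ ∑ k ∈ Finset.range k0, |inner ℝ x (bv μ (2 ^ k * R0))| :=
          Finset.single_le_sum (f := fun k => |inner ℝ x (bv μ (2 ^ k * R0))|) (fun i _ => abs_nonneg _)
            (Finset.mem_range.2 hk)
        have := hq0 0
        have := hq1 0
        have : 0 ≤ ‖x‖ ^ 2 := by positivity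
        have : 0 ≤ K * ‖x‖ ^ 3 := by positivity
        linarith
      · push Not at hk
        have h1 := h.expandk h0 hR hx k (hk0 k hk)
        have h2 : K * ‖x‖ ^ 3 * (1 / 2) ^ k ≤ K * ‖x‖ ^ 3 := by
          apply mul_le_of_le_one_right (by positivity)
          exact pow_le_one₀ (by norm_num) (by norm_num)
        have h3 : 0 ≤ ∑ k ∈ Finset.range k0, |inner ℝ x (bv μ (2 ^ k * R0))| :=
          Finset.sum_nonneg (fun i _ => abs_nonneg _)
        have := hq0 k
        have := hq1 k
        have : 0 ≤ ‖x‖ ^ 2 := by positivity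
        have h1' := abs_le.1 (h1.trans h2)
        rw [abs_le]
        constructor <;> linarith [h1'.1, h1'.2]
    | zero => exact ⟨0, fun k => by simp⟩
    | add x y _ _ hx hy =>
      obtain ⟨C, hC⟩ := hx
      obtain ⟨D, hD⟩ := hy
      refine ⟨C + D, fun k => ?_⟩
      rw [inner_add_left]
      exact (abs_add_le _ _).trans (add_le_add (hC k) (hD k))
    | smul a x _ hx =>
      obtain ⟨C, hC⟩ := hx
      refine ⟨|a| * C, fun k => ?_⟩
      rw [real_inner_smul_left, abs_mul]
      exact mul_le_mul_of_nonneg_left (hC k) (abs_nonneg _)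
  obtain ⟨C, hC⟩ := banach_steinhaus (E := W) (F := ℝ) (σ₁₂ := RingHom.id ℝ)
    (g := fun k : ℕ => (innerSL ℝ (bv μ (2 ^ k * R0))).comp W.subtypeL) (by
      rintro ⟨x, hx⟩
      obtain ⟨C, hC⟩ := hpt x hx
      refine ⟨C, fun k => ?_⟩
      simpa [real_inner_comm] using hC k)
  refine ⟨max C 0, le_max_right _ _, fun k x hx => ?_⟩
  have := ContinuousLinearMap.le_of_opNorm_le _ (hC k) ⟨x, hx⟩
  have h2 : |inner ℝ x (bv μ (2 ^ k * R0))| ≤ C * ‖x‖ := by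
    simpa [real_inner_comm] using this
  exact h2.trans (mul_le_mul_of_nonneg_right (le_max_left _ _) (norm_nonneg _))

end
end FlatPf
end

section
open MeasureTheory Metric
open scoped ENNReal NNReal
set_option linter.unusedSectionVars false
set_option linter.unusedVariables false

namespace FlatPf
section
variable {V : Type*} [NormedAddCommGroup V] [InnerProductSpace ℝ V] [FiniteDimensional ℝ V]
  [MeasurableSpace V] [BorelSpace V]
variable {μ : Measure V} [IsLocallyFiniteMeasure μ] {S : Set V} {g : ℝ → ℝ}

lemma ulim (U : Ultrafilter ℕ) {u : ℕ → ℝ} {C : ℝ} (h : ∀ k, |u k| ≤ C) :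
    ∃ l, Filter.Tendsto u U (nhds l) := by
  obtain ⟨l, _, hl⟩ := (isCompact_Icc (a := -C) (b := C)).ultrafilter_le_nhds (U.map u) (by
    rw [Filter.le_principal_iff]
    exact Filter.mem_map.2 (Filter.univ_mem' (fun k => abs_le.1 (h k))))
  exact ⟨l, hl⟩

lemma Unif.M_scale (h : Unif μ S g) (h0 : (0 : V) ∈ S) (R : ℝ) (k : ℕ) :
    ∫ y, (vv (2 ^ k * R) y) ^ 2 * ‖y‖ ∂μ = 64 ^ k * ∫ y, (vv R y) ^ 2 * ‖y‖ ∂μ := by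
  induction k with
  | zero => simp
  | succ k ih =>
    rw [pow_succ, show (2 : ℝ) ^ k * 2 * R = 2 * (2 ^ k * R) by ring, pow_succ, mul_comm _ (64 : ℝ), mul_assoc, ← ih]
    generalize 2 ^ k * R = R
    have := h.scale h0 (fun t => (max (R ^ 2 - t ^ 2) 0) ^ 2 * t) (by fun_prop)
    unfold vv
    have e : ∀ y : V, (max ((2 * R) ^ 2 - ‖y‖ ^ 2) 0) ^ 2 * ‖y‖
        = 32 * ((max (R ^ 2 - (‖y‖ / 2) ^ 2) 0) ^ 2 * (‖y‖ / 2)) := by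
      intro y
      have : max ((2 * R) ^ 2 - ‖y‖ ^ 2) 0 = 4 * max (R ^ 2 - (‖y‖ / 2) ^ 2) 0 := by
        rw [mul_max_of_nonneg _ _ (by norm_num : (0 : ℝ) ≤ 4)]; congr 1 <;> ring
      rw [this]; ring
    simp_rw [e]
    rw [integral_const_mul, this]; ring

lemma Unif.M_pos (h : Unif μ S g) (h0 : (0 : V) ∈ S) {R : ℝ} (hR : 0 < R) :
    0 < ∫ y, (vv R y) ^ 2 * ‖y‖ ∂μ := by
  rw [integral_pos_iff_support_of_nonneg (fun y => mul_nonneg (sq_nonneg _) (norm_nonneg y))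
    (integ_vv2 μ hR.le (by fun_prop))]
  rw [pos_iff_ne_zero]
  intro hc
  have hsub : Metric.ball (0 : V) (2 * (R / 4)) ⊆ Metric.ball (0 : V) (R / 4) ∪
      Function.support (fun y => (vv R y) ^ 2 * ‖y‖) := by
    intro y hy
    by_cases hy2 : y ∈ Metric.ball (0 : V) (R / 4)
    · exact Or.inl hy2
    · right
      simp at hy hy2
      have : 0 < vv R y := by
        unfold vv; apply lt_max_of_lt_left; nlinarith
      have : 0 < ‖y‖ := by linarith
      simp only [Function.mem_support]
      positivity
  have h1 : μ (Metric.ball (0 : V) (2 * (R / 4))) ≤ μ (Metric.ball (0 : V) (R / 4)) := by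
    refine (measure_mono hsub).trans ((measure_union_le _ _).trans ?_)
    rw [hc, add_zero]
  have h2 := ENNReal.toReal_mono (ball_ne_top _ _ _) h1
  change μ.real _ ≤ μ.real _ at h2
  rw [h.ball 0 h0 _ (by positivity), h.ball 0 h0 _ (by positivity), h.dbl _ (by positivity)] at h2
  have := h.pos (R / 4) (by positivity)
  linarith

lemma Unif.balanced (h : Unif μ S g) (h0 : (0 : V) ∈ S) {R0 : ℝ} (hR : 0 < R0) {e : V} {C K : ℝ}
    (hA : ∀ k : ℕ, |inner ℝ e (bv μ (2 ^ k * R0))| ≤ C)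
    (hy : ∀ y ∈ S, ‖y‖ ≤ 2 * inner ℝ e y + K) : False := by
  have hM := h.M_pos h0 hR
  set M := ∫ y, (vv R0 y) ^ 2 * ‖y‖ ∂μ
  have hZ0 := h.ZZ_pos h0 hR
  have key : ∀ k : ℕ, 2 ^ k * (M / ZZ μ R0) ≤ C + K := by
    intro k
    have hRk : 0 < 2 ^ k * R0 := by positivity
    have hZ := h.ZZ_pos h0 hRk
    have i1 : Integrable (fun y => (vv (2 ^ k * R0) y) ^ 2) μ := by
      simpa using integ_vv2 μ hRk.le (f := fun _ => 1) (by fun_prop)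
    have h1 : ∫ y, (vv (2 ^ k * R0) y) ^ 2 * ‖y‖ ∂μ ≤ 2 * mA μ (2 ^ k * R0) e + K * ZZ μ (2 ^ k * R0) := by
      unfold mA ZZ
      rw [← integral_const_mul, ← integral_const_mul, ← integral_add
        ((integ_vv2 μ hRk.le (by fun_prop)).const_mul _) (i1.const_mul _)]
      apply integral_mono_ae (integ_vv2 μ hRk.le (by fun_prop))
      · exact int_add ((integ_vv2 μ hRk.le (by fun_prop)).const_mul _) (i1.const_mul _)
      · filter_upwards [h.ae_mem] with y hyS
        have := mul_le_mul_of_nonneg_left (hy y hyS) (sq_nonneg (vv (2 ^ k * R0) y))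
        linarith
    have h2 := (abs_le.1 (hA k)).2
    rw [inner_bv hRk, div_mul_eq_mul_div, div_le_iff₀ hZ] at h2
    rw [h.M_scale h0] at h1
    have h3 := h.ZZ_pow h0 k R0
    have e2 : (64 : ℝ) ^ k = 2 ^ k * 32 ^ k := by
      rw [← mul_pow]; norm_num
    rw [e2] at h1
    rw [mul_div_assoc', div_le_iff₀ hZ0]
    have h4 : (0 : ℝ) < 32 ^ k := by positivity
    rw [h3] at h1 h2
    have h5 : 32 ^ k * (2 ^ k * M) ≤ 32 ^ k * ((C + K) * ZZ μ R0) := by nlinarith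
    exact le_of_mul_le_mul_left h5 h4
  have hp : 0 < M / ZZ μ R0 := by positivity
  obtain ⟨k, hk⟩ := pow_unbounded_of_one_lt ((C + K) / (M / ZZ μ R0)) (one_lt_two : (1 : ℝ) < 2)
  rw [div_lt_iff₀ hp] at hk
  linarith [key k]

lemma Unif.quadlim (h : Unif μ S g) (h0 : (0 : V) ∈ S) {R0 : ℝ} (hR : 0 < R0) (hT : TT μ R0 ≤ 1)
    {C : ℝ} (hC0 : 0 ≤ C)
    (hC : ∀ k : ℕ, ∀ x ∈ Submodule.span ℝ S, |inner ℝ x (bv μ (2 ^ k * R0))| ≤ C * ‖x‖) :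
    ∃ e : V, ‖e‖ = 1 ∧ e ∈ Submodule.span ℝ S ∧ ∃ α : ℝ,
      ∀ x ∈ S, ‖x - (inner ℝ e x) • e‖ ^ 2 ≤ inner ℝ e x * α + C * ‖x - (inner ℝ e x) • e‖ := by
  let U := Filter.hyperfilter ℕ
  have hRk : ∀ k : ℕ, 0 < 2 ^ k * R0 := fun k => by positivity
  have hqb : ∀ x k, |qv μ (2 ^ k * R0) x| ≤ TT μ R0 * ‖x‖ ^ 2 := by
    intro x k
    rw [abs_of_nonneg (h.qv_nonneg h0 (hRk k) x), ← h.TT_pow h0 hR k]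
    exact h.qv_le h0 (hRk k) x
  choose q hq using fun x => ulim U (hqb x)
  have hqT : ∀ x, q x ≤ TT μ R0 * ‖x‖ ^ 2 := fun x =>
    le_of_tendsto (hq x) (Filter.Eventually.of_forall fun k => (le_abs_self _).trans (hqb x k))
  have hq0 : ∀ x, 0 ≤ q x := fun x =>
    ge_of_tendsto (hq x) (Filter.Eventually.of_forall fun k => h.qv_nonneg h0 (hRk k) x)
  have hqs : ∀ (c : ℝ) x, q (c • x) = c ^ 2 * q x := by
    intro c x
    refine tendsto_nhds_unique (hq (c • x)) ?_
    simp_rw [qv_smul]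
    exact (hq x).const_mul _
  have hqsplit : ∀ u w η, 0 < η → q (u + w) ≤ (1 + η) * q u + (1 + 1 / η) * q w := by
    intro u w η hη
    refine le_of_tendsto_of_tendsto (hq (u + w)) (((hq u).const_mul _).add ((hq w).const_mul _)) ?_
    exact Filter.Eventually.of_forall fun k => h.qv_split h0 (hRk k) u w hη
  have hUle : (U : Filter ℕ) ≤ Filter.atTop := Nat.hyperfilter_le_atTop
  -- limit identity on S
  have hlim : ∀ x ∈ S, Filter.Tendsto (fun k : ℕ => inner ℝ x (bv μ (2 ^ k * R0))) U
      (nhds (‖x‖ ^ 2 - q x)) := by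
    intro x hx
    have h1 : Filter.Tendsto (fun k : ℕ => ‖x‖ ^ 2 - inner ℝ x (bv μ (2 ^ k * R0)) - qv μ (2 ^ k * R0) x)
        U (nhds 0) := by
      apply Filter.Tendsto.mono_left _ hUle
      apply squeeze_zero_norm' (a := fun k => (50 * R0 ^ 3 * g (4 * R0) / ZZ μ R0) * ‖x‖ ^ 3 * (1 / 2) ^ k)
      · obtain ⟨k0, hk0⟩ := pow_unbounded_of_one_lt (‖x‖ / R0) (one_lt_two : (1 : ℝ) < 2)
        filter_upwards [Filter.eventually_ge_atTop k0] with k hk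
        rw [div_lt_iff₀ hR] at hk0
        have : (2 : ℝ) ^ k0 ≤ 2 ^ k := pow_le_pow_right₀ (by norm_num) hk
        exact h.expandk h0 hR hx k (by nlinarith)
      · have := tendsto_pow_atTop_nhds_zero_of_lt_one (r := (1 / 2 : ℝ)) (by norm_num) (by norm_num)
        simpa using this.const_mul _
    have h2 := ((hq x).add h1).const_sub (‖x‖ ^ 2)
    convert h2 using 2
    · ring
    · ring
  have hSW : ∀ x ∈ S, x ∈ Submodule.span ℝ S := fun x hx => Submodule.subset_span hx
  have hlow : ∀ x ∈ S, ‖x‖ ^ 2 - q x ≤ C * ‖x‖ := fun x hx =>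
    le_of_tendsto (hlim x hx) (Filter.Eventually.of_forall fun k =>
      (le_abs_self _).trans (hC k x (hSW x hx)))
  -- direction
  choose X hXS hXn using fun j : ℕ => h.unbounded h0 ((j : ℝ) + 1)
  have hXp : ∀ j, 0 < ‖X j‖ := fun j => lt_trans (by positivity) (hXn j)
  obtain ⟨e, he1, he⟩ := (isCompact_sphere (0 : V) 1).ultrafilter_le_nhds
    (U.map (fun j => ‖X j‖⁻¹ • X j)) (by
    rw [Filter.le_principal_iff]
    refine Filter.mem_map.2 (Filter.univ_mem' (fun j => ?_))
    have := (hXp j).ne'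
    simp [norm_smul, this])
  replace he : Filter.Tendsto (fun j => ‖X j‖⁻¹ • X j) U (nhds e) := he
  have he1 : ‖e‖ = 1 := by simpa using he1
  have heW : e ∈ Submodule.span ℝ S := by
    have hcl : IsClosed (Submodule.span ℝ S : Set V) := Submodule.closed_of_finiteDimensional _
    refine hcl.mem_of_tendsto he (Filter.Eventually.of_forall fun j => ?_)
    exact Submodule.smul_mem _ _ (hSW _ (hXS j))
  have hnorm : Filter.Tendsto (fun j => ‖X j‖) U Filter.atTop := by
    apply Filter.Tendsto.mono_left _ hUle
    apply Filter.tendsto_atTop_mono (f := fun j : ℕ => (j : ℝ)) _ tendsto_natCast_atTop_atTop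
    intro j; linarith [hXn j]
  have hqe : 1 ≤ q e := by
    have h1 : ∀ η : ℝ, 0 < η → 1 ≤ (1 + η) * q e := by
      intro η hη
      have hj : ∀ j, 1 - C * ‖X j‖⁻¹ ≤ (1 + η) * q e + (1 + 1 / η) * (TT μ R0 * ‖‖X j‖⁻¹ • X j - e‖ ^ 2) := by
        intro j
        have h2 := hqsplit e (‖X j‖⁻¹ • X j - e) η hη
        rw [add_sub_cancel, hqs] at h2
        have h3 := hqT (‖X j‖⁻¹ • X j - e)
        have h4 := hlow (X j) (hXS j)
        have h5 : 1 - C * ‖X j‖⁻¹ ≤ ‖X j‖⁻¹ ^ 2 * q (X j) := by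
          have hp := hXp j
          have : ‖X j‖⁻¹ ^ 2 * (‖X j‖ ^ 2 - C * ‖X j‖) ≤ ‖X j‖⁻¹ ^ 2 * q (X j) := by
            gcongr; linarith
          refine le_trans (le_of_eq ?_) this
          field_simp
        have h6 : (1 + 1 / η) * q (‖X j‖⁻¹ • X j - e) ≤ (1 + 1 / η) * (TT μ R0 * ‖‖X j‖⁻¹ • X j - e‖ ^ 2) := by
          gcongr
        linarith
      have l1 : Filter.Tendsto (fun j => 1 - C * ‖X j‖⁻¹) U (nhds (1 - C * 0)) :=
        ((tendsto_inv_atTop_zero.comp hnorm).const_mul C).const_sub 1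
      have l2 : Filter.Tendsto (fun j => (1 + η) * q e + (1 + 1 / η) * (TT μ R0 * ‖‖X j‖⁻¹ • X j - e‖ ^ 2)) U
          (nhds ((1 + η) * q e + (1 + 1 / η) * (TT μ R0 * ‖e - e‖ ^ 2))) :=
        (((((he.sub_const e).norm).pow 2).const_mul _).const_mul _).const_add _
      have := le_of_tendsto_of_tendsto l1 l2 (Filter.Eventually.of_forall hj)
      simpa using this
    by_contra hc
    push Not at hc
    have h0' := hq0 e
    have := h1 ((1 - q e) / 2) (by linarith)
    nlinarith
  have hperp : ∀ f, inner ℝ e f = 0 → q f = 0 := by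
    intro f hf
    by_cases hf0 : f = 0
    · have := hqs 0 f
      rw [hf0]; rw [hf0] at this; simpa using this
    have hfn : ‖f‖ ≠ 0 := by simpa using hf0
    have h1 : q e + q (‖f‖⁻¹ • f) ≤ TT μ R0 := by
      refine le_of_tendsto ((hq e).add (hq _)) (Filter.Eventually.of_forall fun k => ?_)
      rw [← h.TT_pow h0 hR k]
      apply h.qv_add_le h0 (hRk k) he1
      · simp [norm_smul, hfn]
      · rw [real_inner_smul_right, hf, mul_zero]
    rw [hqs] at h1
    have h2 := hq0 f
    have h3 : ‖f‖⁻¹ ^ 2 * q f ≤ 0 := by linarith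
    have h4 : 0 < ‖f‖⁻¹ ^ 2 := by positivity
    nlinarith
  have hqx : ∀ x, q x ≤ (inner ℝ e x) ^ 2 := by
    intro x
    have h1 : ∀ η : ℝ, 0 < η → q x ≤ (1 + η) * (inner ℝ e x) ^ 2 := by
      intro η hη
      have h2 := hqsplit ((inner ℝ e x) • e) (x - (inner ℝ e x) • e) η hη
      rw [add_sub_cancel, hqs, hperp (x - (inner ℝ e x) • e) (by
        rw [inner_sub_right, real_inner_smul_right, real_inner_self_eq_norm_sq, he1]; ring)] at h2
      have h3 := hqT e
      rw [he1] at h3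
      have h4 : (inner ℝ e x) ^ 2 * q e ≤ (inner ℝ e x) ^ 2 * 1 := by
        gcongr; linarith
      nlinarith
    by_contra hc
    push Not at hc
    rcases eq_or_lt_of_le (sq_nonneg (inner ℝ e x)) with h5 | h5
    · have := h1 1 one_pos
      rw [← h5] at this hc; linarith
    · have := h1 ((q x - (inner ℝ e x) ^ 2) / (2 * (inner ℝ e x) ^ 2)) (by
        apply div_pos <;> linarith)
      have e2 : (1 + (q x - (inner ℝ e x) ^ 2) / (2 * (inner ℝ e x) ^ 2)) * (inner ℝ e x) ^ 2
        = (inner ℝ e x) ^ 2 + (q x - (inner ℝ e x) ^ 2) / 2 := by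
        have h6 : (inner ℝ e x : ℝ) ≠ 0 := fun h => by simp [h] at h5
        field_simp
      rw [e2] at this; linarith
  obtain ⟨α, hα⟩ := ulim U (u := fun k => inner ℝ e (bv μ (2 ^ k * R0))) (fun k => hC k e heW)
  refine ⟨e, he1, heW, α, fun x hx => ?_⟩
  set x1 := inner ℝ e x with hx1
  set x' := x - x1 • e with hx'
  have hx'W : x' ∈ Submodule.span ℝ S := Submodule.sub_mem _ (hSW x hx) (Submodule.smul_mem _ _ heW)
  have h1 := (hlim x hx).sub (hα.const_mul x1)
  have h2 : ‖x‖ ^ 2 - q x - x1 * α ≤ C * ‖x'‖ := by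
    refine le_of_tendsto h1 (Filter.Eventually.of_forall fun k => ?_)
    have e3 : inner ℝ x (bv μ (2 ^ k * R0)) - x1 * inner ℝ e (bv μ (2 ^ k * R0)) = inner ℝ x' (bv μ (2 ^ k * R0)) := by
      rw [hx', inner_sub_left, real_inner_smul_left]
    rw [e3]
    exact (le_abs_self _).trans (hC k x' hx'W)
  have h3 : ‖x'‖ ^ 2 = ‖x‖ ^ 2 - x1 ^ 2 := by
    rw [hx', norm_sub_sq_real, real_inner_smul_right, norm_smul, he1, real_inner_comm, ← hx1, Real.norm_eq_abs,
      mul_one, sq_abs]; ring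
  have := hqx x
  linarith

lemma pyth {e : V} (he : ‖e‖ = 1) (x : V) : ‖x‖ ≤ |inner ℝ e x| + ‖x - (inner ℝ e x) • e‖ := by
  calc ‖x‖ = ‖(inner ℝ e x) • e + (x - (inner ℝ e x) • e)‖ := by rw [add_sub_cancel]
    _ ≤ ‖(inner ℝ e x) • e‖ + ‖x - (inner ℝ e x) • e‖ := norm_add_le _ _
    _ = _ := by rw [norm_smul, he, mul_one, Real.norm_eq_abs]

lemma Unif.alpha_pos (h : Unif μ S g) (h0 : (0 : V) ∈ S) {R0 : ℝ} (hR : 0 < R0) {e : V} (he : ‖e‖ = 1)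
    {C α : ℝ} (hC0 : 0 ≤ C) (hα : 0 < α)
    (hA : ∀ k : ℕ, |inner ℝ e (bv μ (2 ^ k * R0))| ≤ C)
    (hS : ∀ x ∈ S, ‖x - (inner ℝ e x) • e‖ ^ 2 ≤ inner ℝ e x * α + C * ‖x - (inner ℝ e x) • e‖) :
    False := by
  apply h.balanced h0 hR (K := C ^ 2 / α * 3 + C + α) hA
  intro y hy
  have h1 := hS y hy
  have h2 := pyth he y
  set y1 := inner ℝ e y
  set s := ‖y - y1 • e‖ with hs
  have hs0 : 0 ≤ s := norm_nonneg _
  have h3 : - (C ^ 2 / α) ≤ y1 := by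
    rw [← neg_div, div_le_iff₀ hα]
    nlinarith [sq_nonneg (s - C / 2)]
  have hp : 0 ≤ C ^ 2 / α := by positivity
  have h4 : |y1| ≤ y1 + 2 * (C ^ 2 / α) := by
    rw [abs_le]; constructor <;> linarith
  have h5 : s ≤ y1 + C ^ 2 / α + C + α := by
    by_cases hsc : s ≤ C + α
    · linarith
    · push Not at hsc
      have : s * α ≤ y1 * α := by nlinarith
      have := le_of_mul_le_mul_right this hα
      linarith
  linarith

lemma Unif.tube (h : Unif μ S g) (h0 : (0 : V) ∈ S) :
    ∃ e : V, ‖e‖ = 1 ∧ ∃ C : ℝ, 0 ≤ C ∧ (∀ x ∈ S, ‖x - (inner ℝ e x) • e‖ ≤ C) ∧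
      (∀ t, ∃ y ∈ S, inner ℝ e y < t) ∧ (∀ t, ∃ y ∈ S, t < inner ℝ e y) := by
  obtain ⟨R0, hR, hR0⟩ := h.exists_R0 h0
  have hZ := h.ZZ_pos h0 hR
  have hT : TT μ R0 ≤ 1 := by
    unfold TT; rw [hR0]; field_simp; norm_num
  obtain ⟨C, hC0, hC⟩ := h.bv_bound h0 hR
  obtain ⟨e, he, heW, α, hα⟩ := h.quadlim h0 hR hT hC0 hC
  have hA : ∀ k : ℕ, |inner ℝ e (bv μ (2 ^ k * R0))| ≤ C := fun k => by
    have := hC k e heW; rwa [he, mul_one] at this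
  have hA' : ∀ k : ℕ, |inner ℝ (-e) (bv μ (2 ^ k * R0))| ≤ C := fun k => by
    rw [inner_neg_left, abs_neg]; exact hA k
  have hα0 : α = 0 := by
    rcases lt_trichotomy α 0 with hn | hz | hp
    · exfalso
      refine h.alpha_pos h0 hR (e := -e) (α := -α) (by simpa using he) hC0 (by linarith) hA' ?_
      intro x hx
      simpa [inner_neg_left] using hα x hx
    · exact hz
    · exact (h.alpha_pos h0 hR he hC0 hp hA hα).elim
  have htube : ∀ x ∈ S, ‖x - (inner ℝ e x) • e‖ ≤ C := by
    intro x hx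
    have := hα x hx
    rw [hα0, mul_zero, zero_add] at this
    by_contra hc
    push Not at hc
    nlinarith [norm_nonneg (x - (inner ℝ e x) • e)]
  refine ⟨e, he, C, hC0, htube, ?_, ?_⟩
  · intro t
    by_contra! hc
    apply h.balanced h0 hR (K := 3 * |t| + C) hA
    intro y hy
    have h1 := hc y hy
    have h2 := pyth he y
    have h3 := htube y hy
    have h4 := neg_abs_le t
    have h5 : |inner ℝ e y| ≤ inner ℝ e y + 2 * |t| := by
      rw [abs_le]; constructor <;> linarith [abs_nonneg t]
    linarith
  · intro t
    by_contra! hc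
    apply h.balanced h0 hR (K := 3 * |t| + C) hA'
    intro y hy
    have h1 := hc y hy
    have h2 := pyth he y
    have h3 := htube y hy
    have h4 := le_abs_self t
    rw [inner_neg_left]
    have h5 : |inner ℝ e y| ≤ - inner ℝ e y + 2 * |t| := by
      rw [abs_le]; constructor <;> linarith [abs_nonneg t]
    linarith

end
end FlatPf
end

section
open MeasureTheory Metric
open scoped ENNReal NNReal
set_option linter.unusedSectionVars false
set_option linter.unusedVariables false

namespace FlatPf
section
variable {V : Type*} [NormedAddCommGroup V] [InnerProductSpace ℝ V] [FiniteDimensional ℝ V]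
  [MeasurableSpace V] [BorelSpace V]
variable {μ : Measure V} [IsLocallyFiniteMeasure μ] {S : Set V} {g : ℝ → ℝ}

lemma inner_decomp {e : V} (he : ‖e‖ = 1) (x y : V) :
    inner ℝ x y = inner ℝ e x * inner ℝ e y + inner ℝ (x - (inner ℝ e x) • e) (y - (inner ℝ e y) • e) := by
  rw [inner_sub_left, inner_sub_right, inner_sub_right, real_inner_smul_left, real_inner_smul_right,
    real_inner_smul_left, real_inner_smul_right, real_inner_self_eq_norm_sq, he, real_inner_comm x e]
  ring

lemma inner_decomp' {e : V} (he : ‖e‖ = 1) (x y : V) :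
    inner ℝ (x - (inner ℝ e x) • e) y = inner ℝ (x - (inner ℝ e x) • e) (y - (inner ℝ e y) • e) := by
  rw [inner_sub_right (x - _), inner_sub_left, inner_sub_left, real_inner_smul_left, real_inner_smul_right,
    real_inner_smul_left, real_inner_smul_right, real_inner_self_eq_norm_sq, he, real_inner_comm x e]
  ring

lemma norm_decomp {e : V} (he : ‖e‖ = 1) (x : V) :
    ‖x‖ ^ 2 = (inner ℝ e x) ^ 2 + ‖x - (inner ℝ e x) • e‖ ^ 2 := by
  have := inner_decomp he x x
  rw [real_inner_self_eq_norm_sq, real_inner_self_eq_norm_sq] at this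
  rw [this]; ring

lemma Unif.qv_near (h : Unif μ S g) (h0 : (0 : V) ∈ S) {e : V} (he : ‖e‖ = 1) {C : ℝ} (hC : 0 ≤ C)
    (htube : ∀ x ∈ S, ‖x - (inner ℝ e x) • e‖ ≤ C) {R : ℝ} (hR : 0 < R) {x : V} (hx : x ∈ S) :
    |qv μ R x - (inner ℝ e x) ^ 2 * TT μ R| ≤
      4 / ZZ μ R * aa μ R * (2 * |inner ℝ e x| * C ^ 2 * R + C ^ 4 + (inner ℝ e x) ^ 2 * C ^ 2) := by
  have hZ := h.ZZ_pos h0 hR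
  set x1 := inner ℝ e x with hx1
  set D := 2 * |x1| * C ^ 2 * R + C ^ 4 + x1 ^ 2 * C ^ 2
  rw [h.TT_eq h0 hR]
  unfold qv mQ
  rw [mul_left_comm, ← mul_sub, abs_mul, abs_of_pos (by positivity : 0 < 4 / ZZ μ R), mul_assoc]
  apply mul_le_mul_of_nonneg_left _ (by positivity)
  have i1 : Integrable (fun y => vv R y * inner ℝ x y ^ 2) μ := integ_vv μ hR.le (by fun_prop)
  have i2 : Integrable (fun y => vv R y * ‖y‖ ^ 2) μ := integ_vv μ hR.le (by fun_prop)
  have i3 : Integrable (fun y => vv R y) μ := by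
    simpa using integ_vv μ hR.le (f := fun _ => 1) (by fun_prop)
  rw [← integral_const_mul, ← integral_sub i1 (i2.const_mul _), ← Real.norm_eq_abs]
  unfold aa
  rw [← integral_mul_const]
  apply norm_integral_le_of_norm_le (i3.mul_const _)
  filter_upwards [h.ae_mem] with y hy
  rcases le_or_gt R ‖y‖ with hyR | hyR
  · simp [vv_zero hR.le hyR]
  rw [mul_left_comm, ← mul_sub, norm_mul, Real.norm_eq_abs, abs_of_nonneg (vv_nonneg _ _)]
  apply mul_le_mul_of_nonneg_left _ (vv_nonneg _ _)
  rw [norm_decomp he y, inner_decomp he x y, ← hx1]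
  have hxt := htube x hx
  have hyt := htube y hy
  have hs := abs_real_inner_le_norm (x - x1 • e) (y - (inner ℝ e y) • e)
  have hy1 : |inner ℝ e y| ≤ R := by
    have := abs_real_inner_le_norm e y
    rw [he, one_mul] at this; linarith
  rw [← hx1] at hxt
  set s := inner ℝ (x - x1 • e) (y - (inner ℝ e y) • e)
  set y1 := inner ℝ e y
  set p := ‖y - y1 • e‖
  have hp0 : 0 ≤ p := norm_nonneg _
  have hs2 : |s| ≤ C ^ 2 := by
    refine hs.trans ?_
    rw [sq]; gcongr
  rw [Real.norm_eq_abs]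
  have e1 : (x1 * y1 + s) ^ 2 - x1 ^ 2 * (y1 ^ 2 + p ^ 2) = 2 * x1 * s * y1 + s ^ 2 - x1 ^ 2 * p ^ 2 := by ring
  rw [e1]
  have b1 : |2 * x1 * s * y1| ≤ 2 * |x1| * C ^ 2 * R := by
    rw [abs_mul, abs_mul, abs_mul]; norm_num; gcongr
  have b2 : s ^ 2 ≤ C ^ 4 := by
    rw [← sq_abs, show C ^ 4 = (C ^ 2) ^ 2 by ring]; gcongr
  have b3 : x1 ^ 2 * p ^ 2 ≤ x1 ^ 2 * C ^ 2 := by gcongr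
  have b4 : 0 ≤ x1 ^ 2 * p ^ 2 := by positivity
  have b5 := abs_le.1 b1
  rw [abs_le]
  constructor <;> nlinarith [sq_nonneg s]

lemma Unif.qv_lim (h : Unif μ S g) (h0 : (0 : V) ∈ S) {e : V} (he : ‖e‖ = 1) {C : ℝ} (hC : 0 ≤ C)
    (htube : ∀ x ∈ S, ‖x - (inner ℝ e x) • e‖ ≤ C) {R : ℝ} (hR : 0 < R) {x : V} (hx : x ∈ S) :
    Filter.Tendsto (fun k : ℕ => qv μ (2 ^ k * R) x) Filter.atTop (nhds ((inner ℝ e x) ^ 2 * TT μ R)) := by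
  rw [tendsto_iff_norm_sub_tendsto_zero]
  set D := 2 * |inner ℝ e x| * C ^ 2 * R + C ^ 4 + (inner ℝ e x) ^ 2 * C ^ 2
  have hZ := h.ZZ_pos h0 hR
  have haa0 : 0 ≤ aa μ R := integral_nonneg (fun y => vv_nonneg R y)
  apply squeeze_zero (g := fun k : ℕ => 4 / ZZ μ R * aa μ R * D * (1 / 2) ^ k) (fun _ => norm_nonneg _)
  · intro k
    have hRk : 0 < 2 ^ k * R := by positivity
    have h1 := h.qv_near h0 he hC htube hRk hx
    rw [h.TT_pow h0 hR, h.ZZ_pow h0, h.aa_pow h0] at h1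
    rw [Real.norm_eq_abs]
    refine h1.trans ?_
    have e2 : (32 : ℝ) ^ k = 2 ^ k * 2 ^ k * 8 ^ k := by
      rw [← mul_pow, ← mul_pow]; norm_num
    have e3 : 4 / (32 ^ k * ZZ μ R) * (8 ^ k * aa μ R) *
       (2 * |inner ℝ e x| * C ^ 2 * (2 ^ k * R) + C ^ 4 + inner ℝ e x ^ 2 * C ^ 2)
       = 4 / ZZ μ R * aa μ R * (1 / 2) ^ k * ((1 / 2) ^ k *
        (2 * |inner ℝ e x| * C ^ 2 * (2 ^ k * R) + C ^ 4 + inner ℝ e x ^ 2 * C ^ 2)) := by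
      rw [e2, one_div, inv_pow]; field_simp
    rw [e3, mul_right_comm _ D, one_div, inv_pow]
    have h2k : (1 : ℝ) ≤ 2 ^ k := one_le_pow₀ (by norm_num)
    apply mul_le_mul_of_nonneg_left _ (by positivity)
    rw [inv_mul_le_iff₀ (by positivity)]
    have : 0 ≤ C ^ 4 + inner ℝ e x ^ 2 * C ^ 2 := by positivity
    nlinarith
  · have := tendsto_pow_atTop_nhds_zero_of_lt_one (r := (1 / 2 : ℝ)) (by norm_num) (by norm_num)
    simpa using this.const_mul _

lemma Unif.perp_bv (h : Unif μ S g) (h0 : (0 : V) ∈ S) {e : V} (he : ‖e‖ = 1) {C : ℝ} (hC : 0 ≤ C)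
    (htube : ∀ x ∈ S, ‖x - (inner ℝ e x) • e‖ ≤ C) {R : ℝ} (hR : 0 < R) {x : V} (hx : x ∈ S) :
    |inner ℝ (x - (inner ℝ e x) • e) (bv μ R)| ≤ 2 * C ^ 2 := by
  have hZ := h.ZZ_pos h0 hR
  rw [inner_bv hR, abs_mul, abs_of_pos (by positivity : 0 < 2 / ZZ μ R)]
  have : |mA μ R (x - (inner ℝ e x) • e)| ≤ ZZ μ R * C ^ 2 := by
    unfold mA ZZ
    rw [← integral_mul_const, ← Real.norm_eq_abs]
    have i1 : Integrable (fun y => (vv R y) ^ 2) μ := by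
      simpa using integ_vv2 μ hR.le (f := fun _ => 1) (by fun_prop)
    apply norm_integral_le_of_norm_le (i1.mul_const _)
    filter_upwards [h.ae_mem] with y hy
    rw [norm_mul, Real.norm_eq_abs, abs_of_nonneg (sq_nonneg _), Real.norm_eq_abs]
    apply mul_le_mul_of_nonneg_left _ (sq_nonneg _)
    rw [inner_decomp' he]
    refine (abs_real_inner_le_norm _ _).trans ?_
    rw [sq]
    exact mul_le_mul (htube x hx) (htube y hy) (norm_nonneg _) hC
  rw [div_mul_eq_mul_div, div_le_iff₀ hZ]
  linarith

lemma Unif.TT_one (h : Unif μ S g) (h0 : (0 : V) ∈ S) {e : V} (he : ‖e‖ = 1) {C : ℝ} (hC : 0 ≤ C)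
    (htube : ∀ x ∈ S, ‖x - (inner ℝ e x) • e‖ ≤ C) (hub : ∀ t, ∃ y ∈ S, t < inner ℝ e y)
    {R : ℝ} (hR : 0 < R) : TT μ R = 1 := by
  have key : ∀ x ∈ S, 1 ≤ inner ℝ e x → ∀ᶠ k : ℕ in Filter.atTop,
      |inner ℝ e x * (1 - TT μ R) - inner ℝ e (bv μ (2 ^ k * R))| ≤ 3 * C ^ 2 + 1 := by
    intro x hx hx1
    have h1 : Filter.Tendsto (fun k : ℕ => ‖x‖ ^ 2 - inner ℝ x (bv μ (2 ^ k * R)) - qv μ (2 ^ k * R) x)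
        Filter.atTop (nhds 0) := by
      apply squeeze_zero_norm' (a := fun k => (50 * R ^ 3 * g (4 * R) / ZZ μ R) * ‖x‖ ^ 3 * (1 / 2) ^ k)
      · obtain ⟨k0, hk0⟩ := pow_unbounded_of_one_lt (‖x‖ / R) (one_lt_two : (1 : ℝ) < 2)
        filter_upwards [Filter.eventually_ge_atTop k0] with k hk
        rw [div_lt_iff₀ hR] at hk0
        have : (2 : ℝ) ^ k0 ≤ 2 ^ k := pow_le_pow_right₀ (by norm_num) hk
        exact h.expandk h0 hR hx k (by nlinarith)
      · have := tendsto_pow_atTop_nhds_zero_of_lt_one (r := (1 / 2 : ℝ)) (by norm_num) (by norm_num)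
        simpa using this.const_mul _
    have h2 := h1.add ((h.qv_lim h0 he hC htube hR hx).sub_const (inner ℝ e x ^ 2 * TT μ R))
    have h3 := h2.abs
    simp only [sub_self, add_zero, abs_zero] at h3
    filter_upwards [h3.eventually_le_const (zero_lt_one)] with k hk
    have hRk : 0 < 2 ^ k * R := by positivity
    have h4 := h.perp_bv h0 he hC htube hRk hx
    have h5 : inner ℝ x (bv μ (2 ^ k * R)) = inner ℝ e x * inner ℝ e (bv μ (2 ^ k * R))
        + inner ℝ (x - (inner ℝ e x) • e) (bv μ (2 ^ k * R)) := by
      rw [inner_sub_left, real_inner_smul_left]; ring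
    have h6 := norm_decomp he x
    have h7 := htube x hx
    rw [h5, h6] at hk
    have h8 : ‖x - (inner ℝ e x) • e‖ ^ 2 ≤ C ^ 2 := by gcongr
    have h9 := sq_nonneg ‖x - (inner ℝ e x) • e‖
    set x1 := inner ℝ e x
    have hk' := abs_le.1 hk
    have h4' := abs_le.1 h4
    have h10 : |x1 * (x1 * (1 - TT μ R) - inner ℝ e (bv μ (2 ^ k * R)))| ≤ 3 * C ^ 2 + 1 := by
      rw [abs_le]
      constructor <;> nlinarith
    rw [abs_mul, abs_of_pos (by linarith : 0 < x1)] at h10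
    have := abs_nonneg (x1 * (1 - TT μ R) - inner ℝ e (bv μ (2 ^ k * R)))
    nlinarith
  obtain ⟨x, hx, hx1⟩ := hub 1
  by_contra hT
  have hpos : 0 < |1 - TT μ R| := abs_pos.2 (fun h => hT (by linarith))
  set D := 3 * C ^ 2 + 1
  obtain ⟨z, hz, hz1⟩ := hub (inner ℝ e x + (2 * D + 1) / |1 - TT μ R|)
  have hDp : 0 < (2 * D + 1) / |1 - TT μ R| := by positivity
  obtain ⟨k, hk1, hk2⟩ := ((key x hx hx1.le).and (key z hz (by linarith))).exists
  have h1 : |(inner ℝ e z - inner ℝ e x) * (1 - TT μ R)| ≤ 2 * D := by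
    have := abs_sub (inner ℝ e z * (1 - TT μ R) - inner ℝ e (bv μ (2 ^ k * R)))
      (inner ℝ e x * (1 - TT μ R) - inner ℝ e (bv μ (2 ^ k * R)))
    have e1 : (inner ℝ e z - inner ℝ e x) * (1 - TT μ R) =
      (inner ℝ e z * (1 - TT μ R) - inner ℝ e (bv μ (2 ^ k * R)))
      - (inner ℝ e x * (1 - TT μ R) - inner ℝ e (bv μ (2 ^ k * R))) := by ring
    rw [e1]; linarith
  rw [abs_mul, abs_of_pos (by linarith)] at h1
  have h2 : (2 * D + 1) / |1 - TT μ R| < inner ℝ e z - inner ℝ e x := by linarith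
  rw [div_lt_iff₀ hpos] at h2
  linarith

lemma Unif.linear (h : Unif μ S g) (h0 : (0 : V) ∈ S) (hT : ∀ R, 0 < R → TT μ R = 1) :
    ∃ c : ℝ, 0 < c ∧ ∀ r, 0 < r → g r = c * r := by
  have hrel : ∀ R, 0 < R → 4 * R ^ 2 * aa μ R = 5 * ZZ μ R := by
    intro R hR
    have hZ := h.ZZ_pos h0 hR
    have := hT R hR
    unfold TT at this
    have h2 : 4 * R ^ 2 * aa μ R / ZZ μ R = 5 := by linarith
    rw [div_eq_iff hZ.ne'] at h2; exact h2
  have hconst : ∀ a b, 0 < a → a < b → ZZ μ b / b ^ 5 = ZZ μ a / a ^ 5 := by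
    intro a b ha hab
    obtain ⟨c, hc, hc'⟩ := exists_hasDerivAt_eq_slope (fun R => ZZ μ R / R ^ 5)
      (fun R => ((4 * R ^ 2 * aa μ R - 5 * ZZ μ R) / R ^ 6)) hab (by
        intro x hx
        exact (ZZ5_deriv μ (by linarith [hx.1])).continuousAt.continuousWithinAt)
      (fun x hx => ZZ5_deriv μ (by linarith [hx.1]))
    rw [hrel c (by linarith [hc.1]), sub_self, zero_div] at hc'
    have : b - a ≠ 0 := by linarith
    rw [eq_comm, div_eq_zero_iff] at hc'
    rcases hc' with h | h
    · linarith
    · exact absurd h this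
  set z := ZZ μ 1
  have hz : 0 < z := h.ZZ_pos h0 one_pos
  have hZ : ∀ R, 0 < R → ZZ μ R = z * R ^ 5 := by
    intro R hR
    rcases lt_trichotomy R 1 with h1 | h1 | h1
    · have := hconst R 1 hR h1
      rw [one_pow, div_one, eq_div_iff (by positivity)] at this
      exact this.symm
    · rw [h1]; ring
    · have := hconst 1 R one_pos h1
      rw [one_pow, div_one, div_eq_iff (by positivity)] at this
      exact this
  have ha : ∀ R, 0 < R → aa μ R = 5 / 4 * z * R ^ 3 := by
    intro R hR
    have h1 := hrel R hR
    rw [hZ R hR] at h1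
    have : 0 < 4 * R ^ 2 := by positivity
    apply mul_left_cancel₀ this.ne'
    rw [h1]; ring
  have i3 : ∀ R : ℝ, 0 < R → Integrable (fun y => vv R y) μ := fun R hR => by
    simpa using integ_vv μ hR.le (f := fun _ => 1) (by fun_prop)
  have hind : ∀ (R c : ℝ), 0 < R → g R * c = ∫ y, (Metric.ball (0 : V) R).indicator (fun _ => c) y ∂μ := by
    intro R c hR
    rw [integral_indicator_const _ measurableSet_ball, h.ball 0 h0 R hR]; simp
  have hii : ∀ (R c : ℝ), Integrable ((Metric.ball (0 : V) R).indicator (fun _ => c)) μ := fun R c =>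
    (integrable_indicator_iff measurableSet_ball).2 (integrableOn_const (ball_ne_top _ _ _))
  have lo : ∀ R R', 0 < R → R < R' → g R * (R' ^ 2 - R ^ 2) ≤ aa μ R' - aa μ R := by
    intro R R' hR hRR
    unfold aa
    rw [hind R _ hR, ← integral_sub (i3 R' (hR.trans hRR)) (i3 R hR)]
    apply integral_mono (hii _ _) (int_sub (i3 R' (hR.trans hRR)) (i3 R hR))
    intro y
    by_cases hy : y ∈ Metric.ball (0 : V) R
    · simp only [Set.indicator_of_mem hy]
      have hy' : ‖y‖ < R := by simpa using hy
      unfold vv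
      rw [max_eq_left (by nlinarith [norm_nonneg y]), max_eq_left (by nlinarith [norm_nonneg y])]
      linarith
    · simp only [Set.indicator_of_notMem hy]
      have := vv_mono (R := R) (R' := R') (by rw [abs_of_pos hR]; exact hRR.le) y
      linarith
  have hi : ∀ R R', 0 < R → R < R' → aa μ R' - aa μ R ≤ g R' * (R' ^ 2 - R ^ 2) := by
    intro R R' hR hRR
    unfold aa
    rw [hind R' _ (hR.trans hRR), ← integral_sub (i3 R' (hR.trans hRR)) (i3 R hR)]
    apply integral_mono (int_sub (i3 R' (hR.trans hRR)) (i3 R hR)) (hii _ _)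
    intro y
    by_cases hy : y ∈ Metric.ball (0 : V) R'
    · simp only [Set.indicator_of_mem hy]
      have hy' : ‖y‖ < R' := by simpa using hy
      unfold vv
      rw [max_eq_left (a := R' ^ 2 - ‖y‖ ^ 2) (by nlinarith [norm_nonneg y])]
      linarith [le_max_left (R ^ 2 - ‖y‖ ^ 2) 0]
    · simp only [Set.indicator_of_notMem hy]
      have hy' : R' ≤ ‖y‖ := by simpa using hy
      rw [vv_zero (by linarith) hy', vv_zero hR.le (by linarith)]; simp
  refine ⟨5 / 4 * z * (3 / 2), by positivity, fun r hr => ?_⟩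
  have hcont : ContinuousAt (fun R' => 5 / 4 * z * (R' ^ 2 + r * R' + r ^ 2) / (R' + r)) r := by
    apply ContinuousAt.div (by fun_prop) (by fun_prop); positivity
  have hval : 5 / 4 * z * (r ^ 2 + r * r + r ^ 2) / (r + r) = 5 / 4 * z * (3 / 2) * r := by
    field_simp; ring
  have hc2 := hcont.tendsto
  rw [hval] at hc2
  apply le_antisymm
  · refine ge_of_tendsto (hc2.mono_left nhdsWithin_le_nhds : Filter.Tendsto _ (nhdsWithin r (Set.Ioi r)) _) ?_
    filter_upwards [self_mem_nhdsWithin] with R' hR'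
    have hR'' : r < R' := hR'
    have := lo r R' hr hR''
    rw [ha r hr, ha R' (hr.trans hR'')] at this
    rw [le_div_iff₀ (by linarith)]
    have hd : 0 < R' - r := by linarith
    have h5 : (g r * (R' + r)) * (R' - r) ≤ (5 / 4 * z * (R' ^ 2 + r * R' + r ^ 2)) * (R' - r) := by
      nlinarith
    exact le_of_mul_le_mul_right h5 hd
  · refine le_of_tendsto (hc2.mono_left nhdsWithin_le_nhds : Filter.Tendsto _ (nhdsWithin r (Set.Iio r)) _) ?_
    have : Set.Ioo 0 r ∈ nhdsWithin r (Set.Iio r) := Ioo_mem_nhdsLT hr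
    filter_upwards [this] with R' hR'
    have := hi R' r hR'.1 hR'.2
    rw [ha r hr, ha R' hR'.1] at this
    rw [div_le_iff₀ (by linarith [hR'.1])]
    have hd : 0 < r - R' := by linarith [hR'.2]
    have h5 : (5 / 4 * z * (R' ^ 2 + r * R' + r ^ 2)) * (r - R') ≤ (g r * (R' + r)) * (r - R') := by
      nlinarith
    exact le_of_mul_le_mul_right h5 hd

end
end FlatPf
end

section
open MeasureTheory Metric
open scoped ENNReal NNReal
set_option linter.unusedSectionVars false
set_option linter.unusedVariables false

namespace FlatPf
section
variable {V : Type*} [NormedAddCommGroup V] [InnerProductSpace ℝ V] [FiniteDimensional ℝ V]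
  [MeasurableSpace V] [BorelSpace V]
variable {μ : Measure V} [IsLocallyFiniteMeasure μ] {S : Set V} {g : ℝ → ℝ} {c : ℝ}

structure Lin (μ : Measure V) (S : Set V) (c : ℝ) : Prop where
  closed : IsClosed S
  null : μ Sᶜ = 0
  cpos : 0 < c
  ball : ∀ x ∈ S, ∀ r, 0 < r → μ (ball x r) = ENNReal.ofReal (c * r)

structure Cluster (μ : Measure V) (S : Set V) (c r : ℝ) (K : Set V) : Prop where
  sub : K ⊆ S
  ne : K.Nonempty
  meas : MeasurableSet K
  mass : μ K = ENNReal.ofReal (c * r)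
  gap : ∀ p ∈ K, ∀ q ∈ S, q ∉ K → r ≤ dist p q

lemma Lin.meas_inter (h : Lin μ S c) (A : Set V) : μ (A ∩ S) = μ A := by
  apply le_antisymm (measure_mono Set.inter_subset_left)
  calc μ A ≤ μ ((A ∩ S) ∪ Sᶜ) := measure_mono (fun y hy => by
        by_cases h : y ∈ S
        · exact Or.inl ⟨hy, h⟩
        · exact Or.inr h)
    _ ≤ μ (A ∩ S) + μ Sᶜ := measure_union_le _ _
    _ = _ := by rw [h.null, add_zero]

lemma Lin.notMem_open (h : Lin μ S c) {U : Set V} (hU : IsOpen U) (hU0 : μ U = 0) {x : V}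
    (hx : x ∈ S) : x ∉ U := by
  intro hxU
  obtain ⟨r, hr, hb⟩ := Metric.isOpen_iff.1 hU x hxU
  have := h.ball x hx r hr
  rw [measure_mono_null hb hU0] at this
  have h2 : 0 < c * r := mul_pos h.cpos hr
  have := (ENNReal.ofReal_eq_zero.1 this.symm)
  linarith

/-- one-sided part of Lemma A -/
lemma Lin.lemA0 (h : Lin μ S c) {E1 E2 : Set V} (hS : S = E1 ∪ E2) {r : ℝ} (hr : 0 < r)
    (hgap : ∀ p ∈ E1, ∀ q ∈ E2, r ≤ dist p q) {x y : V} (hx : x ∈ E1) (hy : y ∈ E2)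
    (hxy : dist x y = r) :
    μ (Metric.ball x (2 * r) \ ((Metric.ball x r ∩ S) ∪ (Metric.ball y r ∩ S))) = 0 ∧
    ∀ z ∈ S, z ∈ Metric.ball x (2 * r) → z ∈ closedBall x r ∪ closedBall y r := by
  have hxS : x ∈ S := by rw [hS]; exact Or.inl hx
  have hyS : y ∈ S := by rw [hS]; exact Or.inr hy
  have mS : MeasurableSet S := h.closed.measurableSet
  have hdisj : Disjoint (Metric.ball x r ∩ S) (Metric.ball y r ∩ S) := by
    rw [Set.disjoint_left]
    rintro z ⟨hz1, hzS⟩ ⟨hz2, _⟩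
    rw [hS] at hzS
    rcases hzS with hz | hz
    · have := hgap z hz y hy
      rw [mem_ball] at hz2; linarith
    · have := hgap x hx z hz
      rw [mem_ball, dist_comm] at hz1; linarith
  have hsub : (Metric.ball x r ∩ S) ∪ (Metric.ball y r ∩ S) ⊆ Metric.ball x (2 * r) := by
    rintro z (⟨hz, _⟩ | ⟨hz, _⟩)
    · rw [mem_ball] at hz ⊢; linarith
    · rw [mem_ball] at hz ⊢
      have := dist_triangle z y x
      rw [dist_comm y x] at this; linarith
  have h1 : μ (Metric.ball x (2 * r) \ ((Metric.ball x r ∩ S) ∪ (Metric.ball y r ∩ S))) = 0 := by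
    rw [measure_diff hsub ((measurableSet_ball.inter mS).union (measurableSet_ball.inter mS)).nullMeasurableSet
      (measure_ne_top_of_subset hsub (ball_ne_top _ _ _)),
      measure_union hdisj (measurableSet_ball.inter mS), h.meas_inter, h.meas_inter,
      h.ball x hxS r hr, h.ball y hyS r hr, h.ball x hxS _ (by positivity),
      ← ENNReal.ofReal_add (mul_pos h.cpos hr).le (mul_pos h.cpos hr).le]
    rw [show c * (2 * r) = c * r + c * r by ring, tsub_self]
  refine ⟨h1, fun z hz hzb => ?_⟩
  by_contra hc
  have hO : IsOpen (Metric.ball x (2 * r) \ (closedBall x r ∪ closedBall y r)) :=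
    isOpen_ball.sdiff (isClosed_closedBall.union isClosed_closedBall)
  refine h.notMem_open hO ?_ hz ⟨hzb, hc⟩
  refine measure_mono_null ?_ h1
  apply Set.diff_subset_diff_right
  exact Set.union_subset_union (fun z hz => ball_subset_closedBall hz.1) (fun z hz => ball_subset_closedBall hz.1)

lemma Lin.lemA (h : Lin μ S c) {E1 E2 : Set V} (hS : S = E1 ∪ E2) (m1 : MeasurableSet E1) {r : ℝ} (hr : 0 < r)
    (hgap : ∀ p ∈ E1, ∀ q ∈ E2, r ≤ dist p q) {x y : V} (hx : x ∈ E1) (hy : y ∈ E2)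
    (hxy : dist x y = r) :
    Cluster μ S c r (E1 ∩ (Metric.ball x (2 * r) ∪ Metric.ball y (2 * r))) := by
  have hxS : x ∈ S := by rw [hS]; exact Or.inl hx
  obtain ⟨n1, s1⟩ := h.lemA0 hS hr hgap hx hy hxy
  obtain ⟨n2, s2⟩ := h.lemA0 (by rw [hS, Set.union_comm]) hr
    (fun p hp q hq => by rw [dist_comm]; exact hgap q hq p hp) hy hx (by rw [dist_comm]; exact hxy)
  have hE1S : E1 ⊆ S := by rw [hS]; exact Set.subset_union_left
  refine ⟨fun z hz => hE1S hz.1, ⟨x, hx, Or.inl (mem_ball_self (by positivity))⟩,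
    m1.inter (measurableSet_ball.union measurableSet_ball), ?_, ?_⟩
  · apply le_antisymm
    · rw [← h.ball x hxS r hr]
      calc _ ≤ μ (Metric.ball x r ∪ ((Metric.ball x (2 * r) \ ((Metric.ball x r ∩ S) ∪ (Metric.ball y r ∩ S)))
            ∪ (Metric.ball y (2 * r) \ ((Metric.ball y r ∩ S) ∪ (Metric.ball x r ∩ S))))) := by
              apply measure_mono
              rintro z ⟨hz1, hz2⟩
              by_cases hzx : z ∈ Metric.ball x r
              · exact Or.inl hzx
              right
              have hzy : z ∉ Metric.ball y r := by
                intro hzy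
                have := hgap z hz1 y hy
                rw [mem_ball] at hzy; linarith
              rcases hz2 with hz2 | hz2
              · left; exact ⟨hz2, by rintro (h | h); exacts [hzx h.1, hzy h.1]⟩
              · right; exact ⟨hz2, by rintro (h | h); exacts [hzy h.1, hzx h.1]⟩
        _ ≤ μ (Metric.ball x r) + (0 + 0) := by
              refine (measure_union_le _ _).trans (add_le_add le_rfl ?_)
              refine (measure_union_le _ _).trans ?_
              rw [n1, n2]
        _ = _ := by simp
    · rw [← h.ball x hxS r hr, ← h.meas_inter]
      apply measure_mono
      rintro z ⟨hz, hzS⟩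
      refine ⟨?_, Or.inl (ball_subset_ball (by linarith) hz)⟩
      rw [hS] at hzS
      rcases hzS with hz' | hz'
      · exact hz'
      · have := hgap x hx z hz'
        rw [mem_ball, dist_comm] at hz; linarith
  · rintro p ⟨hp, hpU⟩ q hq hqn
    have hqS := hq
    rw [hS] at hq
    rcases hq with hq | hq
    · have hqU : q ∉ Metric.ball x (2 * r) ∪ Metric.ball y (2 * r) := fun hc => hqn ⟨hq, hc⟩
      have hpc : p ∈ closedBall x r ∪ closedBall y r := by
        rcases hpU with hpU | hpU
        · exact s1 p (hE1S hp) hpU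
        · exact (s2 p (hE1S hp) hpU).symm
      rw [Set.mem_union, not_or, mem_ball, mem_ball, not_lt, not_lt] at hqU
      rcases hpc with hpc | hpc
      · rw [mem_closedBall] at hpc
        have := dist_triangle q p x
        rw [dist_comm q p] at this
        linarith [hqU.1]
      · rw [mem_closedBall] at hpc
        have := dist_triangle q p y
        rw [dist_comm q p] at this
        linarith [hqU.2]
    · exact hgap p hp q hq

lemma Cluster.ball_sub {r : ℝ} {K : Set V} (k : Cluster μ S c r K) {p : V} (hp : p ∈ K) :
    Metric.ball p r ∩ S ⊆ K := by
  rintro z ⟨hz, hzS⟩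
  by_contra hc
  have := k.gap p hp z hzS hc
  rw [mem_ball, dist_comm] at hz; linarith

lemma Cluster.null (h : Lin μ S c) {r : ℝ} (hr : 0 < r) {K : Set V} (k : Cluster μ S c r K) {p : V} (hp : p ∈ K) :
    μ (K \ (Metric.ball p r ∩ S)) = 0 := by
  rw [measure_diff (k.ball_sub hp) (measurableSet_ball.inter h.closed.measurableSet).nullMeasurableSet
    (measure_ne_top_of_subset Set.inter_subset_left (ball_ne_top _ _ _)), k.mass, h.meas_inter,
    h.ball p (k.sub hp) r hr, tsub_self]

lemma Cluster.diam (h : Lin μ S c) {r : ℝ} (hr : 0 < r) {K : Set V} (k : Cluster μ S c r K) {p q : V}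
    (hp : p ∈ K) (hq : q ∈ K) : dist q p ≤ r := by
  by_contra! hc
  have h1 : Metric.ball q (min r (dist q p - r)) ∩ S ⊆ K \ (Metric.ball p r ∩ S) := by
    rintro z ⟨hz, hzS⟩
    rw [mem_ball, lt_min_iff] at hz
    refine ⟨k.ball_sub hq ⟨hz.1, hzS⟩, ?_⟩
    rintro ⟨hz', _⟩
    rw [mem_ball] at hz'
    have := dist_triangle q z p
    rw [dist_comm q z] at this
    linarith [hz.2]
  have h2 := measure_mono_null h1 (k.null h hr hp)
  have hmin : 0 < min r (dist q p - r) := lt_min hr (by linarith)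
  rw [h.meas_inter, h.ball q (k.sub hq) _ hmin, ENNReal.ofReal_eq_zero] at h2
  have := mul_pos h.cpos hmin
  linarith

lemma Cluster.eq_of_inter (h : Lin μ S c) {r : ℝ} (hr : 0 < r) {K L : Set V} (k : Cluster μ S c r K)
    (l : Cluster μ S c r L) {p : V} (hpk : p ∈ K) (hpl : p ∈ L) : K ⊆ L := by
  intro q hq
  by_contra hc
  have h1 : Metric.ball q r ∩ S ⊆ K \ (Metric.ball p r ∩ S) := by
    rintro z hz
    refine ⟨k.ball_sub hq hz, ?_⟩
    intro hz'
    have hzL := l.ball_sub hpl hz'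
    have := l.gap z hzL q (k.sub hq) hc
    have h3 := hz.1
    rw [mem_ball] at h3; linarith
  have h2 := measure_mono_null h1 (k.null h hr hpk)
  rw [h.meas_inter, h.ball q (k.sub hq) _ hr, ENNReal.ofReal_eq_zero] at h2
  have := mul_pos h.cpos hr
  linarith

lemma Cluster.closed (h : Lin μ S c) {r : ℝ} (hr : 0 < r) {K : Set V} (k : Cluster μ S c r K) :
    IsClosed K := by
  apply isClosed_of_closure_subset
  intro p hp
  have hpS : p ∈ S := h.closed.closure_subset_iff.2 k.sub hp
  by_contra hc
  obtain ⟨q, hq, hqp⟩ := Metric.mem_closure_iff.1 hp r hr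
  have := k.gap q hq p hpS hc
  rw [dist_comm] at this; linarith

lemma Cluster.closed' (h : Lin μ S c) {r : ℝ} (hr : 0 < r) {K : Set V} (k : Cluster μ S c r K) :
    IsClosed (S \ K) := by
  apply isClosed_of_closure_subset
  intro p hp
  have hpS : p ∈ S := h.closed.closure_subset_iff.2 Set.diff_subset hp
  refine ⟨hpS, fun hc => ?_⟩
  obtain ⟨q, hq, hqp⟩ := Metric.mem_closure_iff.1 hp r hr
  have := k.gap p hc q hq.1 hq.2
  linarith

lemma Cluster.partner (h : Lin μ S c) {r : ℝ} (hr : 0 < r) {K : Set V} (k : Cluster μ S c r K) {p : V}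
    (hp : p ∈ K) : ∃ q ∈ S \ K, dist p q = r := by
  have hcomp : IsCompact ((S \ K) ∩ closedBall p (2 * r)) :=
    (isCompact_closedBall p (2 * r)).inter_left (k.closed' h hr)
  have bound : ∀ s, 0 < s → (∀ z ∈ S, z ∉ K → s ≤ dist p z) → s ≤ r := by
    intro s hs hz
    have h1 : Metric.ball p s ∩ S ⊆ K := by
      rintro z ⟨hzb, hzS⟩
      by_contra hc
      have := hz z hzS hc
      rw [mem_ball, dist_comm] at hzb; linarith
    have h2 := measure_mono (μ := μ) h1
    rw [h.meas_inter, h.ball p (k.sub hp) s hs, k.mass,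
      ENNReal.ofReal_le_ofReal_iff (mul_pos h.cpos hr).le] at h2
    exact le_of_mul_le_mul_left h2 h.cpos
  by_cases hne : ((S \ K) ∩ closedBall p (2 * r)).Nonempty
  · obtain ⟨q, hq, hmin⟩ := hcomp.exists_isMinOn hne (f := fun z => dist p z) (by fun_prop)
    refine ⟨q, hq.1, le_antisymm ?_ (k.gap p hp q hq.1.1 hq.1.2)⟩
    apply bound
    · linarith [k.gap p hp q hq.1.1 hq.1.2]
    · intro z hzS hzK
      by_cases hzb : z ∈ closedBall p (2 * r)
      · exact hmin ⟨⟨hzS, hzK⟩, hzb⟩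
      · have h2 := hq.2
        rw [mem_closedBall, dist_comm] at h2 hzb
        linarith
  · exfalso
    have := bound (2 * r) (by positivity) (fun z hzS hzK => by
      by_contra hc
      push Not at hc
      exact hne ⟨z, ⟨hzS, hzK⟩, by rw [mem_closedBall, dist_comm]; exact hc.le⟩)
    linarith

lemma Cluster.compn (h : Lin μ S c) {r : ℝ} (hr : 0 < r) {K : Set V} (k : Cluster μ S c r K) :
    ∃ L, Cluster μ S c r L ∧ Disjoint K L ∧ (∃ p ∈ K, ∃ q ∈ L, dist p q = r) ∧
      ∀ p ∈ K, Metric.ball p (2 * r) ∩ S ⊆ K ∪ L := by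
  choose! Q hQ1 hQ2 using fun p (hp : p ∈ K) => k.partner h hr hp
  have hS : S = (S \ K) ∪ K := by rw [Set.diff_union_of_subset k.sub]
  have mSK : MeasurableSet (S \ K) := h.closed.measurableSet.diff k.meas
  have cl : ∀ p ∈ K, Cluster μ S c r ((S \ K) ∩ (Metric.ball (Q p) (2 * r) ∪ Metric.ball p (2 * r))) := by
    intro p hp
    exact h.lemA hS mSK hr (fun a ha b hb => by rw [dist_comm]; exact k.gap b hb a ha.1 ha.2) (hQ1 p hp) hp
      (by rw [dist_comm]; exact hQ2 p hp)
  have hQmem : ∀ p ∈ K, Q p ∈ ((S \ K) ∩ (Metric.ball (Q p) (2 * r) ∪ Metric.ball p (2 * r))) :=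
    fun p hp => ⟨hQ1 p hp, Or.inl (mem_ball_self (by positivity))⟩
  have near : ∀ p ∈ K, ∀ p' ∈ K, dist p p' < r →
      ((S \ K) ∩ (Metric.ball (Q p') (2 * r) ∪ Metric.ball p' (2 * r))) ⊆
      ((S \ K) ∩ (Metric.ball (Q p) (2 * r) ∪ Metric.ball p (2 * r))) := by
    intro p hp p' hp' hd
    refine (cl p' hp').eq_of_inter h hr (cl p hp) (hQmem p' hp') ?_
    refine ⟨hQ1 p' hp', Or.inr ?_⟩
    rw [mem_ball, dist_comm]
    have := dist_triangle p p' (Q p')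
    rw [hQ2 p' hp'] at this; linarith
  obtain ⟨p0, hp0⟩ := k.ne
  refine ⟨_, cl p0 hp0, ?_, ⟨p0, hp0, Q p0, hQmem p0 hp0, hQ2 p0 hp0⟩, ?_⟩
  · rw [Set.disjoint_left]
    rintro z hz ⟨hz', _⟩
    exact hz'.2 hz
  · rintro p hp z ⟨hz, hzS⟩
    by_cases hzK : z ∈ K
    · exact Or.inl hzK
    right
    have hzp : z ∈ ((S \ K) ∩ (Metric.ball (Q p) (2 * r) ∪ Metric.ball p (2 * r))) := ⟨⟨hzS, hzK⟩, Or.inr hz⟩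
    obtain ⟨m, hmK, hm1, hm2⟩ : ∃ m ∈ K, m ∈ Metric.ball p r ∧ m ∈ Metric.ball p0 r := by
      by_contra! hc
      have : K ⊆ (K \ (Metric.ball p r ∩ S)) ∪ (K \ (Metric.ball p0 r ∩ S)) := by
        intro z hz
        by_cases h1 : z ∈ Metric.ball p r
        · right; exact ⟨hz, fun h2 => hc z hz h1 h2.1⟩
        · left; exact ⟨hz, fun h2 => h1 h2.1⟩
      have h0 : μ K = 0 := measure_mono_null this (measure_union_null (k.null h hr hp) (k.null h hr hp0))
      rw [k.mass, ENNReal.ofReal_eq_zero] at h0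
      linarith [mul_pos h.cpos hr]
    exact near p0 hp0 m hmK (by rw [dist_comm]; exact hm2) (near m hmK p hp hm1 hzp)

lemma Cluster.double (h : Lin μ S c) {r : ℝ} (hr : 0 < r) {K : Set V} (k : Cluster μ S c r K) :
    ∃ K', Cluster μ S c (2 * r) K' := by
  obtain ⟨L, l, hd, ⟨p, hp, q, hq, hpq⟩, hb⟩ := k.compn h hr
  obtain ⟨M, m, hd2, _, hb2⟩ := l.compn h hr
  have hpM : p ∈ M := by
    have : p ∈ L ∪ M := hb2 q hq ⟨by rw [mem_ball, hpq]; linarith, k.sub hp⟩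
    rcases this with h1 | h1
    · exact absurd h1 (Set.disjoint_left.1 hd hp)
    · exact h1
  have hMK : M ⊆ K := m.eq_of_inter h hr k hpM hp
  refine ⟨K ∪ L, Set.union_subset k.sub l.sub, k.ne.inl, k.meas.union l.meas, ?_, ?_⟩
  · rw [measure_union hd l.meas, k.mass, l.mass,
      ← ENNReal.ofReal_add (mul_pos h.cpos hr).le (mul_pos h.cpos hr).le]
    congr 1; ring
  · rintro a ha z hzS hz
    by_contra! hc
    have hzb : z ∈ Metric.ball a (2 * r) ∩ S := ⟨by rw [mem_ball, dist_comm]; exact hc, hzS⟩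
    rcases ha with ha | ha
    · exact hz (hb a ha hzb)
    · rcases hb2 a ha hzb with h1 | h1
      · exact hz (Or.inr h1)
      · exact hz (Or.inl (hMK h1))

lemma tube_dist {e : V} (he : ‖e‖ = 1) {C : ℝ} (htube : ∀ x ∈ S, ‖x - (inner ℝ e x) • e‖ ≤ C) {x y : V}
    (hx : x ∈ S) (hy : y ∈ S) : dist x y ≤ |inner ℝ e x - inner ℝ e y| + 2 * C := by
  have h1 := htube x hx
  have h2 := htube y hy
  have e1 : x - y = (inner ℝ e x - inner ℝ e y) • e + ((x - (inner ℝ e x) • e) - (y - (inner ℝ e y) • e)) := by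
    rw [sub_smul]; abel
  rw [dist_eq_norm, e1]
  refine (norm_add_le _ _).trans ?_
  have := norm_sub_le (x - (inner ℝ e x) • e) (y - (inner ℝ e y) • e)
  rw [norm_smul, he, mul_one, Real.norm_eq_abs]
  linarith

lemma inner_dist {e : V} (he : ‖e‖ = 1) (x y : V) : |inner ℝ e x - inner ℝ e y| ≤ dist x y := by
  rw [← inner_sub_right, dist_eq_norm]
  have := abs_real_inner_le_norm e (x - y)
  rwa [he, one_mul] at this

lemma Cluster.no_big (h : Lin μ S c) {e : V} (he : ‖e‖ = 1) {C : ℝ}  (hC : 0 ≤ C)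
    (htube : ∀ x ∈ S, ‖x - (inner ℝ e x) • e‖ ≤ C) {R : ℝ} (hR : 0 < R) (hRC : 100 * C ≤ R)
    {K : Set V} (k : Cluster μ S c R K) : False := by
  obtain ⟨p0, hp0⟩ := k.ne
  have hcomp : IsCompact K := (isCompact_closedBall p0 R).of_isClosed_subset (k.closed h hR)
    (fun q hq => mem_closedBall.2 (k.diam h hR hp0 hq))
  obtain ⟨pa, hpa, hmin⟩ := hcomp.exists_isMinOn k.ne (f := fun z => (inner ℝ e z : ℝ)) (by fun_prop)
  obtain ⟨pb, hpb, hmax⟩ := hcomp.exists_isMaxOn k.ne (f := fun z => (inner ℝ e z : ℝ)) (by fun_prop)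
  have hab := k.diam h hR hpa hpb
  have hab2 := inner_dist he pb pa
  have hmin' : ∀ z ∈ K, inner ℝ e pa ≤ inner ℝ e z := fun z hz => hmin hz
  have hmax' : ∀ z ∈ K, inner ℝ e z ≤ inner ℝ e pb := fun z hz => hmax hz
  obtain ⟨p, hp, h1, h2⟩ : ∃ p ∈ K, inner ℝ e pa + R / 8 ≤ inner ℝ e p ∧ inner ℝ e p ≤ inner ℝ e pb - R / 8 := by
    by_contra! hc
    have hsub : K ⊆ Metric.ball pa (R / 4) ∪ Metric.ball pb (R / 4) := by
      intro z hz
      by_cases hz1 : inner ℝ e pa + R / 8 ≤ inner ℝ e z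
      · right
        have hz2 := hc z hz hz1
        have := tube_dist he htube (k.sub hz) (k.sub hpb)
        rw [mem_ball]
        have h4 : |inner ℝ e z - inner ℝ e pb| ≤ R / 8 := by
          rw [abs_le]; constructor <;> linarith [hmax' z hz]
        linarith
      · left
        have := tube_dist he htube (k.sub hz) (k.sub hpa)
        rw [mem_ball]
        have h4 : |inner ℝ e z - inner ℝ e pa| ≤ R / 8 := by
          rw [abs_le]; constructor <;> linarith [hmin' z hz]
        linarith
    have h5 := (measure_mono (μ := μ) hsub).trans (measure_union_le _ _)
    have hcp := h.cpos
    rw [k.mass, h.ball pa (k.sub hpa) _ (by positivity), h.ball pb (k.sub hpb) _ (by positivity),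
      ← ENNReal.ofReal_add (by positivity) (by positivity), ENNReal.ofReal_le_ofReal_iff (by positivity)] at h5
    nlinarith [mul_pos hcp hR]
  obtain ⟨q, hq, hpq⟩ := k.partner h hR hp
  have hq1 := inner_dist he p q
  rw [hpq] at hq1
  have hq2 := abs_le.1 hq1
  have hab3 := abs_le.1 (hab2.trans hab)
  rcases le_total (inner ℝ e p) (inner ℝ e q) with hle | hle
  · have h3 := k.gap pb hpb q hq.1 hq.2
    have h4 := tube_dist he htube (k.sub hpb) hq.1
    have h5 : |inner ℝ e pb - inner ℝ e q| ≤ 7 * R / 8 := by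
      rw [abs_le]; constructor <;> linarith
    linarith
  · have h3 := k.gap pa hpa q hq.1 hq.2
    have h4 := tube_dist he htube (k.sub hpa) hq.1
    have h5 : |inner ℝ e pa - inner ℝ e q| ≤ 7 * R / 8 := by
      rw [abs_le]; constructor <;> linarith
    linarith

lemma Cluster.none (h : Lin μ S c) {e : V} (he : ‖e‖ = 1) {C : ℝ} (hC : 0 ≤ C)
    (htube : ∀ x ∈ S, ‖x - (inner ℝ e x) • e‖ ≤ C) {r : ℝ} (hr : 0 < r)
    {K : Set V} (k : Cluster μ S c r K) : False := by
  have : ∀ n : ℕ, ∃ K', Cluster μ S c (2 ^ n * r) K' := by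
    intro n
    induction n with
    | zero => exact ⟨K, by simpa using k⟩
    | succ n ih =>
      obtain ⟨K', k'⟩ := ih
      obtain ⟨K'', k''⟩ := k'.double h (by positivity)
      exact ⟨K'', by rwa [pow_succ, show (2 : ℝ) ^ n * 2 * r = 2 * (2 ^ n * r) by ring]⟩
  obtain ⟨n, hn⟩ := pow_unbounded_of_one_lt (100 * C / r) (one_lt_two : (1 : ℝ) < 2)
  rw [div_lt_iff₀ hr] at hn
  obtain ⟨K', k'⟩ := this n
  exact k'.no_big h he hC htube (by positivity) hn.le

lemma Lin.proj_surj (h : Lin μ S c) {e : V} (he : ‖e‖ = 1) {C : ℝ} (hC : 0 ≤ C)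
    (htube : ∀ x ∈ S, ‖x - (inner ℝ e x) • e‖ ≤ C)
    (hlb : ∀ t, ∃ y ∈ S, inner ℝ e y < t) (hub : ∀ t, ∃ y ∈ S, t < inner ℝ e y) (t : ℝ) :
    ∃ y ∈ S, inner ℝ e y = t := by
  by_contra! hc
  set E1 := S ∩ {y | inner ℝ e y ≤ t} with hE1
  set E2 := S ∩ {y | t ≤ inner ℝ e y} with hE2
  have c1 : IsClosed E1 := h.closed.inter (isClosed_le (by fun_prop) (by fun_prop))
  have c2 : IsClosed E2 := h.closed.inter (isClosed_le (by fun_prop) (by fun_prop))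
  obtain ⟨x0, hx0, hx0t⟩ := hlb t
  obtain ⟨y0, hy0, hy0t⟩ := hub t
  have hx0' : x0 ∈ E1 := ⟨hx0, hx0t.le⟩
  have hy0' : y0 ∈ E2 := ⟨hy0, hy0t.le⟩
  have hSE : S = E1 ∪ E2 := by
    ext z
    constructor
    · intro hz
      rcases le_total (inner ℝ e z) t with h | h
      · exact Or.inl ⟨hz, h⟩
      · exact Or.inr ⟨hz, h⟩
    · rintro (h | h) <;> exact h.1
  set D := dist x0 y0
  set M := ‖x0‖ + ‖y0‖ + |t| + D + C
  have hcomp : IsCompact ((E1 ∩ closedBall 0 M) ×ˢ (E2 ∩ closedBall 0 M)) :=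
    ((isCompact_closedBall (0 : V) M).inter_left c1).prod ((isCompact_closedBall (0 : V) M).inter_left c2)
  have hD : 0 ≤ D := dist_nonneg
  have hmem0 : (x0, y0) ∈ ((E1 ∩ closedBall 0 M) ×ˢ (E2 ∩ closedBall 0 M)) := by
    have := norm_nonneg x0
    have := norm_nonneg y0
    have := abs_nonneg t
    refine ⟨⟨hx0', ?_⟩, ⟨hy0', ?_⟩⟩ <;> simp only [mem_closedBall, dist_zero_right, M] <;> linarith
  obtain ⟨⟨x, y⟩, ⟨⟨hx, _⟩, ⟨hy, _⟩⟩, hmin⟩ := hcomp.exists_isMinOn ⟨_, hmem0⟩ (f := fun z => dist z.1 z.2) (by fun_prop)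
  simp only at hx hy
  have hrpos : 0 < dist x y := by
    apply dist_pos.2
    intro hxy
    rw [← hxy] at hy
    exact hc x hx.1 (le_antisymm hx.2 hy.2)
  have hgap : ∀ p ∈ E1, ∀ q ∈ E2, dist x y ≤ dist p q := by
    intro p hp q hq
    by_contra! hlt
    have hD0 : dist x y ≤ D := hmin hmem0
    have hpq : dist p q ≤ D := by linarith
    have h1 := inner_dist he p q
    have h2 := abs_le.1 (h1.trans hpq)
    have hp1 : inner ℝ e p ≤ t := hp.2
    have hq1 : t ≤ inner ℝ e q := hq.2
    have h3 := pyth he p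
    have h4 := pyth he q
    have h5 := htube p hp.1
    have h6 := htube q hq.1
    have t1 := neg_abs_le t
    have t2 := le_abs_self t
    have h7 : |inner ℝ e p| ≤ |t| + D := by rw [abs_le]; constructor <;> linarith
    have h8 : |inner ℝ e q| ≤ |t| + D := by rw [abs_le]; constructor <;> linarith
    have hpm : (p, q) ∈ ((E1 ∩ closedBall 0 M) ×ˢ (E2 ∩ closedBall 0 M)) := by
      have := norm_nonneg x0
      have := norm_nonneg y0
      refine ⟨⟨hp, ?_⟩, ⟨hq, ?_⟩⟩ <;> simp only [mem_closedBall, dist_zero_right, M] <;> linarith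
    have : dist x y ≤ dist p q := hmin hpm
    linarith
  exact (h.lemA hSE c1.measurableSet hrpos hgap hx hy rfl).none h he hC htube hrpos

end
end FlatPf
end

section
open MeasureTheory Metric
open scoped ENNReal NNReal
set_option linter.unusedSectionVars false
set_option linter.unusedVariables false

namespace FlatPf
section
variable {V : Type*} [NormedAddCommGroup V] [InnerProductSpace ℝ V] [FiniteDimensional ℝ V]
  [MeasurableSpace V] [BorelSpace V]
variable {μ : Measure V} [IsLocallyFiniteMeasure μ] {S : Set V} {g : ℝ → ℝ} {c : ℝ}

def slab (e : V) (t r : ℝ) : Set V := {y | |inner ℝ e y - t| < r}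

lemma slab_open (e : V) (t r : ℝ) : IsOpen (slab e t r) := by
  apply isOpen_lt <;> fun_prop

lemma Lin.slab_ge (h : Lin μ S c) {e : V} (he : ‖e‖ = 1) (hs : ∀ t : ℝ, ∃ y ∈ S, inner ℝ e y = t)
    (t : ℝ) {r : ℝ} (hr : 0 < r) : ENNReal.ofReal (c * r) ≤ μ (slab e t r) := by
  obtain ⟨y, hy, hyt⟩ := hs t
  rw [← h.ball y hy r hr]
  apply measure_mono
  intro z hz
  rw [mem_ball] at hz
  have := inner_dist he z y
  rw [hyt] at this
  exact lt_of_le_of_lt this hz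

lemma Lin.slab_le (h : Lin μ S c) {e : V} (he : ‖e‖ = 1) {C : ℝ} (hC : 0 ≤ C)
    (htube : ∀ x ∈ S, ‖x - (inner ℝ e x) • e‖ ≤ C) (hs : ∀ t : ℝ, ∃ y ∈ S, inner ℝ e y = t)
    (t : ℝ) {L : ℝ} (hL : 0 < L) : μ (slab e t L) ≤ ENNReal.ofReal (c * (L + 2 * C ^ 2 / L)) := by
  obtain ⟨y, hy, hyt⟩ := hs t
  rw [← h.ball y hy _ (by positivity), ← h.meas_inter]
  apply measure_mono
  rintro z ⟨hz, hzS⟩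
  rw [mem_ball]
  have hz' : |inner ℝ e z - t| < L := hz
  have h1 := norm_decomp he (z - y)
  have h2 := htube z hzS
  have h3 := htube y hy
  have h4 : ‖(z - y) - (inner ℝ e (z - y) : ℝ) • e‖ ≤ 2 * C := by
    have e1 : (z - y) - (inner ℝ e (z - y) : ℝ) • e = (z - (inner ℝ e z) • e) - (y - (inner ℝ e y) • e) := by
      rw [inner_sub_right, sub_smul]; abel
    rw [e1]
    have := norm_sub_le (z - (inner ℝ e z) • e) (y - (inner ℝ e y) • e)
    linarith
  have h5 : (inner ℝ e (z - y)) ^ 2 < L ^ 2 := by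
    rw [inner_sub_right, hyt, sq_lt_sq, abs_of_pos hL]; exact hz'
  have h6 : dist z y ^ 2 < L ^ 2 + 4 * C ^ 2 := by
    rw [dist_eq_norm, h1]
    have := norm_nonneg ((z - y) - (inner ℝ e (z - y) : ℝ) • e)
    nlinarith
  apply lt_of_pow_lt_pow_left₀ 2 (by positivity)
  refine h6.trans_le ?_
  have e2 : (L + 2 * C ^ 2 / L) ^ 2 = L ^ 2 + 4 * C ^ 2 + (2 * C ^ 2 / L) ^ 2 := by field_simp; ring
  rw [e2]
  linarith [sq_nonneg (2 * C ^ 2 / L)]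

lemma Lin.slab_eq (h : Lin μ S c) {e : V} (he : ‖e‖ = 1) {C : ℝ} (hC : 0 ≤ C)
    (htube : ∀ x ∈ S, ‖x - (inner ℝ e x) • e‖ ≤ C) (hs : ∀ t : ℝ, ∃ y ∈ S, inner ℝ e y = t)
    (t : ℝ) {r : ℝ} (hr : 0 < r) : μ (slab e t r) = ENNReal.ofReal (c * r) := by
  apply le_antisymm _ (h.slab_ge he hs t hr)
  have hc := h.cpos
  have hfin : μ (slab e t r) ≠ ⊤ := ne_top_of_le_ne_top ENNReal.ofReal_ne_top (h.slab_le he hC htube hs t hr)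
  rw [← ENNReal.ofReal_toReal hfin]
  apply ENNReal.ofReal_le_ofReal
  have key : ∀ L, r < L → (μ (slab e t r)).toReal ≤ c * r + (2 * c * C ^ 2) / L := by
    intro L hL
    have hL0 : 0 < L := hr.trans hL
    have hl : 0 < (L - r) / 2 := by linarith
    have d1 : Disjoint (slab e t r) (slab e (t - (L + r) / 2) ((L - r) / 2)) := by
      rw [Set.disjoint_left]
      intro z h1 h2
      have h1' := abs_lt.1 (show |inner ℝ e z - t| < r from h1)
      have h2' := abs_lt.1 (show |inner ℝ e z - (t - (L + r) / 2)| < (L - r) / 2 from h2)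
      linarith [h1'.1, h2'.2]
    have d2 : Disjoint (slab e t r ∪ slab e (t - (L + r) / 2) ((L - r) / 2)) (slab e (t + (L + r) / 2) ((L - r) / 2)) := by
      rw [Set.disjoint_left]
      rintro z (h1 | h1) h2
      · have h1' := abs_lt.1 (show |inner ℝ e z - t| < r from h1)
        have h2' := abs_lt.1 (show |inner ℝ e z - (t + (L + r) / 2)| < (L - r) / 2 from h2)
        linarith [h1'.2, h2'.1]
      · have h1' := abs_lt.1 (show |inner ℝ e z - (t - (L + r) / 2)| < (L - r) / 2 from h1)
        have h2' := abs_lt.1 (show |inner ℝ e z - (t + (L + r) / 2)| < (L - r) / 2 from h2)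
        linarith [h1'.2, h2'.1]
    have hsub : (slab e t r ∪ slab e (t - (L + r) / 2) ((L - r) / 2)) ∪ (slab e (t + (L + r) / 2) ((L - r) / 2))
        ⊆ slab e t L := by
      rintro z ((h1 | h1) | h1)
      · exact lt_trans (show |inner ℝ e z - t| < r from h1) hL
      · have h1' := abs_lt.1 (show |inner ℝ e z - (t - (L + r) / 2)| < (L - r) / 2 from h1)
        show |inner ℝ e z - t| < L
        rw [abs_lt]
        constructor <;> linarith [h1'.1, h1'.2]
      · have h1' := abs_lt.1 (show |inner ℝ e z - (t + (L + r) / 2)| < (L - r) / 2 from h1)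
        show |inner ℝ e z - t| < L
        rw [abs_lt]
        constructor <;> linarith [h1'.1, h1'.2]
    have h1 := measure_mono (μ := μ) hsub
    rw [measure_union d2 (slab_open _ _ _).measurableSet, measure_union d1 (slab_open _ _ _).measurableSet] at h1
    have h2 := h1.trans (h.slab_le he hC htube hs t hL0)
    have h3 := (add_le_add (add_le_add (le_refl (μ (slab e t r))) (h.slab_ge he hs (t - (L + r) / 2) hl))
      (h.slab_ge he hs (t + (L + r) / 2) hl)).trans h2
    rw [← ENNReal.ofReal_toReal hfin, ← ENNReal.ofReal_add (by positivity) (by positivity),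
      ← ENNReal.ofReal_add (by positivity) (by positivity), ENNReal.ofReal_le_ofReal_iff (by positivity)] at h3
    have e1 : c * (L + 2 * C ^ 2 / L) = c * L + 2 * c * C ^ 2 / L := by ring
    rw [e1] at h3
    linarith
  have lim : Filter.Tendsto (fun L : ℝ => c * r + (2 * c * C ^ 2) / L) Filter.atTop (nhds (c * r + 0)) :=
    tendsto_const_nhds.add (Filter.Tendsto.div_atTop tendsto_const_nhds Filter.tendsto_id)
  rw [add_zero] at lim
  refine ge_of_tendsto lim ?_
  filter_upwards [Filter.eventually_gt_atTop r] with L hL using key L hL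

lemma Lin.on_line (h : Lin μ S c) {e : V} (he : ‖e‖ = 1) {C : ℝ} (hC : 0 ≤ C)
    (htube : ∀ x ∈ S, ‖x - (inner ℝ e x) • e‖ ≤ C) (hs : ∀ t : ℝ, ∃ y ∈ S, inner ℝ e y = t)
    {x y : V} (hx : x ∈ S) (hy : y ∈ S) : y = x + (inner ℝ e y - inner ℝ e x : ℝ) • e := by
  have hd : dist y x ≤ |inner ℝ e y - inner ℝ e x| := by
    by_contra! hc
    obtain ⟨r, hr1, hr2⟩ := exists_between hc
    have hr : 0 < r := (abs_nonneg _).trans_lt hr1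
    refine h.notMem_open (U := slab e (inner ℝ e x) r \ closedBall x r)
      ((slab_open _ _ _).sdiff isClosed_closedBall) ?_ hy ⟨hr1, ?_⟩
    · have hsub : Metric.ball x r ⊆ slab e (inner ℝ e x) r := by
        intro z hz
        exact (inner_dist he z x).trans_lt hz
      refine measure_mono_null (t := slab e (inner ℝ e x) r \ Metric.ball x r)
        (Set.diff_subset_diff_right ball_subset_closedBall) ?_
      rw [measure_diff hsub measurableSet_ball.nullMeasurableSet (ball_ne_top _ _ _),
        h.slab_eq he hC htube hs _ hr, h.ball x hx r hr, tsub_self]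
    · rw [mem_closedBall]; linarith
  have h1 := norm_decomp he (y - x)
  rw [dist_eq_norm, ← inner_sub_right] at hd
  have h2 : ‖y - x‖ ^ 2 ≤ (inner ℝ e (y - x)) ^ 2 := by
    rw [← sq_abs (inner ℝ e (y - x))]
    exact pow_le_pow_left₀ (norm_nonneg _) hd 2
  have h3 : ‖(y - x) - (inner ℝ e (y - x) : ℝ) • e‖ ^ 2 = 0 := le_antisymm (by linarith) (sq_nonneg _)
  rw [sq_eq_zero_iff, norm_eq_zero, sub_eq_zero] at h3
  rw [← inner_sub_right, ← h3]; abel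

lemma Lin.flat (h : Lin μ S c) {e : V} (he : ‖e‖ = 1) {C : ℝ} (hC : 0 ≤ C)
    (htube : ∀ x ∈ S, ‖x - (inner ℝ e x) • e‖ ≤ C) (hs : ∀ t : ℝ, ∃ y ∈ S, inner ℝ e y = t)
    {x : V} (hx : x ∈ S) :
    μ = ENNReal.ofReal (c / 2) • (μH[1].restrict (Set.range fun t : ℝ => x + t • e)) := by
  have hc := h.cpos
  set p : V → ℝ := fun y => inner ℝ e y - inner ℝ e x with hp
  set φ : ℝ → V := fun t => x + t • e with hφ
  have mp : Measurable p := by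
    have : Continuous p := by fun_prop
    exact this.measurable
  have iφ : Isometry φ := by
    apply Isometry.of_dist_eq
    intro a b
    simp only [hφ, dist_add_left]
    rw [dist_eq_norm, dist_eq_norm, ← sub_smul, norm_smul, he, mul_one]
  have hIoo : ∀ a b : ℝ, a < b → μ (p ⁻¹' Set.Ioo a b) = ENNReal.ofReal (c * ((b - a) / 2)) := by
    intro a b hab
    rw [← h.slab_eq he hC htube hs (inner ℝ e x + (a + b) / 2) (r := (b - a) / 2) (by linarith)]
    congr 1
    ext z
    simp only [hp, slab, Set.mem_preimage, Set.mem_Ioo, Set.mem_setOf_eq, abs_lt]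
    constructor <;> rintro ⟨h1, h2⟩ <;> constructor <;> linarith
  have hloc : IsLocallyFiniteMeasure (Measure.map p μ) := by
    refine ⟨fun t => ⟨Set.Ioo (t - 1) (t + 1), Ioo_mem_nhds (by linarith) (by linarith), ?_⟩⟩
    rw [Measure.map_apply mp measurableSet_Ioo, hIoo _ _ (by linarith)]
    exact ENNReal.ofReal_lt_top
  have hmap : Measure.map p μ = ENNReal.ofReal (c / 2) • volume := by
    apply Real.measure_ext_Ioo_rat
    intro a b
    rw [Measure.map_apply mp measurableSet_Ioo, Measure.smul_apply, smul_eq_mul, Real.volume_Ioo,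
      ← ENNReal.ofReal_mul (by positivity)]
    rcases lt_or_ge (a : ℝ) b with hab | hab
    · rw [hIoo _ _ hab]; congr 1; ring
    · rw [Set.Ioo_eq_empty (by linarith), Set.preimage_empty, measure_empty, eq_comm, ENNReal.ofReal_eq_zero]
      exact mul_nonpos_of_nonneg_of_nonpos (by positivity) (by linarith)
  have hae : (φ ∘ p) =ᵐ[μ] id := by
    have h0 : ∀ᵐ y ∂μ, y ∈ S := h.null
    filter_upwards [h0] with y hy
    exact (h.on_line he hC htube hs hx hy).symm
  rw [← iφ.map_hausdorffMeasure (Or.inl zero_le_one), hausdorffMeasure_real, ← Measure.map_smul,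
    ← hmap, Measure.map_map iφ.continuous.measurable mp, Measure.map_congr hae, Measure.map_id]

/-- Uniformly distributed, dyadically homogeneous measures containing 0 are flat. -/
lemma Unif.flat0 (h : Unif μ S g) (h0 : (0 : V) ∈ S) : ∃ a : ℝ, 0 < a ∧ ∃ x e : V, ‖e‖ = 1 ∧
    μ = ENNReal.ofReal a • (μH[1].restrict (Set.range fun t : ℝ => x + t • e)) := by
  obtain ⟨e, he, C, hC, htube, hlb, hub⟩ := h.tube h0
  obtain ⟨c, hc, hg⟩ := h.linear h0 (fun R hR => h.TT_one h0 he hC htube hub hR)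
  have hl : Lin μ S c := ⟨h.closed, h.null, hc, fun x hx r hr => by rw [h.mball hx hr, hg r hr]⟩
  exact ⟨c / 2, by positivity, 0, e, he, hl.flat he hC htube (hl.proj_surj he hC htube hlb hub) h0⟩

end
end FlatPf
end

section
open MeasureTheory Metric
open scoped ENNReal NNReal
set_option linter.unusedSectionVars false
set_option linter.unusedVariables false

namespace FlatPf
section
variable {V : Type*} [NormedAddCommGroup V] [InnerProductSpace ℝ V] [FiniteDimensional ℝ V]
  [MeasurableSpace V] [BorelSpace V]
variable {μ : Measure V} [IsLocallyFiniteMeasure μ] {S : Set V} {g : ℝ → ℝ} {c : ℝ}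

lemma ball_le_of_lt (μ : Measure V) {x : V} {r : ℝ} {M : ℝ≥0∞}
    (h : ∀ s, 0 < s → s < r → μ (ball x s) ≤ M) : μ (ball x r) ≤ M := by
  have e : ball x r = ⋃ n : ℕ, ball x (r - 1 / (n + 1)) := by
    ext y
    simp only [mem_ball, Set.mem_iUnion]
    constructor
    · intro hy
      obtain ⟨n, hn⟩ := exists_nat_one_div_lt (sub_pos.2 hy)
      exact ⟨n, by linarith⟩
    · rintro ⟨n, hn⟩
      have : (0 : ℝ) < 1 / (n + 1) := by positivity
      linarith
  have hm : Monotone fun n : ℕ => ball x (r - 1 / ((n : ℝ) + 1)) := by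
    intro a b hab
    apply ball_subset_ball
    have : 1 / ((b : ℝ) + 1) ≤ 1 / ((a : ℝ) + 1) := by
      apply one_div_le_one_div_of_le (by positivity)
      have : (a : ℝ) ≤ b := by exact_mod_cast hab
      linarith
    linarith
  rw [e, hm.measure_iUnion]
  apply iSup_le
  intro n
  have hn : (0 : ℝ) < 1 / (n + 1) := by positivity
  rcases le_or_gt (r - 1 / ((n : ℝ) + 1)) 0 with h1 | h1
  · rw [ball_eq_empty.2 h1]; simp
  · exact h _ h1 (by linarith)

lemma dbl_pow (hd : ∀ x ∈ S, ∀ r, 0 < r → μ (ball x (2 * r)) = 2 * μ (ball x r)) {x : V} (hx : x ∈ S) (k : ℕ)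
    {r : ℝ} (hr : 0 < r) : μ (ball x (2 ^ k * r)) = 2 ^ k * μ (ball x r) := by
  induction k with
  | zero => simp
  | succ k ih => rw [show (2 : ℝ) ^ (k + 1) * r = 2 * (2 ^ k * r) by ring, hd x hx _ (by positivity), ih]; ring

lemma dbl_indep (hd : ∀ x ∈ S, ∀ r, 0 < r → μ (ball x (2 * r)) = 2 * μ (ball x r)) {x y : V} (hx : x ∈ S)
    (hy : y ∈ S) {r : ℝ} (hr : 0 < r) : μ (ball x r) ≤ μ (ball y r) := by
  apply ball_le_of_lt
  intro s hs hsr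
  obtain ⟨k, hk⟩ := pow_unbounded_of_one_lt (dist x y / (r - s)) (one_lt_two : (1 : ℝ) < 2)
  rw [div_lt_iff₀ (by linarith)] at hk
  have h1 : μ (ball x (2 ^ k * s)) ≤ μ (ball y (2 ^ k * r)) := by
    apply measure_mono
    apply ball_subset_ball'
    nlinarith
  rw [dbl_pow hd hx k hs, dbl_pow hd hy k hr] at h1
  exact (ENNReal.mul_le_mul_iff_right (by positivity) (by finiteness)).1 h1

lemma flat_of_dbl (hcl : IsClosed S) (hnull : μ Sᶜ = 0) (hne : S.Nonempty)
    (hpos : ∀ x ∈ S, ∀ r, 0 < r → 0 < μ (ball x r))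
    (hd : ∀ x ∈ S, ∀ r, 0 < r → μ (ball x (2 * r)) = 2 * μ (ball x r)) :
    ∃ a : ℝ, 0 < a ∧ ∃ x e : V, ‖e‖ = 1 ∧
    μ = ENNReal.ofReal a • (μH[1].restrict (Set.range fun t : ℝ => x + t • e)) := by
  obtain ⟨p, hp⟩ := hne
  set E : V ≃ₜ V := Homeomorph.addRight (-p) with hE
  have hcE : Measurable E := E.continuous.measurable
  have hmap : ∀ A : Set V, MeasurableSet A → (Measure.map E μ) A = μ (E ⁻¹' A) :=
    fun A hA => Measure.map_apply hcE hA
  have hball : ∀ x r, (Measure.map E μ) (ball x r) = μ (ball (x + p) r) := by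
    intro x r
    rw [hmap _ measurableSet_ball]
    congr 1
    ext y
    simp only [hE, Set.mem_preimage, mem_ball, dist_eq_norm, Homeomorph.coe_addRight]
    rw [show y + -p - x = y - (x + p) by abel]
  have : IsLocallyFiniteMeasure (Measure.map E μ) := by
    refine ⟨fun x => ⟨ball x 1, ball_mem_nhds x one_pos, ?_⟩⟩
    rw [hball]; exact measure_ball_lt_top
  have hU : Unif (Measure.map E μ) ((fun y => y + p) ⁻¹' S) (fun r => μ.real (ball p r)) := by
    refine ⟨hcl.preimage (by fun_prop), ?_, ?_, ?_, ?_⟩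
    · rw [hmap _ (hcl.preimage (by fun_prop)).measurableSet.compl, ← hnull]
      congr 1
      ext y; simp [hE]
    · intro x hx r hr
      rw [Measure.real, hball, Measure.real]
      congr 1
      exact le_antisymm (dbl_indep hd hx hp hr) (dbl_indep hd hp hx hr)
    · intro r hr
      exact ENNReal.toReal_pos (hpos p hp r hr).ne' (ball_ne_top _ _ _)
    · intro r hr
      simp only [Measure.real]
      rw [hd p hp r hr, ENNReal.toReal_mul]; rfl
  obtain ⟨a, ha, x, e, he, hfl⟩ := hU.flat0 (by simpa using hp)
  have iso : ∀ x : V, Isometry (fun t : ℝ => x + t • e) := by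
    intro x
    apply Isometry.of_dist_eq
    intro a b
    rw [dist_add_left, dist_eq_norm, dist_eq_norm, ← sub_smul, norm_smul, he, mul_one]
  refine ⟨a, ha, x + p, e, he, ?_⟩
  have h1 : μ = Measure.map (fun y => y + p) (Measure.map E μ) := by
    rw [Measure.map_map (by fun_prop) hcE]
    have : ((fun y => y + p) ∘ E) = id := by ext y; simp [hE]
    rw [this, Measure.map_id]
  rw [h1, hfl, Measure.map_smul, ← (iso x).map_hausdorffMeasure (Or.inl zero_le_one),
    Measure.map_map (by fun_prop) (iso x).continuous.measurable,
    ← (iso (x + p)).map_hausdorffMeasure (Or.inl zero_le_one)]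
  congr 2
  ext t; simp only [Function.comp]; abel

end
end FlatPf
end

section
open MeasureTheory Metric
open scoped ENNReal NNReal
set_option linter.unusedSectionVars false
set_option linter.unusedVariables false

namespace FlatPf
section
variable {V : Type*} [NormedAddCommGroup V] [InnerProductSpace ℝ V] [FiniteDimensional ℝ V]
  [MeasurableSpace V] [BorelSpace V]
variable {μ : Measure V} [IsLocallyFiniteMeasure μ] {S : Set V} {g : ℝ → ℝ} {c : ℝ}

noncomputable def tau (a b t : ℝ) : ℝ := max 0 (b - max a t)

lemma tau_nonneg (a b t : ℝ) : 0 ≤ tau a b t := le_max_left _ _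
@[fun_prop]
lemma tau_cont (a b : ℝ) : Continuous (tau a b) := by unfold tau; fun_prop
lemma tau_zero {a b t : ℝ} (h : b ≤ t) : tau a b t = 0 := by
  unfold tau; apply max_eq_left; linarith [le_max_right a t]
lemma tau_le {a b : ℝ} (hab : a ≤ b) (t : ℝ) : tau a b t ≤ b - a := by
  unfold tau; exact max_le (by linarith) (by linarith [le_max_left a t])
lemma tau_eq {a b t : ℝ} (hab : a ≤ b) (h : t ≤ a) : tau a b t = b - a := by
  unfold tau; rw [max_eq_left h]; exact max_eq_right (by linarith)
lemma tau_lip (a b s t : ℝ) : |tau a b s - tau a b t| ≤ |s - t| := by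
  unfold tau
  rw [max_comm 0, max_comm 0]
  refine (abs_max_sub_max_le_abs _ _ _).trans ?_
  rw [show b - max a s - (b - max a t) = max t a - max s a by rw [max_comm a s, max_comm a t]; ring, abs_sub_comm s t]
  exact abs_max_sub_max_le_abs _ _ _
  
noncomputable def kap (a b : ℝ) (z : V) : ℝ := tau a b ‖z‖ - tau a b (‖z‖ / 2) / 2

@[fun_prop]
lemma kap_cont (a b : ℝ) : Continuous (kap a b : V → ℝ) := by unfold kap; fun_prop

lemma kap_zero {a b : ℝ} {z : V} (hb : 0 ≤ b) (h : 2 * b ≤ ‖z‖) : kap a b z = 0 := by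
  unfold kap; rw [tau_zero (by linarith), tau_zero (by linarith)]; simp

lemma kap_lip (a b : ℝ) (z w : V) : |kap a b z - kap a b w| ≤ 2 * ‖z - w‖ := by
  unfold kap
  have h1 := tau_lip a b ‖z‖ ‖w‖
  have h2 := tau_lip a b (‖z‖ / 2) (‖w‖ / 2)
  have h3 := abs_norm_sub_norm_le z w
  rw [← sub_div, abs_div, abs_two] at h2
  have h4 := abs_le.1 (h1.trans h3)
  have h5 := abs_le.1 (h2.trans (div_le_div_of_nonneg_right h3 zero_le_two))
  have := norm_nonneg (z - w)
  rw [abs_le]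
  constructor <;> linarith [h4.1, h4.2, h5.1, h5.2]

lemma integ' (μ : Measure V) [IsLocallyFiniteMeasure μ] {f : V → ℝ} (hf : Continuous f) (x : V) (R : ℝ)
    (h : ∀ y, R < ‖x - y‖ → f y = 0) : Integrable f μ := by
  apply hf.integrable_of_hasCompactSupport
  apply HasCompactSupport.intro (isCompact_closedBall x R)
  intro y hy
  apply h
  rw [mem_closedBall, not_le, dist_comm, dist_eq_norm] at hy; exact hy

lemma integ_tau (μ : Measure V) [IsLocallyFiniteMeasure μ] (a b : ℝ) (x : V) :
    Integrable (fun y => tau a b ‖x - y‖) μ :=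
  integ' μ (by fun_prop) x b (fun y hy => tau_zero hy.le)
lemma integ_tau2 (μ : Measure V) [IsLocallyFiniteMeasure μ] (a b : ℝ) (x : V) :
    Integrable (fun y => tau a b (‖x - y‖ / 2)) μ :=
  integ' μ (by fun_prop) x (2 * b) (fun y hy => tau_zero (by linarith))

noncomputable def PP (μ : Measure V) (a b : ℝ) (x : V) : ℝ := ∫ y, kap a b (x - y) ∂μ

lemma PP_eq (μ : Measure V) [IsLocallyFiniteMeasure μ] (a b : ℝ) (x : V) :
    PP μ a b x = (∫ y, tau a b ‖x - y‖ ∂μ) - (∫ y, tau a b (‖x - y‖ / 2) ∂μ) / 2 := by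
  unfold PP kap
  rw [integral_sub (integ_tau μ a b x) ((integ_tau2 μ a b x).div_const 2), integral_div]

/-- bound for integrals of functions supported in a ball -/
lemma int_bound (μ : Measure V) [IsLocallyFiniteMeasure μ] {f : V → ℝ} {x : V} {R M : ℝ} (hM : 0 ≤ M)
    (h0 : ∀ y, y ∉ closedBall x R → f y = 0) (hb : ∀ y, |f y| ≤ M) :
    |∫ y, f y ∂μ| ≤ M * μ.real (closedBall x R) := by
  rw [← setIntegral_eq_integral_of_forall_compl_eq_zero h0]
  have h2 : ∀ y ∈ closedBall x R, ‖f y‖ ≤ M := fun y _ => hb y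
  exact norm_setIntegral_le_of_norm_le_const measure_closedBall_lt_top h2

lemma PP_lip (μ : Measure V) [IsLocallyFiniteMeasure μ] {a b : ℝ} (hb : 0 ≤ b) {x x' : V} (hxx : ‖x' - x‖ ≤ 1) :
    |PP μ a b x' - PP μ a b x| ≤ 2 * ‖x' - x‖ * μ.real (closedBall x (2 * b + 1)) := by
  have i1 : ∀ x : V, Integrable (fun y => kap a b (x - y)) μ := fun x =>
    integ' μ (by fun_prop) x (2 * b) (fun y hy => kap_zero hb hy.le)
  unfold PP
  rw [← integral_sub (i1 x') (i1 x)]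
  apply int_bound μ (by positivity)
  · intro y hy
    rw [mem_closedBall, not_le, dist_comm, dist_eq_norm] at hy
    have : ‖x - y‖ ≤ ‖x' - x‖ + ‖x' - y‖ := by
      rw [norm_sub_rev x' x]
      have := norm_add_le (x - x') (x' - y)
      rwa [sub_add_sub_cancel] at this
    rw [kap_zero hb (by linarith), kap_zero hb (by linarith), sub_zero]
  · intro y
    have := kap_lip a b (x' - y) (x - y)
    rwa [sub_sub_sub_cancel_right] at this

lemma tau_lower (μ : Measure V) [IsLocallyFiniteMeasure μ] {a b : ℝ} (hab : a ≤ b) (x : V) :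
    (b - a) * μ.real (ball x a) ≤ ∫ y, tau a b ‖x - y‖ ∂μ := by
  rw [mul_comm, ← smul_eq_mul, ← integral_indicator_const (b - a) measurableSet_ball]
  apply integral_mono
  · exact (integrable_indicator_iff measurableSet_ball).2 (integrableOn_const (ball_ne_top _ _ _))
  · exact integ_tau μ a b x
  · intro y
    apply Set.indicator_le' (fun y hy => ?_) (fun y hy => tau_nonneg _ _ _) y
    rw [mem_ball, dist_comm, dist_eq_norm] at hy
    rw [tau_eq hab hy.le]

lemma tau_upper (μ : Measure V) [IsLocallyFiniteMeasure μ] {a b : ℝ} (hab : a ≤ b) (x : V) :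
    ∫ y, tau a b ‖x - y‖ ∂μ ≤ (b - a) * μ.real (ball x b) := by
  rw [mul_comm, ← smul_eq_mul, ← integral_indicator_const (b - a) measurableSet_ball]
  apply integral_mono
  · exact integ_tau μ a b x
  · exact (integrable_indicator_iff measurableSet_ball).2 (integrableOn_const (ball_ne_top _ _ _))
  · intro y
    refine Set.le_indicator (f := fun y => tau a b ‖x - y‖) (fun y hy => tau_le hab _) (fun y hy => ?_) y
    rw [mem_ball, dist_comm, dist_eq_norm, not_lt] at hy
    rw [tau_zero hy]

lemma tau_lower2 (μ : Measure V) [IsLocallyFiniteMeasure μ] {a b : ℝ} (hab : a ≤ b) (x : V) :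
    (b - a) * μ.real (ball x (2 * a)) ≤ ∫ y, tau a b (‖x - y‖ / 2) ∂μ := by
  rw [mul_comm, ← smul_eq_mul, ← integral_indicator_const (b - a) measurableSet_ball]
  apply integral_mono
  · exact (integrable_indicator_iff measurableSet_ball).2 (integrableOn_const (ball_ne_top _ _ _))
  · exact integ_tau2 μ a b x
  · intro y
    apply Set.indicator_le' (fun y hy => ?_) (fun y hy => tau_nonneg _ _ _) y
    rw [mem_ball, dist_comm, dist_eq_norm] at hy
    rw [tau_eq hab (by linarith)]

lemma tau_upper2 (μ : Measure V) [IsLocallyFiniteMeasure μ] {a b : ℝ} (hab : a ≤ b) (x : V) :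
    ∫ y, tau a b (‖x - y‖ / 2) ∂μ ≤ (b - a) * μ.real (ball x (2 * b)) := by
  rw [mul_comm, ← smul_eq_mul, ← integral_indicator_const (b - a) measurableSet_ball]
  apply integral_mono
  · exact integ_tau2 μ a b x
  · exact (integrable_indicator_iff measurableSet_ball).2 (integrableOn_const (ball_ne_top _ _ _))
  · intro y
    refine Set.le_indicator (f := fun y => tau a b (‖x - y‖ / 2)) (fun y hy => tau_le hab _) (fun y hy => ?_) y
    rw [mem_ball, dist_comm, dist_eq_norm, not_lt] at hy
    rw [tau_zero (by linarith)]

lemma dbl_of_PP {x : V} (h : ∀ a b, 0 < a → a < b → PP μ a b x = 0) (r : ℝ) (hr : 0 < r) :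
    μ (ball x (2 * r)) = 2 * μ (ball x r) := by
  have k1 : ∀ a b, 0 < a → a < b → 2 * μ.real (ball x a) ≤ μ.real (ball x (2 * b)) := by
    intro a b ha hab
    have h0 := h a b ha hab
    rw [PP_eq] at h0
    have h1 := tau_lower μ hab.le x
    have h2 := tau_upper2 μ hab.le x
    have : 0 < b - a := by linarith
    nlinarith
  have k2 : ∀ a b, 0 < a → a < b → μ.real (ball x (2 * a)) ≤ 2 * μ.real (ball x b) := by
    intro a b ha hab
    have h0 := h a b ha hab
    rw [PP_eq] at h0
    have h1 := tau_lower2 μ hab.le x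
    have h2 := tau_upper μ hab.le x
    have : 0 < b - a := by linarith
    nlinarith
  have e : ∀ s, μ (ball x s) = ENNReal.ofReal (μ.real (ball x s)) :=
    fun s => (ENNReal.ofReal_toReal (ball_ne_top _ _ _)).symm
  apply le_antisymm
  · apply ball_le_of_lt
    intro s hs hsr
    have := k2 (s / 2) r (by linarith) (by linarith)
    rw [mul_div_cancel₀ _ two_ne_zero] at this
    rw [e, e r, show (2 : ℝ≥0∞) = ENNReal.ofReal 2 by simp, ← ENNReal.ofReal_mul (by norm_num)]
    exact ENNReal.ofReal_le_ofReal this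
  · have : μ (ball x r) ≤ μ (ball x (2 * r)) / 2 := by
      apply ball_le_of_lt
      intro s hs hsr
      have := k1 s r hs hsr
      rw [ENNReal.le_div_iff_mul_le (by simp) (by simp), mul_comm,
        e, e (2 * r), show (2 : ℝ≥0∞) = ENNReal.ofReal 2 by simp, ← ENNReal.ofReal_mul (by norm_num)]
      exact ENNReal.ofReal_le_ofReal this
    rwa [ENNReal.le_div_iff_mul_le (by simp) (by simp), mul_comm] at this

end
end FlatPf
end

section
open MeasureTheory Metric
open scoped ENNReal NNReal CompactlySupported
set_option linter.unusedSectionVars false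
set_option linter.unusedVariables false

namespace FlatPf
section
variable {V : Type*} [NormedAddCommGroup V] [InnerProductSpace ℝ V] [FiniteDimensional ℝ V]
  [MeasurableSpace V] [BorelSpace V]

lemma ulim' (U : Ultrafilter ℕ) {u : ℕ → ℝ} {C : ℝ} (h : ∀ᶠ k in (U : Filter ℕ), |u k| ≤ C) :
    ∃ l, Filter.Tendsto u U (nhds l) := by
  obtain ⟨l, _, hl⟩ := (isCompact_Icc (a := -C) (b := C)).ultrafilter_le_nhds (U.map u) (by
    rw [Filter.le_principal_iff]
    refine Filter.mem_map.2 ?_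
    filter_upwards [h] with k hk using abs_le.1 hk)
  exact ⟨l, hl⟩

lemma exists_wlim (U : Ultrafilter ℕ) (ν : ℕ → Measure V) [∀ n, IsLocallyFiniteMeasure (ν n)]
    (hG : ∀ R : ℝ, ∃ C : ℝ, ∀ᶠ n in (U : Filter ℕ), (ν n).real (closedBall 0 R) ≤ C) :
    ∃ μ : Measure V, IsLocallyFiniteMeasure μ ∧ ∀ f : V → ℝ, Continuous f → HasCompactSupport f →
      Filter.Tendsto (fun n => ∫ y, f y ∂(ν n)) U (nhds (∫ y, f y ∂μ)) := by
  have key : ∀ f : C_c(V, ℝ), ∃ l : ℝ, Filter.Tendsto (fun n => ∫ y, f y ∂(ν n)) U (nhds l) := by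
    intro f
    obtain ⟨R, hR⟩ := f.hasCompactSupport.isCompact.isBounded.subset_closedBall (0 : V)
    obtain ⟨C, hC⟩ := hG R
    obtain ⟨M, hM⟩ := f.hasCompactSupport.exists_bound_of_continuous f.continuous
    have hM0 : 0 ≤ M := (norm_nonneg _).trans (hM 0)
    refine ulim' U (C := M * C) ?_
    filter_upwards [hC] with n hn
    have h1 := int_bound (ν n) (f := f) (x := 0) (R := R) hM0 (fun y hy => by
      by_contra hc
      exact hy (hR (subset_tsupport _ hc))) hM
    exact h1.trans (mul_le_mul_of_nonneg_left hn hM0)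
  choose Λ hΛ using key
  have hi : ∀ (f : C_c(V, ℝ)) n, Integrable f (ν n) := fun f n =>
    f.continuous.integrable_of_hasCompactSupport f.hasCompactSupport
  let L : C_c(V, ℝ) →ₗ[ℝ] ℝ :=
    { toFun := Λ
      map_add' := by
        intro f g
        refine tendsto_nhds_unique (hΛ (f + g)) (((hΛ f).add (hΛ g)).congr fun n => ?_)
        rw [← integral_add (hi f n) (hi g n)]; rfl
      map_smul' := by
        intro c f
        refine tendsto_nhds_unique (hΛ (c • f)) (((hΛ f).const_mul c).congr fun n => ?_)
        rw [← integral_const_mul]; rfl }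
  let P : C_c(V, ℝ) →ₚ[ℝ] ℝ := PositiveLinearMap.mk₀ L (by
    intro f hf
    refine ge_of_tendsto' (hΛ f) fun n => integral_nonneg fun y => hf y)
  refine ⟨RealRMK.rieszMeasure P, ?_, ?_⟩
  · have : IsFiniteMeasureOnCompacts (RealRMK.rieszMeasure P) := inferInstance
    infer_instance
  · intro f hf hc
    have h1 := RealRMK.integral_rieszMeasure P ⟨⟨f, hf⟩, hc⟩
    have h2 : ∫ y, f y ∂(RealRMK.rieszMeasure P) = Λ ⟨⟨f, hf⟩, hc⟩ := h1
    rw [h2]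
    exact hΛ _

lemma supp_PP {U : Ultrafilter ℕ} (hU : (U : Filter ℕ) ≤ Filter.atTop) {ν : ℕ → Measure V} [∀ n, IsLocallyFiniteMeasure (ν n)]
    (hG : ∀ R : ℝ, ∃ C : ℝ, ∀ᶠ n in (U : Filter ℕ), (ν n).real (closedBall 0 R) ≤ C)
    {a b : ℝ} (hb : 0 ≤ b)
    (hW : ∀ η : ℝ, 0 < η → ∀ᶠ n in (U : Filter ℕ),
      ∫⁻ x in ball 0 ((n : ℝ) + 1), ENNReal.ofReal |PP (ν n) a b x| ∂(ν n) ≤ ENNReal.ofReal η)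
    {μ : Measure V} [IsLocallyFiniteMeasure μ]
    (hμ : ∀ f : V → ℝ, Continuous f → HasCompactSupport f →
      Filter.Tendsto (fun n => ∫ y, f y ∂(ν n)) U (nhds (∫ y, f y ∂μ)))
    {x : V} (hx : x ∈ μ.support) : PP μ a b x = 0 := by
  by_contra hne
  set η := |PP μ a b x| with hη
  have hη0 : 0 < η := abs_pos.2 hne
  obtain ⟨C, hC⟩ := hG (2 * b + 1 + ‖x‖)
  set C' := max C 1 with hC'
  have hC'1 : 1 ≤ C' := le_max_right _ _
  set ρ := min 1 (η / (8 * C')) with hρ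
  have hρ0 : 0 < ρ := lt_min one_pos (by positivity)
  have hρ1 : ρ ≤ 1 := min_le_left _ _
  have hρ2 : 2 * ρ * C' ≤ η / 4 := by
    have : ρ ≤ η / (8 * C') := min_le_right _ _
    rw [le_div_iff₀ (by positivity)] at this
    linarith
  have lim1 : Filter.Tendsto (fun n => PP (ν n) a b x) U (nhds (PP μ a b x)) := by
    apply hμ (fun y => kap a b (x - y)) (by fun_prop)
    apply HasCompactSupport.intro (isCompact_closedBall x (2 * b))
    intro y hy
    rw [mem_closedBall, not_le, dist_comm, dist_eq_norm] at hy
    exact kap_zero hb hy.le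
  have lim2 := hμ (fun y => tau (ρ / 2) ρ ‖x - y‖) (by fun_prop) (by
    apply HasCompactSupport.intro (isCompact_closedBall x ρ)
    intro y hy
    rw [mem_closedBall, not_le, dist_comm, dist_eq_norm] at hy
    exact tau_zero hy.le)
  have hpos : 0 < ∫ y, tau (ρ / 2) ρ ‖x - y‖ ∂μ := by
    refine lt_of_lt_of_le ?_ (tau_lower μ (by linarith) x)
    refine mul_pos (by linarith) (ENNReal.toReal_pos ?_ (ball_ne_top _ _ _))
    rw [Measure.mem_support_iff_forall] at hx
    exact (hx _ (ball_mem_nhds x (by positivity))).ne'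
  set q := ∫ y, tau (ρ / 2) ρ ‖x - y‖ ∂μ with hq
  have e1 := (lim1.abs).eventually (lt_mem_nhds (show η / 2 < |PP μ a b x| by rw [← hη]; linarith))
  have e2 := lim2.eventually (lt_mem_nhds (show q / 2 < q by linarith))
  have e3 : ∀ᶠ n in (U : Filter ℕ), ⌈‖x‖ + 1⌉₊ ≤ n := hU (Filter.eventually_ge_atTop ⌈‖x‖ + 1⌉₊)
  have e4 := hW (η / 4 * (q / 2) / 2) (by positivity)
  obtain ⟨n, h1, h2, h3, h4, h5⟩ := (e1.and (e2.and (e3.and (e4.and hC)))).exists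
  have hsub : ball x ρ ⊆ ball 0 ((n : ℝ) + 1) := by
    apply ball_subset_ball'
    rw [dist_zero_right]
    have h3' : ‖x‖ + 1 ≤ n := Nat.ceil_le.1 h3
    linarith
  have hlow : ∀ y ∈ ball x ρ, η / 4 ≤ |PP (ν n) a b y| := by
    intro y hy
    rw [mem_ball, dist_eq_norm] at hy
    have hl := PP_lip (ν n) (a := a) hb (x := x) (x' := y) (by linarith)
    have hm : (ν n).real (closedBall x (2 * b + 1)) ≤ C' := by
      refine le_trans (measureReal_mono (closedBall_subset_closedBall' ?_) measure_closedBall_lt_top.ne)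
        (h5.trans (le_max_left _ _))
      rw [dist_zero_right]
    have : 2 * ‖y - x‖ * (ν n).real (closedBall x (2 * b + 1)) ≤ η / 4 := by
      refine le_trans ?_ hρ2
      apply mul_le_mul (by linarith) hm measureReal_nonneg (by positivity)
    have h6 := abs_sub_abs_le_abs_sub (PP (ν n) a b x) (PP (ν n) a b y)
    rw [abs_sub_comm] at h6
    linarith
  have h7 : q / 2 < (ν n).real (ball x ρ) := by
    refine lt_of_lt_of_le h2 ((tau_upper (ν n) (by linarith) x).trans ?_)
    exact mul_le_of_le_one_left measureReal_nonneg (by linarith)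
  have h8 : ENNReal.ofReal (η / 4) * (ν n) (ball x ρ) ≤ ENNReal.ofReal (η / 4 * (q / 2) / 2) := by
    refine le_trans ?_ h4
    rw [← setLIntegral_const]
    calc _ ≤ ∫⁻ y in ball x ρ, ENNReal.ofReal |PP (ν n) a b y| ∂(ν n) :=
          setLIntegral_mono' measurableSet_ball (fun y hy => ENNReal.ofReal_le_ofReal (hlow y hy))
      _ ≤ _ := lintegral_mono_set hsub
  rw [← ENNReal.ofReal_toReal (ball_ne_top (ν n) x ρ), ← ENNReal.ofReal_mul (by positivity),
    ENNReal.ofReal_le_ofReal_iff (by positivity)] at h8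
  have h9 : η / 4 * (q / 2) < η / 4 * (ν n).real (ball x ρ) := mul_lt_mul_of_pos_left h7 (by positivity)
  have h10 : 0 < η / 4 * (q / 2) := by positivity
  unfold Measure.real at h9
  linarith

lemma limit_flat {U : Ultrafilter ℕ} (hU : (U : Filter ℕ) ≤ Filter.atTop) (ν : ℕ → Measure V) [∀ n, IsLocallyFiniteMeasure (ν n)]
    (hG : ∀ R : ℝ, ∃ C : ℝ, ∀ᶠ n in (U : Filter ℕ), (ν n).real (closedBall 0 R) ≤ C)
    (hM : ∀ n, 1 ≤ (ν n).real (ball 0 2))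
    (hW : ∀ a b : ℝ, 0 < a → a < b → ∀ η : ℝ, 0 < η → ∀ᶠ n in (U : Filter ℕ),
      ∫⁻ x in ball 0 ((n : ℝ) + 1), ENNReal.ofReal |PP (ν n) a b x| ∂(ν n) ≤ ENNReal.ofReal η) :
    ∃ μ : Measure V, IsLocallyFiniteMeasure μ ∧ (∀ f : V → ℝ, Continuous f → HasCompactSupport f →
      Filter.Tendsto (fun n => ∫ y, f y ∂(ν n)) U (nhds (∫ y, f y ∂μ))) ∧
      ∃ a : ℝ, 0 < a ∧ ∃ x e : V, ‖e‖ = 1 ∧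
        μ = ENNReal.ofReal a • (μH[1].restrict (Set.range fun t : ℝ => x + t • e)) := by
  obtain ⟨μ, hl, hμ⟩ := exists_wlim U ν hG
  refine ⟨μ, hl, hμ, ?_⟩
  have hne : μ ≠ 0 := by
    intro h0
    have lim2 := hμ (fun y => tau 2 3 ‖(0 : V) - y‖) (by fun_prop) (by
      apply HasCompactSupport.intro (isCompact_closedBall (0 : V) 3)
      intro y hy
      rw [mem_closedBall, not_le, dist_comm, dist_eq_norm] at hy
      exact tau_zero hy.le)
    have : 1 ≤ ∫ y, tau 2 3 ‖(0 : V) - y‖ ∂μ := by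
      refine ge_of_tendsto' lim2 fun n => ?_
      have := tau_lower (ν n) (a := 2) (b := 3) (by norm_num) 0
      have := hM n
      linarith
    rw [h0, integral_zero_measure] at this
    linarith
  apply flat_of_dbl (S := μ.support) Measure.isClosed_support Measure.measure_compl_support
    (Measure.nonempty_support hne)
  · intro x hx r hr
    rw [Measure.mem_support_iff_forall] at hx
    exact hx _ (ball_mem_nhds x hr)
  · intro x hx r hr
    exact dbl_of_PP (fun a b ha hab => supp_PP hU hG (by linarith) (hW a b ha hab) hμ hx) r hr

/-- uniform convergence over 1-Lipschitz functions -/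
lemma unif_conv {U : Ultrafilter ℕ} {ν : ℕ → Measure V} [∀ n, IsLocallyFiniteMeasure (ν n)]
    (hG : ∀ R : ℝ, ∃ C : ℝ, ∀ᶠ n in (U : Filter ℕ), (ν n).real (closedBall 0 R) ≤ C)
    {μ : Measure V} [IsLocallyFiniteMeasure μ]
    (hμ : ∀ f : V → ℝ, Continuous f → HasCompactSupport f →
      Filter.Tendsto (fun n => ∫ y, f y ∂(ν n)) U (nhds (∫ y, f y ∂μ)))
    {e : V} (he : ‖e‖ = 1) {η : ℝ} (hη : 0 < η) :
    ∀ᶠ n in (U : Filter ℕ), ∀ f : V → ℝ, LipschitzWith 1 f → Function.support f ⊆ ball 0 2 →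
      |(∫ y, f y ∂(ν n)) - ∫ y, f y ∂μ| ≤ η := by
  by_contra hcon
  rw [← Ultrafilter.eventually_not] at hcon
  have hex : ∀ n, ∃ f : V → ℝ, LipschitzWith 1 f ∧ Function.support f ⊆ ball 0 2 ∧
      ((¬ ∀ f : V → ℝ, LipschitzWith 1 f → Function.support f ⊆ ball 0 2 →
      |(∫ y, f y ∂(ν n)) - ∫ y, f y ∂μ| ≤ η) → η < |(∫ y, f y ∂(ν n)) - ∫ y, f y ∂μ|) := by
    intro n
    by_cases h : ∀ f : V → ℝ, LipschitzWith 1 f → Function.support f ⊆ ball 0 2 →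
      |(∫ y, f y ∂(ν n)) - ∫ y, f y ∂μ| ≤ η
    · exact ⟨fun _ => 0, LipschitzWith.const' 0, by simp, fun h' => absurd h h'⟩
    · have h' := h
      push Not at h'
      obtain ⟨f, h1, h2, h3⟩ := h'
      exact ⟨f, h1, h2, fun _ => h3⟩
  choose F hF1 hF2 hF3 using hex
  have hlip : ∀ n x y, |F n x - F n y| ≤ dist x y := by
    intro n x y
    have := (hF1 n).dist_le_mul x y
    rwa [Real.dist_eq, NNReal.coe_one, one_mul] at this
  have hzero : ∀ n x, x ∉ ball (0 : V) 2 → F n x = 0 := by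
    intro n x hx
    by_contra hc
    exact hx (hF2 n hc)
  have hbd : ∀ n x, |F n x| ≤ dist x ((2 : ℝ) • e) := by
    intro n x
    have := hlip n x ((2 : ℝ) • e)
    rwa [hzero n ((2 : ℝ) • e) (by rw [mem_ball, dist_zero_right, norm_smul, he]; simp), sub_zero] at this
  choose f hf using fun x => ulim' U (u := fun n => F n x) (Filter.Eventually.of_forall (fun n => hbd n x))
  have flip : ∀ x y, |f x - f y| ≤ dist x y := by
    intro x y
    exact le_of_tendsto' (((hf x).sub (hf y)).abs) (fun n => hlip n x y)
  have fzero : ∀ x, x ∉ ball (0 : V) 2 → f x = 0 := by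
    intro x hx
    refine tendsto_nhds_unique (hf x) (tendsto_const_nhds.congr fun n => (hzero n x hx).symm)
  have fcont : Continuous f := by
    have : LipschitzWith 1 f := LipschitzWith.of_dist_le_mul (fun x y => by
      rw [Real.dist_eq, NNReal.coe_one, one_mul]; exact flip x y)
    exact this.continuous
  have fcs : HasCompactSupport f := by
    apply HasCompactSupport.intro (isCompact_closedBall (0 : V) 2)
    intro y hy
    exact fzero y (fun h => hy (ball_subset_closedBall h))
  have Fcs : ∀ n, HasCompactSupport (F n) := by
    intro n
    apply HasCompactSupport.intro (isCompact_closedBall (0 : V) 2)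
    intro y hy
    exact hzero n y (fun h => hy (ball_subset_closedBall h))
  obtain ⟨C, hC⟩ := hG 2
  set M := max (max C (μ.real (closedBall 0 2))) 1 with hM
  have hM1 : 1 ≤ M := le_max_right _ _
  set κ := η / (12 * M) with hκ
  have hκ0 : 0 < κ := by positivity
  obtain ⟨t, ht, hcov⟩ := (isCompact_closedBall (0 : V) 2).totallyBounded.exists_subset
    (Metric.dist_mem_uniformity hκ0)
  obtain ⟨htf, hcov⟩ := hcov
  have ev : ∀ᶠ n in (U : Filter ℕ), ∀ p ∈ t, |F n p - f p| < κ := by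
    rw [Set.Finite.eventually_all htf]
    intro p hp
    have := (((hf p).sub_const (f p)).abs)
    rw [sub_self, abs_zero] at this
    exact this.eventually (gt_mem_nhds hκ0)
  have ev2 := (((hμ f fcont fcs).sub_const (∫ y, f y ∂μ)).abs)
  rw [sub_self, abs_zero] at ev2
  have ev3 := ev2.eventually (gt_mem_nhds (show 0 < η / 4 by positivity))
  obtain ⟨n, h1, h2, h3, h4⟩ := (ev.and (ev3.and (hC.and hcon))).exists
  have hun : ∀ x, |F n x - f x| ≤ 3 * κ := by
    intro x
    by_cases hx : x ∈ ball (0 : V) 2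
    · have := hcov (ball_subset_closedBall hx)
      simp only [Set.mem_iUnion] at this
      obtain ⟨p, hp, hxp⟩ := this
      have hxp' : dist x p < κ := hxp
      have a1 := abs_le.1 (hlip n x p)
      have a2 := abs_lt.1 (h1 p hp)
      have a3 := abs_le.1 (flip x p)
      rw [abs_le]
      constructor <;> linarith [a1.1, a1.2, a2.1, a2.2, a3.1, a3.2]
    · rw [hzero n x hx, fzero x hx]; simp; positivity
  have hz : ∀ y, y ∉ closedBall (0 : V) 2 → F n y - f y = 0 := by
    intro y hy
    have : y ∉ ball (0 : V) 2 := fun h => hy (ball_subset_closedBall h)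
    rw [hzero n y this, fzero y this, sub_zero]
  have b1 := int_bound (ν n) (by positivity) hz hun
  have b2 := int_bound μ (by positivity) hz hun
  have i1 : ∀ σ : Measure V, [IsLocallyFiniteMeasure σ] → ∫ y, (F n y - f y) ∂σ = (∫ y, F n y ∂σ) - ∫ y, f y ∂σ := by
    intro σ _
    exact integral_sub ((hF1 n).continuous.integrable_of_hasCompactSupport (Fcs n))
      (fcont.integrable_of_hasCompactSupport fcs)
  rw [i1] at b1 b2
  have m1 : 3 * κ * (ν n).real (closedBall 0 2) ≤ η / 4 := by
    have : (ν n).real (closedBall 0 2) ≤ M := h3.trans ((le_max_left _ _).trans (le_max_left _ _))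
    calc _ ≤ 3 * κ * M := by gcongr
      _ = η / 4 := by rw [hκ]; field_simp; norm_num
  have m2 : 3 * κ * μ.real (closedBall 0 2) ≤ η / 4 := by
    have : μ.real (closedBall 0 2) ≤ M := (le_max_right _ _).trans (le_max_left _ _)
    calc _ ≤ 3 * κ * M := by gcongr
      _ = η / 4 := by rw [hκ]; field_simp; norm_num
  have h5 := hF3 n h4
  have c1 := abs_le.1 (b1.trans m1)
  have c2 := abs_le.1 (b2.trans m2)
  have c3 := abs_lt.1 h2
  have : |(∫ y, F n y ∂(ν n)) - ∫ y, F n y ∂μ| ≤ η := by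
    rw [abs_le]
    constructor <;> linarith [c1.1, c1.2, c2.1, c2.2, c3.1, c3.2]
  linarith

end
end FlatPf
end

section
open MeasureTheory Metric
open scoped ENNReal NNReal
set_option linter.unusedSectionVars false
set_option linter.unusedVariables false

namespace FlatPf
section
variable {V : Type*} [NormedAddCommGroup V] [InnerProductSpace ℝ V] [FiniteDimensional ℝ V]
  [MeasurableSpace V] [BorelSpace V]
variable {μ : Measure V} [IsLocallyFiniteMeasure μ] {ν : Measure V} [IsLocallyFiniteMeasure ν]

noncomputable def bd (μ : Measure V) (x : V) (r : ℝ) : ℝ :=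
  |(μ (ball x r)).toReal / r - (μ (ball x (2 * r))).toReal / (2 * r)|

noncomputable def DD (μ : Measure V) (δ : ℝ) (x : V) : ℝ≥0∞ :=
  ∫⁻ r in Set.Ioc δ δ⁻¹, ENNReal.ofReal (bd μ x r) / ENNReal.ofReal r

lemma tent (ν : Measure V) [IsLocallyFiniteMeasure ν] {q : V → ℝ} (hq : Measurable q) (a b : ℝ)
    (hi : Integrable (fun y => tau a b (q y)) ν) :
    ∫⁻ r in Set.Ioc a b, ν {y | q y < r} = ENNReal.ofReal (∫ y, tau a b (q y) ∂ν) := by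
  have hs : MeasurableSet {p : ℝ × V | q p.2 < p.1} :=
    measurableSet_lt (hq.comp measurable_snd) measurable_fst
  have h1 := Measure.prod_apply (μ := volume.restrict (Set.Ioc a b)) (ν := ν) hs
  have h2 := Measure.prod_apply_symm (μ := volume.restrict (Set.Ioc a b)) (ν := ν) hs
  rw [ofReal_integral_eq_lintegral_ofReal hi (Filter.Eventually.of_forall fun y => tau_nonneg _ _ _)]
  refine (h1.symm.trans h2).trans ?_
  apply lintegral_congr
  intro y
  have e : (fun r : ℝ => (r, y)) ⁻¹' {p : ℝ × V | q p.2 < p.1} = Set.Ioi (q y) := by ext r; simp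
  rw [e, Measure.restrict_apply measurableSet_Ioi, Set.inter_comm, Set.Ioc_inter_Ioi, Real.volume_Ioc]
  unfold tau
  rcases le_total 0 (b - max a (q y)) with h | h
  · rw [max_eq_right h]
  · rw [max_eq_left h, ENNReal.ofReal_of_nonpos h, ENNReal.ofReal_zero]

lemma tent1 (ν : Measure V) [IsLocallyFiniteMeasure ν] (x : V) (a b : ℝ) :
    ∫⁻ r in Set.Ioc a b, ν (ball x r) = ENNReal.ofReal (∫ y, tau a b ‖x - y‖ ∂ν) := by
  rw [← tent ν (q := fun y => ‖x - y‖) (by fun_prop) a b (integ_tau ν a b x)]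
  apply lintegral_congr
  intro r
  congr 1
  ext y; rw [mem_ball, dist_comm, dist_eq_norm]; rfl

lemma tent2 (ν : Measure V) [IsLocallyFiniteMeasure ν] (x : V) (a b : ℝ) :
    ∫⁻ r in Set.Ioc a b, ν (ball x (2 * r)) = ENNReal.ofReal (∫ y, tau a b (‖x - y‖ / 2) ∂ν) := by
  rw [← tent ν (q := fun y => ‖x - y‖ / 2) (by fun_prop) a b (integ_tau2 ν a b x)]
  apply lintegral_congr
  intro r
  congr 1
  ext y; rw [mem_ball, dist_comm, dist_eq_norm]
  constructor
  · intro h; show ‖x - y‖ / 2 < r; linarith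
  · intro h; have : ‖x - y‖ / 2 < r := h
    linarith

lemma meas_ball_r (ν : Measure V) (x : V) : Measurable fun r : ℝ => ν (ball x r) :=
  (show Monotone fun r : ℝ => ν (ball x r) from fun r s h => measure_mono (ball_subset_ball h)).measurable

lemma bd_pt (ν : Measure V) [IsLocallyFiniteMeasure ν] (x : V) {r b : ℝ} (hr : 0 < r) (hrb : r ≤ b) :
    ν (ball x r) ≤ ν (ball x (2 * r)) / 2 + ENNReal.ofReal (b ^ 2) * (ENNReal.ofReal (bd ν x r) / ENNReal.ofReal r) ∧
    ν (ball x (2 * r)) / 2 ≤ ν (ball x r) + ENNReal.ofReal (b ^ 2) * (ENNReal.ofReal (bd ν x r) / ENNReal.ofReal r) := by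
  have hb0 : 0 ≤ bd ν x r := abs_nonneg _
  have e : ∀ s, ν (ball x s) = ENNReal.ofReal (ν (ball x s)).toReal :=
    fun s => (ENNReal.ofReal_toReal (ball_ne_top _ _ _)).symm
  have h1 : |(ν (ball x r)).toReal - (ν (ball x (2 * r))).toReal / 2| ≤ b ^ 2 * (bd ν x r / r) := by
    have e1 : (ν (ball x r)).toReal - (ν (ball x (2 * r))).toReal / 2 =
        r * ((ν (ball x r)).toReal / r - (ν (ball x (2 * r))).toReal / (2 * r)) := by
      field_simp
    rw [e1, abs_mul, abs_of_pos hr]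
    change r * bd ν x r ≤ _
    rw [show r * bd ν x r = r ^ 2 * (bd ν x r / r) by field_simp]
    gcongr
  rw [abs_le] at h1
  rw [← ENNReal.ofReal_div_of_pos hr, ← ENNReal.ofReal_mul (by positivity), e r, e (2 * r)]
  rw [show (2 : ℝ≥0∞) = ENNReal.ofReal 2 by simp, ← ENNReal.ofReal_div_of_pos two_pos,
    ← ENNReal.ofReal_add (by positivity) (by positivity), ← ENNReal.ofReal_add (by positivity) (by positivity)]
  constructor <;> apply ENNReal.ofReal_le_ofReal <;> linarith [h1.1, h1.2]

lemma PP_le (ν : Measure V) [IsLocallyFiniteMeasure ν] (x : V) {a b δ : ℝ} (ha : 0 < a) (hδ : δ ≤ a)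
    (hb : b ≤ δ⁻¹) : ENNReal.ofReal |PP ν a b x| ≤ ENNReal.ofReal (b ^ 2) * DD ν δ x := by
  set X := ENNReal.ofReal (b ^ 2) * DD ν δ x with hX
  have hsub : Set.Ioc a b ⊆ Set.Ioc δ δ⁻¹ := Set.Ioc_subset_Ioc hδ hb
  have hle : ∫⁻ r in Set.Ioc a b, ENNReal.ofReal (b ^ 2) * (ENNReal.ofReal (bd ν x r) / ENNReal.ofReal r) ≤ X := by
    rw [lintegral_const_mul' _ _ ENNReal.ofReal_ne_top]
    exact mul_le_mul' le_rfl (lintegral_mono_set hsub)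
  have t1 := tent1 ν x a b
  have t2 := tent2 ν x a b
  set s1 := ∫ y, tau a b ‖x - y‖ ∂ν with hs1
  set s2 := ∫ y, tau a b (‖x - y‖ / 2) ∂ν with hs2
  have p1 : 0 ≤ s1 := integral_nonneg fun y => tau_nonneg _ _ _
  have p2 : 0 ≤ s2 := integral_nonneg fun y => tau_nonneg _ _ _
  have m2 : Measurable fun r : ℝ => ν (ball x (2 * r)) := (meas_ball_r ν x).comp (by fun_prop)
  have t3 : ∫⁻ r in Set.Ioc a b, ν (ball x (2 * r)) / 2 = ENNReal.ofReal (s2 / 2) := by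
    simp_rw [div_eq_mul_inv]
    rw [lintegral_mul_const _ m2, t2, ENNReal.ofReal_mul p2, ENNReal.ofReal_inv_of_pos two_pos]
    simp
  have k1 : ENNReal.ofReal s1 ≤ ENNReal.ofReal (s2 / 2) + X := by
    rw [← t1, ← t3]
    refine le_trans ?_ (add_le_add le_rfl hle)
    rw [← lintegral_add_left (m2.div_const 2)]
    exact setLIntegral_mono' measurableSet_Ioc fun r hr => (bd_pt ν x (ha.trans hr.1) hr.2).1
  have k2 : ENNReal.ofReal (s2 / 2) ≤ ENNReal.ofReal s1 + X := by
    rw [← t1, ← t3]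
    refine le_trans ?_ (add_le_add le_rfl hle)
    rw [← lintegral_add_left (meas_ball_r ν x)]
    exact setLIntegral_mono' measurableSet_Ioc fun r hr => (bd_pt ν x (ha.trans hr.1) hr.2).2
  rw [PP_eq, ← hs1, ← hs2]
  rcases le_total s1 (s2 / 2) with h | h
  · rw [abs_of_nonpos (by linarith), neg_sub, ENNReal.ofReal_sub _ p1]
    exact tsub_le_iff_left.2 k2
  · rw [abs_of_nonneg (by linarith), ENNReal.ofReal_sub _ (by positivity)]
    exact tsub_le_iff_left.2 k1

lemma meas_ball_joint (ν : Measure V) [IsLocallyFiniteMeasure ν] (l : ℝ) :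
    Measurable fun p : ℝ × V => ν (ball p.2 (l * p.1)) := by
  have hs : MeasurableSet {p : (ℝ × V) × V | dist p.2 p.1.2 < l * p.1.1} := by
    apply IsOpen.measurableSet
    apply isOpen_lt <;> fun_prop
  exact measurable_measure_prodMk_left (ν := ν) hs

lemma meas_bd (ν : Measure V) [IsLocallyFiniteMeasure ν] :
    Measurable fun p : ℝ × V => ENNReal.ofReal (bd ν p.2 p.1) := by
  have h1 := meas_ball_joint ν 1
  have h2 := meas_ball_joint ν 2
  simp only [one_mul] at h1
  have h3 := h1.ennreal_toReal
  have h4 := h2.ennreal_toReal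
  unfold bd
  apply Measurable.ennreal_ofReal
  exact ((h3.div measurable_fst).sub (h4.div (measurable_fst.const_mul 2))).abs

lemma swap_aux (ν : Measure V) [SFinite ν] (F : V → ℝ → ℝ≥0∞) (hF : Measurable (Function.uncurry F)) (I : Set ℝ) (B : Set V) :
    ∫⁻ x in B, (∫⁻ r in I, F x r / ENNReal.ofReal r) ∂ν = ∫⁻ r in I, (∫⁻ x in B, F x r ∂ν) / ENNReal.ofReal r := by
  have hm2 : Measurable (Function.uncurry fun (x : V) (r : ℝ) => F x r * (ENNReal.ofReal r)⁻¹) :=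
    hF.mul (measurable_snd.ennreal_ofReal.inv)
  simp only [div_eq_mul_inv]
  rw [lintegral_lintegral_swap hm2.aemeasurable]
  apply lintegral_congr
  intro r
  exact lintegral_mul_const _ (hF.comp measurable_prodMk_right)

lemma fubini (ν : Measure V) [IsLocallyFiniteMeasure ν] (δ : ℝ) (B : Set V) :
    ∫⁻ r in Set.Ioc δ δ⁻¹, (∫⁻ x in B, ENNReal.ofReal (bd ν x r) ∂ν) / ENNReal.ofReal r =
      ∫⁻ x in B, DD ν δ x ∂ν := by
  have h := (meas_bd ν).comp measurable_swap
  exact (swap_aux ν (fun x r => ENNReal.ofReal (bd ν x r)) h _ B).symm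

/-- W -/
lemma weak_W {U : Filter ℕ} (hU : U ≤ Filter.atTop) (ν : ℕ → Measure V) [∀ n, IsLocallyFiniteMeasure (ν n)]
    (hD : ∀ n : ℕ, ∫⁻ x in ball 0 ((n : ℝ) + 1), DD (ν n) ((n : ℝ) + 1)⁻¹ x ∂(ν n) ≤
      ENNReal.ofReal (Real.sqrt ((n : ℝ) + 1)⁻¹)) (a b : ℝ) (ha : 0 < a) (hab : a < b) (η : ℝ) (hη : 0 < η) :
    ∀ᶠ n in U, ∫⁻ x in ball 0 ((n : ℝ) + 1), ENNReal.ofReal |PP (ν n) a b x| ∂(ν n) ≤ ENNReal.ofReal η := by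
  have lim0 : Filter.Tendsto (fun n : ℕ => ((n : ℝ) + 1)⁻¹) Filter.atTop (nhds 0) := by
    simpa [one_div] using tendsto_one_div_add_atTop_nhds_zero_nat (𝕜 := ℝ)
  have lim1 : Filter.Tendsto (fun n : ℕ => b ^ 2 * Real.sqrt ((n : ℝ) + 1)⁻¹) Filter.atTop (nhds 0) := by
    have := (Real.continuous_sqrt.tendsto 0).comp lim0
    rw [Real.sqrt_zero] at this
    have h2 := this.const_mul (b ^ 2)
    rwa [mul_zero] at h2
  apply hU
  filter_upwards [lim0.eventually (gt_mem_nhds ha), lim1.eventually (gt_mem_nhds hη),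
    Filter.eventually_ge_atTop ⌈b⌉₊] with n h1 h2 h3
  have h3' : b ≤ n := Nat.ceil_le.1 h3
  calc _ ≤ ∫⁻ x in ball 0 ((n : ℝ) + 1), ENNReal.ofReal (b ^ 2) * DD (ν n) ((n : ℝ) + 1)⁻¹ x ∂(ν n) := by
        apply lintegral_mono
        intro x
        exact PP_le (ν n) x ha h1.le (by rw [inv_inv]; linarith)
    _ ≤ ENNReal.ofReal (b ^ 2) * ENNReal.ofReal (Real.sqrt ((n : ℝ) + 1)⁻¹) := by
        rw [lintegral_const_mul' _ _ ENNReal.ofReal_ne_top]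
        gcongr
        exact hD n
    _ ≤ _ := by
        rw [← ENNReal.ofReal_mul (by positivity)]
        exact ENNReal.ofReal_le_ofReal h2.le

lemma growth {U : Filter ℕ} (hU : U ≤ Filter.atTop) (ν : ℕ → Measure V) [∀ n, IsLocallyFiniteMeasure (ν n)]
    (hD : ∀ n : ℕ, ∫⁻ x in ball 0 ((n : ℝ) + 1), DD (ν n) ((n : ℝ) + 1)⁻¹ x ∂(ν n) ≤
      ENNReal.ofReal (Real.sqrt ((n : ℝ) + 1)⁻¹))
    (hone : ∀ n, ν n (closedBall 0 1) = 1) (hnine : ∀ n, ν n (ball 0 2) ≤ 9) (R : ℝ) :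
    ∃ C : ℝ, ∀ᶠ n in U, (ν n).real (closedBall 0 R) ≤ C := by
  have hx : ∀ n : ℕ, 1 ≤ n → ∃ x ∈ closedBall (0 : V) 1, DD (ν n) ((n : ℝ) + 1)⁻¹ x ≤ 2 := by
    intro n hn
    by_contra! hc
    have hn' : (1 : ℝ) ≤ n := by exact_mod_cast hn
    have h1 : ∫⁻ x in closedBall (0 : V) 1, (2 : ℝ≥0∞) ∂(ν n) ≤ 1 := by
      calc _ ≤ ∫⁻ x in closedBall (0 : V) 1, DD (ν n) ((n : ℝ) + 1)⁻¹ x ∂(ν n) :=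
            setLIntegral_mono' measurableSet_closedBall fun x hx => (hc x hx).le
        _ ≤ ∫⁻ x in ball 0 ((n : ℝ) + 1), DD (ν n) ((n : ℝ) + 1)⁻¹ x ∂(ν n) :=
            lintegral_mono_set (closedBall_subset_ball (by linarith))
        _ ≤ _ := hD n
        _ ≤ ENNReal.ofReal 1 := by
            apply ENNReal.ofReal_le_ofReal
            rw [Real.sqrt_le_one]
            exact inv_le_one_of_one_le₀ (by linarith)
        _ = 1 := ENNReal.ofReal_one
    rw [setLIntegral_const, hone, mul_one] at h1
    norm_num at h1
  choose! x hx1 hx2 using hx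
  have step : ∀ n : ℕ, 1 ≤ n → ∀ b : ℝ, 1 ≤ b → b ≤ n →
      (ν n).real (ball (x n) (3 / 2 * b)) ≤ 2 * (ν n).real (ball (x n) b) + 16 * b := by
    intro n hn b hb hbn
    have hn' : (1 : ℝ) ≤ n := by exact_mod_cast hn
    have h1 := PP_le (ν n) (x n) (a := 3 / 4 * b) (b := b) (δ := ((n : ℝ) + 1)⁻¹) (by positivity)
      (by
        have : ((n : ℝ) + 1)⁻¹ ≤ 2⁻¹ := inv_anti₀ two_pos (by linarith)
        linarith) (by rw [inv_inv]; linarith)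
    have h2 : ENNReal.ofReal |PP (ν n) (3 / 4 * b) b (x n)| ≤ ENNReal.ofReal (b ^ 2 * 2) := by
      refine h1.trans ?_
      rw [ENNReal.ofReal_mul (by positivity)]
      gcongr
      simpa using hx2 n hn
    rw [ENNReal.ofReal_le_ofReal_iff (by positivity), PP_eq, abs_le] at h2
    have h3 := tau_lower2 (ν n) (a := 3 / 4 * b) (b := b) (by linarith) (x n)
    have h4 := tau_upper (ν n) (a := 3 / 4 * b) (b := b) (by linarith) (x n)
    rw [show 2 * (3 / 4 * b) = 3 / 2 * b by ring] at h3
    have h5 : b / 8 * (ν n).real (ball (x n) (3 / 2 * b)) ≤ b / 8 * (2 * (ν n).real (ball (x n) b) + 16 * b) := by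
      linarith [h2.1]
    exact le_of_mul_le_mul_left h5 (by positivity)
  have ind : ∀ k : ℕ, ∃ C : ℝ, ∀ n : ℕ, 1 ≤ n → (3 / 2 : ℝ) ^ k ≤ n → (ν n).real (ball (x n) ((3 / 2 : ℝ) ^ k)) ≤ C := by
    intro k
    induction k with
    | zero =>
      refine ⟨9, fun n hn _ => ?_⟩
      have h1 : ν n (ball (x n) ((3 / 2 : ℝ) ^ 0)) ≤ 9 := by
        refine le_trans (measure_mono (ball_subset_ball' ?_)) (hnine n)
        have := hx1 n hn
        rw [mem_closedBall] at this
        rw [pow_zero]; linarith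
      exact ENNReal.toReal_le_of_le_ofReal (by norm_num) (by simpa using h1)
    | succ k ih =>
      obtain ⟨C, hC⟩ := ih
      refine ⟨2 * C + 16 * (3 / 2) ^ k, fun n hn hk => ?_⟩
      have h1 : (1 : ℝ) ≤ (3 / 2) ^ k := one_le_pow₀ (by norm_num)
      rw [pow_succ'] at hk ⊢
      have hk' : (3 / 2 : ℝ) ^ k ≤ n := by linarith
      have := step n hn _ h1 hk'
      linarith [hC n hn hk']
  obtain ⟨k, hk⟩ := pow_unbounded_of_one_lt (R + 1) (show (1 : ℝ) < 3 / 2 by norm_num)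
  obtain ⟨C, hC⟩ := ind k
  refine ⟨C, hU ?_⟩
  filter_upwards [Filter.eventually_ge_atTop 1, Filter.eventually_ge_atTop ⌈(3 / 2 : ℝ) ^ k⌉₊] with n h1 h2
  refine le_trans (measureReal_mono ?_ (ball_ne_top _ _ _)) (hC n h1 (Nat.ceil_le.1 h2))
  have := hx1 n h1
  rw [mem_closedBall] at this
  apply closedBall_subset_ball'
  rw [dist_comm]
  linarith

/-- The compactness statement for normalised measures. -/
lemma compactness (ν : ℕ → Measure V) [∀ n, IsLocallyFiniteMeasure (ν n)]
    (hD : ∀ n : ℕ, ∫⁻ r in Set.Ioc ((n : ℝ) + 1)⁻¹ (((n : ℝ) + 1)⁻¹)⁻¹,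
      (∫⁻ x in ball 0 ((n : ℝ) + 1), ENNReal.ofReal (bd (ν n) x r) ∂(ν n)) / ENNReal.ofReal r ≤
      ENNReal.ofReal (Real.sqrt ((n : ℝ) + 1)⁻¹))
    (hone : ∀ n, ν n (closedBall 0 1) = 1) (hnine : ∀ n, ν n (ball 0 2) ≤ 9) {η : ℝ} (hη : 0 < η) :
    ∃ n, ∃ a : ℝ, 0 < a ∧ ∃ x e : V, ‖e‖ = 1 ∧ ∀ f : V → ℝ, LipschitzWith 1 f → Function.support f ⊆ ball 0 2 →
      |(∫ y, f y ∂(ν n)) -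
        ∫ y, f y ∂(ENNReal.ofReal a • (μH[1].restrict (Set.range fun t : ℝ => x + t • e)))| ≤ η := by
  have hU : (Filter.hyperfilter ℕ : Filter ℕ) ≤ Filter.atTop := Nat.hyperfilter_le_atTop
  have hD' : ∀ n : ℕ, ∫⁻ x in ball 0 ((n : ℝ) + 1), DD (ν n) ((n : ℝ) + 1)⁻¹ x ∂(ν n) ≤
      ENNReal.ofReal (Real.sqrt ((n : ℝ) + 1)⁻¹) := fun n => by
    rw [← fubini]; exact hD n
  have hG := growth hU ν hD' hone hnine
  obtain ⟨μ, hl, hμ, a, ha, x, e, he, hfl⟩ := limit_flat hU ν hG (fun n => by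
    have h1 : (1 : ℝ≥0∞) ≤ ν n (ball 0 2) := by
      rw [← hone n]; exact measure_mono (closedBall_subset_ball (by norm_num))
    have := ENNReal.toReal_mono (ball_ne_top _ _ _) h1
    simpa [Measure.real] using this) (weak_W hU ν hD')
  obtain ⟨n, hn⟩ := (unif_conv hG hμ he hη).exists
  refine ⟨n, a, ha, x, e, he, ?_⟩
  rw [← hfl]
  exact hn

end
end FlatPf
end

namespace FlatPf
section
variable {V : Type*} [NormedAddCommGroup V] [InnerProductSpace ℝ V] [FiniteDimensional ℝ V]
  [MeasurableSpace V] [BorelSpace V]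

/-- Change of variables on the half line. -/
lemma cov (H : ℝ → ℝ≥0∞) {r₀ : ℝ} (hr : 0 < r₀) (a b : ℝ) :
    ∫⁻ s in Set.Ioc a b, H (r₀ * s) = ENNReal.ofReal r₀⁻¹ * ∫⁻ r in Set.Ioc (a * r₀) (b * r₀), H r := by
  rw [← lintegral_indicator measurableSet_Ioc, ← lintegral_indicator measurableSet_Ioc]
  have h1 := lintegral_map_equiv (μ := (volume : Measure ℝ)) ((Set.Ioc (a * r₀) (b * r₀)).indicator H)
    (MeasurableEquiv.mulLeft₀ r₀ hr.ne')
  have h2 : Measure.map (MeasurableEquiv.mulLeft₀ r₀ hr.ne') (volume : Measure ℝ) = ENNReal.ofReal r₀⁻¹ • volume := by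
    have := Real.map_volume_mul_left hr.ne'
    rw [abs_of_pos (by positivity)] at this
    exact this
  rw [h2, lintegral_smul_measure, smul_eq_mul] at h1
  rw [h1]
  apply lintegral_congr
  intro s
  have e : (MeasurableEquiv.mulLeft₀ r₀ hr.ne') s = r₀ * s := rfl
  rw [e]
  by_cases hs : s ∈ Set.Ioc a b
  · have hs' : r₀ * s ∈ Set.Ioc (a * r₀) (b * r₀) := ⟨by nlinarith [hs.1], by nlinarith [hs.2]⟩
    rw [Set.indicator_of_mem hs, Set.indicator_of_mem hs']
  · have hs' : r₀ * s ∉ Set.Ioc (a * r₀) (b * r₀) := fun h => hs ⟨by nlinarith [h.1], by nlinarith [h.2]⟩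
    rw [Set.indicator_of_notMem hs, Set.indicator_of_notMem hs']

/-- Normalised copy of a measure. -/
noncomputable def resc (μ : Measure V) (x₀ : V) (r₀ m : ℝ) : Measure V :=
  ENNReal.ofReal m⁻¹ • Measure.map (fun y => r₀⁻¹ • (y - x₀)) μ

variable {μ : Measure V} {x₀ : V} {r₀ m : ℝ}

lemma resc_ball (hr : 0 < r₀) (x : V) (r : ℝ) :
    resc μ x₀ r₀ m (ball x r) = ENNReal.ofReal m⁻¹ * μ (ball (x₀ + r₀ • x) (r₀ * r)) := by
  unfold resc
  rw [Measure.smul_apply, smul_eq_mul, Measure.map_apply (by fun_prop) measurableSet_ball]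
  congr 2
  ext y
  simp only [Set.mem_preimage, mem_ball, dist_eq_norm]
  have e : y - (x₀ + r₀ • x) = r₀ • (r₀⁻¹ • (y - x₀) - x) := by
    rw [smul_sub, smul_inv_smul₀ hr.ne']; abel
  rw [e, norm_smul, Real.norm_of_nonneg hr.le, mul_lt_mul_iff_right₀ hr]

lemma resc_closedBall (hr : 0 < r₀) (x : V) (r : ℝ) :
    resc μ x₀ r₀ m (closedBall x r) = ENNReal.ofReal m⁻¹ * μ (closedBall (x₀ + r₀ • x) (r₀ * r)) := by
  unfold resc
  rw [Measure.smul_apply, smul_eq_mul, Measure.map_apply (by fun_prop) measurableSet_closedBall]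
  congr 2
  ext y
  simp only [Set.mem_preimage, mem_closedBall, dist_eq_norm]
  have e : y - (x₀ + r₀ • x) = r₀ • (r₀⁻¹ • (y - x₀) - x) := by
    rw [smul_sub, smul_inv_smul₀ hr.ne']; abel
  rw [e, norm_smul, Real.norm_of_nonneg hr.le, mul_le_mul_iff_right₀ hr]

lemma resc_loc [IsLocallyFiniteMeasure μ] (hr : 0 < r₀) : IsLocallyFiniteMeasure (resc μ x₀ r₀ m) := by
  refine ⟨fun x => ⟨ball x 1, ball_mem_nhds x one_pos, ?_⟩⟩
  rw [resc_ball hr]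
  exact ENNReal.mul_lt_top ENNReal.ofReal_lt_top measure_ball_lt_top

lemma resc_bd (hr : 0 < r₀) (hm : 0 < m) (x : V) {s : ℝ} (hs : 0 < s) :
    bd (resc μ x₀ r₀ m) x s = m⁻¹ * r₀ * bd μ (x₀ + r₀ • x) (r₀ * s) := by
  unfold bd
  rw [resc_ball hr, resc_ball hr, ENNReal.toReal_mul, ENNReal.toReal_mul,
    ENNReal.toReal_ofReal (by positivity), ← abs_of_pos (show 0 < m⁻¹ * r₀ by positivity), ← abs_mul,
    show r₀ * (2 * s) = 2 * (r₀ * s) by ring]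
  congr 1
  field_simp

lemma meas_slice {F : ℝ × V → ℝ≥0∞} (hF : Measurable F) (s : ℝ) : Measurable fun x => F (s, x) :=
  hF.comp measurable_prodMk_left

lemma meas_slice' {F : V × ℝ → ℝ≥0∞} (hF : Measurable F) (s : ℝ) : Measurable fun x => F (x, s) :=
  hF.comp measurable_prodMk_right

lemma meas_bd_x (ν : Measure V) [IsLocallyFiniteMeasure ν] (s : ℝ) :
    Measurable fun x => ENNReal.ofReal (bd ν x s) := by
  have h := meas_slice (meas_bd ν) s
  exact h

lemma resc_inner [IsLocallyFiniteMeasure μ] (hr : 0 < r₀) (hm : 0 < m) {s : ℝ} (hs : 0 < s) (R : ℝ) :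
    ∫⁻ x in ball 0 R, ENNReal.ofReal (bd (resc μ x₀ r₀ m) x s) ∂(resc μ x₀ r₀ m) =
      ENNReal.ofReal (m⁻¹ * (m⁻¹ * r₀)) * ∫⁻ y in ball x₀ (R * r₀), ENNReal.ofReal (bd μ y (r₀ * s)) ∂μ := by
  have := resc_loc (μ := μ) (x₀ := x₀) (m := m) hr
  have hmeas : Measurable fun x => ENNReal.ofReal (bd (resc μ x₀ r₀ m) x s) :=
    meas_bd_x _ s
  obtain ⟨F, hF⟩ : ∃ F : V → ℝ≥0∞, F = fun x => ENNReal.ofReal (bd (resc μ x₀ r₀ m) x s) := ⟨_, rfl⟩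
  have hF' : ∀ x, ENNReal.ofReal (bd (resc μ x₀ r₀ m) x s) = F x := fun x => by rw [hF]
  rw [← hF] at hmeas
  rw [lintegral_congr hF']
  unfold resc
  rw [Measure.restrict_smul, lintegral_smul_measure, smul_eq_mul,
    setLIntegral_map measurableSet_ball hmeas (by fun_prop)]
  have e : (fun y : V => r₀⁻¹ • (y - x₀)) ⁻¹' ball 0 R = ball x₀ (R * r₀) := by
    ext y
    simp only [Set.mem_preimage, mem_ball, dist_eq_norm, sub_zero]
    rw [norm_smul, norm_inv, Real.norm_of_nonneg hr.le, inv_mul_lt_iff₀ hr, mul_comm]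
  rw [e]
  have e2 : ∀ y, F (r₀⁻¹ • (y - x₀)) = ENNReal.ofReal (m⁻¹ * r₀) * ENNReal.ofReal (bd μ y (r₀ * s)) := by
    intro y
    rw [← hF', resc_bd hr hm _ hs, smul_inv_smul₀ hr.ne', add_sub_cancel, ENNReal.ofReal_mul (by positivity)]
  simp_rw [e2]
  rw [lintegral_const_mul' _ _ ENNReal.ofReal_ne_top, ← mul_assoc, ← ENNReal.ofReal_mul (by positivity)]

lemma resc_int [IsLocallyFiniteMeasure μ] (hr : 0 < r₀) (hm : 0 < m) {δ : ℝ} (hδ : 0 < δ)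
    (h : (∫⁻ r in Set.Ioc (δ * r₀) (δ⁻¹ * r₀),
          (∫⁻ x in ball x₀ (δ⁻¹ * r₀), ENNReal.ofReal (bd μ x r) ∂μ) / ENNReal.ofReal r) ≤
        ENNReal.ofReal (Real.sqrt δ * m ^ 2 / r₀)) :
    ∫⁻ s in Set.Ioc δ δ⁻¹, (∫⁻ x in ball 0 δ⁻¹, ENNReal.ofReal (bd (resc μ x₀ r₀ m) x s) ∂(resc μ x₀ r₀ m)) /
      ENNReal.ofReal s ≤ ENNReal.ofReal (Real.sqrt δ) := by
  set I : ℝ → ℝ≥0∞ := fun r => ∫⁻ x in ball x₀ (δ⁻¹ * r₀), ENNReal.ofReal (bd μ x r) ∂μ with hI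
  have h1 : ∫⁻ s in Set.Ioc δ δ⁻¹, (∫⁻ x in ball 0 δ⁻¹, ENNReal.ofReal (bd (resc μ x₀ r₀ m) x s) ∂(resc μ x₀ r₀ m)) /
      ENNReal.ofReal s = ∫⁻ s in Set.Ioc δ δ⁻¹, ENNReal.ofReal (m⁻¹ * (m⁻¹ * r₀) * r₀) *
        (fun r => I r / ENNReal.ofReal r) (r₀ * s) := by
    apply setLIntegral_congr_fun measurableSet_Ioc
    intro s hs
    have hs0 : 0 < s := hδ.trans hs.1
    simp only
    rw [resc_inner hr hm hs0, ENNReal.ofReal_mul hr.le (q := s), ENNReal.ofReal_mul (q := r₀) (by positivity),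
      div_eq_mul_inv, div_eq_mul_inv, ENNReal.mul_inv (by simp) (by simp)]
    have hc : ENNReal.ofReal r₀ * (ENNReal.ofReal r₀)⁻¹ = 1 :=
      ENNReal.mul_inv_cancel (by simpa using hr) ENNReal.ofReal_ne_top
    calc _ = ENNReal.ofReal (m⁻¹ * (m⁻¹ * r₀)) * I (r₀ * s) * (ENNReal.ofReal s)⁻¹ * 1 := by rw [mul_one]
      _ = _ := by rw [← hc]; ring
  rw [h1, lintegral_const_mul' _ _ ENNReal.ofReal_ne_top, cov (fun r => I r / ENNReal.ofReal r) hr]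
  calc _ ≤ ENNReal.ofReal (m⁻¹ * (m⁻¹ * r₀) * r₀) * (ENNReal.ofReal r₀⁻¹ * ENNReal.ofReal (Real.sqrt δ * m ^ 2 / r₀)) :=
        mul_le_mul' le_rfl (mul_le_mul' le_rfl h)
    _ = ENNReal.ofReal (Real.sqrt δ) := by
        rw [← ENNReal.ofReal_mul (by positivity), ← ENNReal.ofReal_mul (by positivity)]
        congr 1
        field_simp

end

section
variable {d : ℕ}

lemma isFlat_map {a : ℝ} (ha : 0 < a) {x e : EuclideanSpace ℝ (Fin d)} (he : ‖e‖ = 1)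
    (x₀ : EuclideanSpace ℝ (Fin d)) {r₀ m : ℝ} (hr : 0 < r₀) (hm : 0 < m) :
    IsFlat (ENNReal.ofReal m • Measure.map (fun z => x₀ + r₀ • z)
      (ENNReal.ofReal a • (μH[1].restrict (Set.range fun t : ℝ => x + t • e)))) := by
  have iso : ∀ x : EuclideanSpace ℝ (Fin d), Isometry (fun t : ℝ => x + t • e) := by
    intro x
    apply Isometry.of_dist_eq
    intro a b
    rw [dist_add_left, dist_eq_norm, dist_eq_norm, ← sub_smul, norm_smul, he, mul_one]
  refine ⟨m * (a * r₀⁻¹), by positivity, Set.range fun t : ℝ => (x₀ + r₀ • x) + t • e,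
    ⟨x₀ + r₀ • x, e, by rintro rfl; simp at he, ?_⟩, ?_⟩
  · ext y; simp only [Set.mem_range, Set.mem_setOf_eq, eq_comm]
  · rw [← (iso x).map_hausdorffMeasure (Or.inl zero_le_one), ← (iso _).map_hausdorffMeasure (Or.inl zero_le_one),
      Measure.map_smul, Measure.map_map (by fun_prop) (iso x).continuous.measurable, hausdorffMeasure_real]
    have e1 : ((fun z : EuclideanSpace ℝ (Fin d) => x₀ + r₀ • z) ∘ fun t : ℝ => x + t • e) =
        (fun t : ℝ => (x₀ + r₀ • x) + t • e) ∘ (fun t => r₀ * t) := by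
      ext1 t
      simp only [Function.comp]
      rw [smul_add, smul_smul]; abel
    rw [e1, ← Measure.map_map (iso _).continuous.measurable (by fun_prop), Real.map_volume_mul_left hr.ne',
      abs_of_pos (by positivity), Measure.map_smul, smul_smul, smul_smul,
      ENNReal.ofReal_mul hm.le, ENNReal.ofReal_mul ha.le, mul_assoc]

lemma dist_scale {μ σ : Measure (EuclideanSpace ℝ (Fin d))} {x₀ : EuclideanSpace ℝ (Fin d)} {r₀ m η : ℝ}
    (hr : 0 < r₀) (hm : 0 < m) (hη : 0 ≤ η)
    (h : ∀ f : EuclideanSpace ℝ (Fin d) → ℝ, LipschitzWith 1 f → Function.support f ⊆ ball 0 2 →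
      |(∫ y, f y ∂(resc μ x₀ r₀ m)) - ∫ y, f y ∂σ| ≤ η) :
    distB (ball x₀ (2 * r₀)) μ (ENNReal.ofReal m • Measure.map (fun z => x₀ + r₀ • z) σ) ≤ η * r₀ * m := by
  unfold distB
  have : Nonempty {f : EuclideanSpace ℝ (Fin d) → ℝ // LipschitzWith 1 f ∧ Function.support f ⊆ ball x₀ (2 * r₀)} :=
    ⟨⟨fun _ => 0, LipschitzWith.const' 0, by simp⟩⟩
  apply ciSup_le
  rintro ⟨f, hf1, hf2⟩
  simp only
  have hfl : ∀ x y, |f x - f y| ≤ dist x y := by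
    intro x y
    have := hf1.dist_le_mul x y
    rwa [Real.dist_eq, NNReal.coe_one, one_mul] at this
  have hfc := hf1.continuous
  have h1 := h (fun z => r₀⁻¹ * f (x₀ + r₀ • z)) (LipschitzWith.of_dist_le_mul (fun x y => by
      rw [Real.dist_eq, NNReal.coe_one, one_mul, ← mul_sub, abs_mul, abs_of_pos (by positivity),
        inv_mul_le_iff₀ hr]
      refine (hfl _ _).trans ?_
      rw [dist_add_left, dist_smul₀, Real.norm_of_nonneg hr.le])) (by
      intro z hz
      have hz' : f (x₀ + r₀ • z) ≠ 0 := fun h0 => hz (by simp [h0])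
      have := hf2 hz'
      rw [mem_ball, dist_eq_norm, add_sub_cancel_left, norm_smul, Real.norm_of_nonneg hr.le, mul_comm 2,
        mul_lt_mul_iff_right₀ hr] at this
      rwa [mem_ball, dist_zero_right])
  rw [integral_const_mul, integral_const_mul, ← mul_sub, abs_mul, abs_of_pos (by positivity),
        inv_mul_le_iff₀ hr] at h1
  have i1 : ∫ y, f (x₀ + r₀ • y) ∂(resc μ x₀ r₀ m) = m⁻¹ * ∫ y, f y ∂μ := by
    unfold resc
    rw [integral_smul_measure, ENNReal.toReal_ofReal (by positivity), smul_eq_mul,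
      integral_map (by fun_prop) (by
        apply Continuous.aestronglyMeasurable; fun_prop)]
    congr 1
    apply integral_congr_ae
    refine Filter.Eventually.of_forall fun y => ?_
    simp only
    rw [smul_inv_smul₀ hr.ne', add_sub_cancel]
  have i2 : ∫ y, f y ∂(ENNReal.ofReal m • Measure.map (fun z => x₀ + r₀ • z) σ) = m * ∫ z, f (x₀ + r₀ • z) ∂σ := by
    rw [integral_smul_measure, ENNReal.toReal_ofReal (by positivity), smul_eq_mul,
      integral_map (by fun_prop) hfc.aestronglyMeasurable]
  rw [i1] at h1
  rw [i2]
  have e1 : (∫ y, f y ∂μ) - m * ∫ z, f (x₀ + r₀ • z) ∂σ = m * (m⁻¹ * (∫ y, f y ∂μ) - ∫ z, f (x₀ + r₀ • z) ∂σ) := by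
    field_simp
  rw [e1, abs_mul, abs_of_pos hm]
  calc _ ≤ m * (r₀ * η) := by gcongr
    _ = _ := by ring

lemma distToFlat_le {B : Set (EuclideanSpace ℝ (Fin d))} {μ σ : Measure (EuclideanSpace ℝ (Fin d))}
    (h : IsFlat σ) : distToFlat B μ ≤ distB B μ σ := by
  unfold distToFlat
  refine ciInf_le (f := fun σ : {σ : Measure (EuclideanSpace ℝ (Fin d)) // IsFlat σ} => distB B μ σ.1) ?_ ⟨σ, h⟩
  refine ⟨0, ?_⟩
  rintro _ ⟨σ, rfl⟩
  exact Real.iSup_nonneg fun f => abs_nonneg _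

end
end FlatPf

theorem stmt9 {d : ℕ} (hd : 1 ≤ d) (ε : ℝ) (hε : 0 < ε) :
    ∃ δ : ℝ, 0 < δ ∧
      ∀ μ : Measure (EuclideanSpace ℝ (Fin d)), IsLocallyFiniteMeasure μ →
      ∀ (x₀ : EuclideanSpace ℝ (Fin d)) (r₀ : ℝ), 0 < r₀ →
      0 < μ (closedBall x₀ r₀) →
      μ (ball x₀ (2 * r₀)) ≤ 9 * μ (closedBall x₀ r₀) →
      (∫⁻ r in Set.Ioc (δ * r₀) (δ⁻¹ * r₀),
          (∫⁻ x in ball x₀ (δ⁻¹ * r₀),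
            ENNReal.ofReal (ballDelta μ x r) ∂μ) / ENNReal.ofReal r) ≤
        ENNReal.ofReal (Real.sqrt δ * (μ (closedBall x₀ r₀)).toReal ^ 2 / r₀) →
      distToFlat (ball x₀ (2 * r₀)) μ < ε * r₀ * (μ (closedBall x₀ r₀)).toReal := by
  by_contra! hcon
  have hpos : ∀ n : ℕ, (0 : ℝ) < ((n : ℝ) + 1)⁻¹ := fun n => by positivity
  choose μ hloc x₀ r₀ hr hm h9 hint hbad using fun n : ℕ => hcon (((n : ℝ) + 1)⁻¹) (hpos n)
  have hfin : ∀ n, μ n (closedBall (x₀ n) (r₀ n)) ≠ ⊤ := fun n =>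
    have := hloc n
    measure_closedBall_lt_top.ne
  set m : ℕ → ℝ := fun n => (μ n (closedBall (x₀ n) (r₀ n))).toReal with hmdef
  have hm0 : ∀ n, 0 < m n := fun n => ENNReal.toReal_pos (hm n).ne' (hfin n)
  have hmE : ∀ n, μ n (closedBall (x₀ n) (r₀ n)) = ENNReal.ofReal (m n) := fun n =>
    (ENNReal.ofReal_toReal (hfin n)).symm
  have hl : ∀ n, IsLocallyFiniteMeasure (FlatPf.resc (μ n) (x₀ n) (r₀ n) (m n)) := fun n =>
    have := hloc n
    FlatPf.resc_loc (hr n)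
  have hcancel : ∀ n, ENNReal.ofReal (m n)⁻¹ * ENNReal.ofReal (m n) = 1 := fun n => by
    rw [← ENNReal.ofReal_mul (inv_nonneg.2 (hm0 n).le), inv_mul_cancel₀ (hm0 n).ne', ENNReal.ofReal_one]
  obtain ⟨n, a, ha, x, e, he, hf⟩ := FlatPf.compactness (fun n => FlatPf.resc (μ n) (x₀ n) (r₀ n) (m n))
    (fun n => by
      have := hloc n
      have h := FlatPf.resc_int (hr n) (hm0 n) (hpos n) (hint n)
      simpa only [inv_inv] using h)
    (fun n => by
      rw [FlatPf.resc_closedBall (hr n), smul_zero, add_zero, mul_one, hmE, hcancel])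
    (fun n => by
      rw [FlatPf.resc_ball (hr n), smul_zero, add_zero, mul_comm (r₀ n)]
      calc _ ≤ ENNReal.ofReal (m n)⁻¹ * (9 * μ n (closedBall (x₀ n) (r₀ n))) := mul_le_mul' le_rfl (h9 n)
        _ = 9 * (ENNReal.ofReal (m n)⁻¹ * ENNReal.ofReal (m n)) := by rw [hmE]; ring
        _ = 9 := by rw [hcancel, mul_one])
    (η := ε / 2) (by positivity)
  have h1 := FlatPf.dist_scale (hr n) (hm0 n) (by positivity) hf
  have h2 := FlatPf.distToFlat_le (B := ball (x₀ n) (2 * r₀ n)) (μ := μ n)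
    (FlatPf.isFlat_map (x := x) ha he (x₀ n) (hr n) (hm0 n))
  have h3 := hbad n
  have h4 : 0 < ε * r₀ n * m n := mul_pos (mul_pos hε (hr n)) (hm0 n)
  have h5 : ε / 2 * r₀ n * m n = (ε * r₀ n * m n) / 2 := by ring
  have h6 : ε * r₀ n * m n ≤ (ε * r₀ n * m n) / 2 := by
    rw [← h5]
    exact h3.trans (h2.trans h1)
  linarith
end

section
/- Let μ be a Radon measure on ℝ^d, let x ∈ ℝ^d and r > 0 be such that μ(B(x, r/2)) > 0. If ∫_{r/2}^{2r} Δ_μ(x,t)² (dt/t) ≤ (1/200)·Θ_μ(B(x,r))², then μ(B(x,2r)) ≤ 9·μ(B(x,r)). -/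
open MeasureTheory Metric
open scoped ENNReal NNReal

theorem lower_aux (f : ℝ → ℝ) (hf : Monotone f) (hf0 : ∀ t, 0 ≤ f t) (r M a b : ℝ) (hr : 0 < r)
    (hM : 0 < M) (ha : r / 2 ≤ a) (hb : b ≤ 2 * r) (hab : a + r / 4 ≤ b)
    (hD : ∀ t, a < t → t ≤ b → M / (2 * r) ≤ |f t / t - f (2 * t) / (2 * t)|) :
    (1 / 200) * (M / r) ^ 2 <
      ∫ t in Set.Ioc (r / 2) (2 * r), |f t / t - f (2 * t) / (2 * t)| ^ 2 / t := by
  have hm : Measurable f := hf.measurable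
  have hint : IntegrableOn (fun t => |f t / t - f (2 * t) / (2 * t)| ^ 2 / t)
      (Set.Ioc (r / 2) (2 * r)) := by
    refine Measure.integrableOn_of_bounded (M := (f (4 * r) / (r / 2)) ^ 2 / (r / 2))
      (by simp) ?_ ?_
    · apply Measurable.aestronglyMeasurable
      have h2 : Measurable (fun t => f (2 * t)) := hm.comp (by fun_prop)
      have h3 : Measurable (fun t : ℝ => f t / t - f (2 * t) / (2 * t)) :=
        (hm.div measurable_id).sub (h2.div (by fun_prop))
      exact ((continuous_abs.measurable.comp h3).pow_const 2).div measurable_id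
    · refine (ae_restrict_iff' measurableSet_Ioc).2 (Filter.Eventually.of_forall ?_)
      intro t ht
      have ht0 : 0 < t := by linarith [ht.1]
      have e1 : f t / t ≤ f (4 * r) / (r / 2) :=
        div_le_div₀ (hf0 _) (hf (by linarith [ht.2])) (by linarith) ht.1.le
      have e2 : f (2 * t) / (2 * t) ≤ f (4 * r) / (r / 2) :=
        div_le_div₀ (hf0 _) (hf (by linarith [ht.2])) (by linarith) (by linarith [ht.1])
      have e3 : 0 ≤ f t / t := div_nonneg (hf0 _) ht0.le
      have e4 : 0 ≤ f (2 * t) / (2 * t) := div_nonneg (hf0 _) (by linarith)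
      rw [Real.norm_of_nonneg (by positivity)]
      refine div_le_div₀ (by positivity) ?_ (by linarith) ht.1.le
      refine pow_le_pow_left₀ (abs_nonneg _) ?_ 2
      rw [abs_le]
      constructor <;> linarith
  have hsub : Set.Ioc a b ⊆ Set.Ioc (r / 2) (2 * r) := Set.Ioc_subset_Ioc ha hb
  have h1 := setIntegral_mono_set hint
    ((ae_restrict_iff' measurableSet_Ioc).2 (Filter.Eventually.of_forall fun t ht => by
      have ht0 : 0 < t := by linarith [ht.1]
      show 0 ≤ _
      positivity)) hsub.eventuallyLE
  have h2 : (M / (2 * r)) ^ 2 / (2 * r) * volume.real (Set.Ioc a b) ≤ 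
      ∫ t in Set.Ioc a b, |f t / t - f (2 * t) / (2 * t)| ^ 2 / t := by
    refine setIntegral_ge_of_const_le_real measurableSet_Ioc (by simp) ?_ (hint.mono_set hsub)
    intro t ht
    have ht0 : 0 < t := by linarith [ht.1]
    refine div_le_div₀ (by positivity) ?_ ht0 (by linarith [ht.2])
    exact pow_le_pow_left₀ (by positivity) (hD t ht.1 ht.2) 2
  rw [Real.volume_real_Ioc_of_le (by linarith)] at h2
  have h3 : (M / (2 * r)) ^ 2 / (2 * r) * (r / 4) ≤ (M / (2 * r)) ^ 2 / (2 * r) * (b - a) := by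
    refine mul_le_mul_of_nonneg_left (by linarith) (by positivity)
  have h4 : (M / (2 * r)) ^ 2 / (2 * r) * (r / 4) = 1 / 32 * (M / r) ^ 2 := by
    field_simp; norm_num
  have h5 : 0 < (M / r) ^ 2 := by positivity
  linarith

theorem stmt10 {d : ℕ} (μ : Measure (EuclideanSpace ℝ (Fin d)))
    [IsLocallyFiniteMeasure μ]
    (x : EuclideanSpace ℝ (Fin d)) (r : ℝ) (hr : 0 < r)
    (hpos : 0 < μ (ball x (r / 2)))
    (h : (∫ t in Set.Ioc (r / 2) (2 * r), (ballDelta μ x t) ^ 2 / t) ≤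
      (1 / 200) * ((μ (ball x r)).toReal / r) ^ 2) :
    μ (ball x (2 * r)) ≤ 9 * μ (ball x r) := by
  have hfin : ∀ t, μ (ball x t) ≠ ∞ := fun t => measure_ball_lt_top.ne
  set f : ℝ → ℝ := fun t => (μ (ball x t)).toReal with hfdef
  have hf : Monotone f := fun s t hst =>
    ENNReal.toReal_mono (hfin t) (measure_mono (ball_subset_ball hst))
  have hf0 : ∀ t, 0 ≤ f t := fun t => ENNReal.toReal_nonneg
  have hM : 0 < f r :=
    lt_of_lt_of_le (ENNReal.toReal_pos hpos.ne' (hfin _)) (hf (by linarith : r / 2 ≤ r))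
  by_contra hcon
  have h9 : 9 * f r < f (2 * r) := by
    have := (ENNReal.toReal_lt_toReal (ENNReal.mul_ne_top (by simp) (hfin r)) (hfin (2 * r))).2
      (not_le.1 hcon)
    simpa [hfdef] using this
  have key : ∀ t, 0 < t → t ≤ 2 * r → f r * 2 ≤ f (2 * t) - 2 * f t ∨
      (t ≤ r ∧ f r ≤ f (2 * t) - 2 * f t) →
      f r / (2 * r) ≤ |f t / t - f (2 * t) / (2 * t)| := by
    intro t ht ht2 hc
    rw [abs_sub_comm]
    refine le_trans ?_ (le_abs_self _)
    have e : f (2 * t) / (2 * t) - f t / t = (f (2 * t) - 2 * f t) / (2 * t) := by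
      field_simp
    rw [e, div_le_div_iff₀ (by linarith) (by linarith)]
    rcases hc with hc | ⟨h1, hc⟩ <;> nlinarith
  refine absurd h (not_le.2 ?_)
  by_cases hc : f (3 * r / 2) ≤ 3 * f r
  · refine lower_aux f hf hf0 r (f r) r (3 * r / 2) hr hM (by linarith) (by linarith)
      (by linarith) ?_
    intro t h1 h2
    have a1 := hf h2
    have a2 := hf (by linarith : 2 * r ≤ 2 * t)
    exact key t (by linarith) (by linarith) (Or.inl (by linarith))
  · refine lower_aux f hf hf0 r (f r) (3 * r / 4) r hr hM (by linarith) (by linarith)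
      (by linarith) ?_
    intro t h1 h2
    have a1 := hf h2
    have a2 := hf (by linarith : 3 * r / 2 ≤ 2 * t)
    exact key t (by linarith) (by linarith) (Or.inr ⟨h2, by linarith⟩)
end
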